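/- Let h be a smooth solution of the Hele-Shaw equation on [0,T]. Then B = B(h)h satisfies the evolution equation ∂_t B − V·∇B + a·G(h)B = γ, where γ = (1+|∇h|²)^{-1}·( G(h)(B² + |V|²) − 2B·G(h)B − 2V·G(h)V ), and moreover γ(t,x) ≤ 0 for all (t,x) ∈ [0,T]×𝕋ⁿ. -/

import Mathlib

open MeasureTheory
open scoped Classical

noncomputable section

/-- ℤⁿ-periodicity for functions on ℝⁿ (model for functions on the torus 𝕋ⁿ = ℝⁿ/ℤⁿ). -/
def ZPeriodic (n : ℕ) (f : (Fin n → ℝ) → ℝ) : Prop :=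
  ∀ (x : Fin n → ℝ) (k : Fin n → ℤ), f (x + fun i => (k i : ℝ)) = f x

/-- ℤⁿ-periodicity in the horizontal variable for functions on ℝⁿ × ℝ. -/
def ZPeriodicE (n : ℕ) (φ : (Fin n → ℝ) × ℝ → ℝ) : Prop :=
  ∀ (x : Fin n → ℝ) (y : ℝ) (k : Fin n → ℤ), φ (x + fun i => (k i : ℝ), y) = φ (x, y)

/-- Fundamental cell of the torus 𝕋ⁿ. -/
def cell (n : ℕ) : Set (Fin n → ℝ) := Set.univ.pi fun _ => Set.Ico (0:ℝ) 1

/-- i-th partial derivative of a function on ℝⁿ. -/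
def pdX (n : ℕ) (f : (Fin n → ℝ) → ℝ) (i : Fin n) (x : Fin n → ℝ) : ℝ :=
  fderiv ℝ f x (Pi.single i 1)

/-- Directional derivative of a function on ℝⁿ × ℝ. -/
def pdE (n : ℕ) (φ : (Fin n → ℝ) × ℝ → ℝ) (v : (Fin n → ℝ) × ℝ)
    (p : (Fin n → ℝ) × ℝ) : ℝ := fderiv ℝ φ p v

def eX (n : ℕ) (i : Fin n) : (Fin n → ℝ) × ℝ := (Pi.single i 1, 0)
def eY (n : ℕ) : (Fin n → ℝ) × ℝ := (0, 1)

/-- Laplacian Δ_{x,y} on ℝⁿ × ℝ. -/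
def lapE (n : ℕ) (φ : (Fin n → ℝ) × ℝ → ℝ) (p : (Fin n → ℝ) × ℝ) : ℝ :=
  (∑ i, pdE n (pdE n φ (eX n i)) (eX n i) p) + pdE n (pdE n φ (eY n)) (eY n) p

/-- |∇_{x,y}φ|². -/
def gradSqE (n : ℕ) (φ : (Fin n → ℝ) × ℝ → ℝ) (p : (Fin n → ℝ) × ℝ) : ℝ :=
  (∑ i, (pdE n φ (eX n i) p)^2) + (pdE n φ (eY n) p)^2

/-- One periodic cell of the fluid domain Ω(h) = {y < h(x)}. -/
def fluidCell (n : ℕ) (h : (Fin n → ℝ) → ℝ) : Set ((Fin n → ℝ) × ℝ) :=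
  {p | p.1 ∈ cell n ∧ p.2 < h p.1}

/-- φ is the harmonic extension of ψ to Ω(h) = {y < h(x)}: it is harmonic in Ω(h),
has boundary value ψ, is periodic in x, and has square-integrable gradient. -/
structure IsHarmonicExt (n : ℕ) (h ψ : (Fin n → ℝ) → ℝ)
    (φ : (Fin n → ℝ) × ℝ → ℝ) : Prop where
  smooth : ContDiff ℝ (⊤ : ℕ∞) φ
  periodic : ZPeriodicE n φ
  harmonic : ∀ p : (Fin n → ℝ) × ℝ, p.2 < h p.1 → lapE n φ p = 0
  boundary : ∀ x, φ (x, h x) = ψ x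
  gradL2 : IntegrableOn (gradSqE n φ) (fluidCell n h)

/-- The Dirichlet-to-Neumann operator:
(G(h)ψ)(x) = ∂_yφ(x,h(x)) − ∇h(x)·∇_xφ(x,h(x)), where φ is the harmonic extension of ψ. -/
def DtN (n : ℕ) (h ψ : (Fin n → ℝ) → ℝ) : (Fin n → ℝ) → ℝ :=
  if H : ∃ φ, IsHarmonicExt n h ψ φ then
    fun x => pdE n H.choose (eY n) (x, h x)
      - ∑ i, pdX n h i x * pdE n H.choose (eX n i) (x, h x)
  else 0

/-- (B(h)ψ)(x) = ∂_yφ(x,h(x)). -/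
def Bop (n : ℕ) (h ψ : (Fin n → ℝ) → ℝ) : (Fin n → ℝ) → ℝ :=
  if H : ∃ φ, IsHarmonicExt n h ψ φ then
    fun x => pdE n H.choose (eY n) (x, h x)
  else 0

/-- (V(h)ψ)(x) = ∇_xφ(x,h(x)). -/
def Vop (n : ℕ) (h ψ : (Fin n → ℝ) → ℝ) : (Fin n → ℝ) → Fin n → ℝ :=
  if H : ∃ φ, IsHarmonicExt n h ψ φ then
    fun x i => pdE n H.choose (eX n i) (x, h x)
  else 0

/-- Divergence of a vector field on the torus. -/
def divX (n : ℕ) (W : (Fin n → ℝ) → Fin n → ℝ) (x : Fin n → ℝ) : ℝ :=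
  ∑ i, pdX n (fun z => W z i) i x

/-- h is a smooth solution of the Hele-Shaw equation ∂ₜh + G(h)h = 0 on [0,T]. -/
structure IsHeleShawSol (n : ℕ) (T : ℝ) (h : ℝ → (Fin n → ℝ) → ℝ) : Prop where
  smooth : ContDiff ℝ (⊤ : ℕ∞) (Function.uncurry h)
  periodic : ∀ t : ℝ, ZPeriodic n (h t)
  extension : ∀ t ∈ Set.Icc 0 T, ∃ φ, IsHarmonicExt n (h t) (h t) φ
  equation : ∀ t ∈ Set.Icc 0 T, ∀ x, deriv (fun s => h s x) t + DtN n (h t) (h t) x = 0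

/-- B(t,x) = (B(h(t,·))h(t,·))(x). -/
def HSB (n : ℕ) (h : ℝ → (Fin n → ℝ) → ℝ) (t : ℝ) (x : Fin n → ℝ) : ℝ :=
  Bop n (h t) (h t) x

/-- V(t,x) = (V(h(t,·))h(t,·))(x). -/
def HSV (n : ℕ) (h : ℝ → (Fin n → ℝ) → ℝ) (t : ℝ) (x : Fin n → ℝ) : Fin n → ℝ :=
  Vop n (h t) (h t) x

/-- The Rayleigh–Taylor coefficient a = 1 − B. -/
def HSa (n : ℕ) (h : ℝ → (Fin n → ℝ) → ℝ) (t : ℝ) (x : Fin n → ℝ) : ℝ :=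
  1 - HSB n h t x

/-- γ = (1+|∇h|²)⁻¹ ( G(h)(B²+|V|²) − 2B G(h)B − 2V·G(h)V ). -/
def HSgamma (n : ℕ) (h : ℝ → (Fin n → ℝ) → ℝ) (t : ℝ) (x : Fin n → ℝ) : ℝ :=
  (1 + ∑ i, (pdX n (h t) i x)^2)⁻¹ *
    ( DtN n (h t) (fun z => (HSB n h t z)^2 + ∑ i, (HSV n h t z i)^2) x
      - 2 * HSB n h t x * DtN n (h t) (fun z => HSB n h t z) x
      - 2 * ∑ i, HSV n h t x i * DtN n (h t) (fun z => HSV n h t z i) x )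

/-- L(h)f = −V·∇f − ½(div V)f + √a G(h)(√a f). -/
def Lop (n : ℕ) (h : ℝ → (Fin n → ℝ) → ℝ) (t : ℝ) (f : (Fin n → ℝ) → ℝ)
    (x : Fin n → ℝ) : ℝ :=
  - (∑ i, HSV n h t x i * pdX n f i x)
  - (1/2) * divX n (HSV n h t) x * f x
  + Real.sqrt (HSa n h t x) * DtN n (h t) (fun z => Real.sqrt (HSa n h t z) * f z) x



noncomputable section

namespace HS
open Set Filter Topology
open scoped ComplexConjugate InnerProductSpace

/-! ### Part 1: the vertical Hilbert space -/

/-- Lebesgue measure on the half line. -/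
abbrev ZM : Measure ℝ := volume.restrict (Set.Iic (0:ℝ))

/-- The vertical Hilbert space. -/
abbrev ZS : Type := Lp ℂ 2 ZM

def efun (z s : ℝ) : ℝ := if s ≤ z then Real.exp (s - z) else 0

lemma efun_nonneg (z s : ℝ) : 0 ≤ efun z s := by
  unfold efun; split_ifs <;> positivity

lemma measurable_efun_uncurry : Measurable (fun p : ℝ × ℝ => efun p.1 p.2) := by
  unfold efun
  apply Measurable.ite (measurableSet_le measurable_snd measurable_fst)
  · fun_prop
  · fun_prop

lemma measurable_efun (z : ℝ) : Measurable (efun z) :=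
  measurable_efun_uncurry.comp (measurable_const.prodMk measurable_id)

/-- integral of exp (a * s) * c over Iic z -/
lemma integrableOn_exp_two (c z : ℝ) :
    IntegrableOn (fun s => Real.exp (2 * s - c)) (Set.Iic z) := by
  have := (integrableOn_exp_mul_Iic (a := 2) (by norm_num) z).const_mul (Real.exp (-c))
  refine this.congr (Filter.Eventually.of_forall fun s => ?_)
  simp only [← Real.exp_add]; ring_nf

lemma integral_exp_two (c z : ℝ) :
    ∫ s in Set.Iic z, Real.exp (2 * s - c) = Real.exp (2 * z - c) / 2 := by
  have h := integral_exp_mul_Iic (a := 2) (by norm_num) z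
  have : ∀ s : ℝ, Real.exp (2 * s - c) = Real.exp (-c) * Real.exp (2 * s) := by
    intro s; rw [← Real.exp_add]; ring_nf
  simp_rw [this]
  rw [integral_const_mul, h]; ring

lemma efun_mul (z w : ℝ) (s : ℝ) :
    efun z s * efun w s = (Set.Iic (min z w)).indicator (fun s => Real.exp (2 * s - (z + w))) s := by
  unfold efun
  by_cases h1 : s ≤ z <;> by_cases h2 : s ≤ w <;> simp [h1, h2, ← Real.exp_add]
  ring_nf

lemma integrable_efun_mul (z w : ℝ) : Integrable (fun s => efun z s * efun w s) ZM := by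
  simp_rw [efun_mul]
  apply Integrable.mono_measure _ Measure.restrict_le_self
  exact (integrableOn_exp_two _ _).integrable_indicator measurableSet_Iic

lemma integral_efun_mul {z w : ℝ} (hz : z ≤ 0) :
    ∫ s, efun z s * efun w s ∂ZM = Real.exp (- |z - w|) / 2 := by
  simp_rw [efun_mul]
  rw [integral_indicator measurableSet_Iic, Measure.restrict_restrict measurableSet_Iic,
    Set.Iic_inter_Iic, min_eq_left (le_trans (min_le_left _ _) hz), integral_exp_two]
  congr 2
  rcases le_total z w with h | h
  · rw [min_eq_left h, abs_of_nonpos (by linarith)]; ring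
  · rw [min_eq_right h, abs_of_nonneg (by linarith)]; ring

lemma memLp_efun (z : ℝ) : MemLp (fun s => (efun z s : ℂ)) 2 ZM := by
  rw [memLp_two_iff_integrable_sq_norm]
  · refine (integrable_efun_mul z z).congr (Filter.Eventually.of_forall fun s => ?_)
    simp [sq]
  · exact (Complex.measurable_ofReal.comp (measurable_efun z)).aestronglyMeasurable

/-- The evaluation vectors. -/
def EV (z : ℝ) : ZS := (memLp_efun (min z 0)).toLp _

lemma EV_coe {z : ℝ} (hz : z ≤ 0) : EV z =ᵐ[ZM] fun s => (efun z s : ℂ) := by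
  have h := (memLp_efun (min z 0)).coeFn_toLp
  unfold EV
  filter_upwards [h] with s hs
  rw [hs, min_eq_left hz]

lemma inner_EV {z : ℝ} (hz : z ≤ 0) (g : ZS) :
    ⟪EV z, g⟫_ℂ = ∫ s, (efun z s : ℂ) * g s ∂ZM := by
  rw [L2.inner_def]
  apply integral_congr_ae
  filter_upwards [EV_coe hz] with s hs
  rw [hs, RCLike.inner_apply]; simp [mul_comm]

lemma inner_EV_EV {z w : ℝ} (hz : z ≤ 0) (hw : w ≤ 0) :
    ⟪EV z, EV w⟫_ℂ = ((Real.exp (- |z - w|) / 2 : ℝ) : ℂ) := by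
  rw [inner_EV hz, ← integral_efun_mul hz, ← integral_complex_ofReal]
  apply integral_congr_ae
  filter_upwards [EV_coe hw] with s hs
  rw [hs]; simp

lemma EV_min (z : ℝ) : EV (min z 0) = EV z := by unfold EV; simp

lemma EV_dist (z w : ℝ) : ‖EV z - EV w‖ ^ 2 = 1 - Real.exp (- |min z 0 - min w 0|) := by
  rw [← EV_min z, ← EV_min w]
  set a := min z 0
  set b := min w 0
  have ha : a ≤ 0 := min_le_right _ _
  have hb : b ≤ 0 := min_le_right _ _
  rw [@norm_sub_sq ℂ, ← inner_self_eq_norm_sq (𝕜 := ℂ), ← inner_self_eq_norm_sq (𝕜 := ℂ),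
    inner_EV_EV ha ha, inner_EV_EV hb hb, inner_EV_EV ha hb]
  simp only [RCLike.re_to_complex, Complex.ofReal_re]
  simp; ring

lemma EV_norm (z : ℝ) : ‖EV z‖ ^ 2 = 1 / 2 := by
  rw [← EV_min z, ← inner_self_eq_norm_sq (𝕜 := ℂ), inner_EV_EV (min_le_right _ _) (min_le_right _ _)]
  simp only [RCLike.re_to_complex, Complex.ofReal_re]
  simp

lemma EV_norm_le (z : ℝ) : ‖EV z‖ ≤ 1 := by
  have := EV_norm z
  nlinarith [norm_nonneg (EV z)]

lemma continuous_EV : Continuous EV := by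
  rw [continuous_iff_continuousAt]
  intro w
  rw [ContinuousAt, tendsto_iff_norm_sub_tendsto_zero]
  have h : Tendsto (fun z => Real.sqrt (1 - Real.exp (- |min z 0 - min w 0|))) (𝓝 w) (𝓝 0) := by
    have : Continuous (fun z => Real.sqrt (1 - Real.exp (- |min z 0 - min w 0|))) := by fun_prop
    have h2 := this.tendsto w
    simpa using h2
  refine h.congr fun z => ?_
  rw [← EV_dist, Real.sqrt_sq (norm_nonneg _)]

/-- continuous representative of `J g` -/
def ev (z : ℝ) (g : ZS) : ℂ := ⟪EV z, g⟫_ℂ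

lemma continuous_ev (g : ZS) : Continuous (fun z => ev z g) := by
  unfold ev
  exact continuous_EV.inner continuous_const

lemma norm_ev_le (z : ℝ) (g : ZS) : ‖ev z g‖ ≤ ‖g‖ := by
  refine (norm_inner_le_norm _ _).trans ?_
  have := EV_norm_le z
  nlinarith [norm_nonneg g]

lemma lintegral_efun_le (z : ℝ) (_hz : z ≤ 0) : ∫⁻ s, ENNReal.ofReal (efun z s) ∂ZM ≤ 1 := by
  have h1 : ∫⁻ s, ENNReal.ofReal (efun z s) ∂ZM ≤ ∫⁻ s, ENNReal.ofReal (efun z s) :=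
    lintegral_mono' Measure.restrict_le_self le_rfl
  refine h1.trans ?_
  have h2 : (fun s => ENNReal.ofReal (efun z s)) =
      (Set.Iic z).indicator (fun s => ENNReal.ofReal (Real.exp (-z) * Real.exp s)) := by
    ext s; unfold efun
    by_cases h : s ≤ z <;> simp [h, ← Real.exp_add]
    ring_nf
  rw [h2, lintegral_indicator measurableSet_Iic, ← ofReal_integral_eq_lintegral_ofReal,
    integral_const_mul, integral_exp_Iic, ← Real.exp_add]
  · simp
  · exact (integrableOn_exp_Iic z).const_mul _
  · exact Filter.Eventually.of_forall fun s => by positivity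

lemma lintegral_efun_le' (s : ℝ) : ∫⁻ z, ENNReal.ofReal (efun z s) ∂ZM ≤ 1 := by
  have h1 : ∫⁻ z, ENNReal.ofReal (efun z s) ∂ZM ≤ ∫⁻ z, ENNReal.ofReal (efun z s) :=
    lintegral_mono' Measure.restrict_le_self le_rfl
  refine h1.trans ?_
  have h2 : (fun z => ENNReal.ofReal (efun z s)) =
      (Set.Ici s).indicator (fun z => ENNReal.ofReal (Real.exp s * Real.exp (-z))) := by
    ext z; unfold efun
    by_cases h : s ≤ z <;> simp [h, ← Real.exp_add]
    ring_nf
  rw [h2, lintegral_indicator measurableSet_Ici, ← ofReal_integral_eq_lintegral_ofReal,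
    integral_const_mul, integral_Ici_eq_integral_Ioi, integral_exp_neg_Ioi, ← Real.exp_add]
  · simp
  · rw [← IntegrableOn, integrableOn_Ici_iff_integrableOn_Ioi]
    exact (integrableOn_exp_neg_Ioi s).const_mul _
  · exact Filter.Eventually.of_forall fun s => by positivity

lemma enorm_ev_sq_le {z : ℝ} (hz : z ≤ 0) (g : ZS) :
    ‖ev z g‖ₑ ^ 2 ≤ ∫⁻ s, ENNReal.ofReal (efun z s) * ‖g s‖ₑ ^ 2 ∂ZM := by
  have hg : AEMeasurable (fun s => ‖g s‖ₑ) ZM := (Lp.aestronglyMeasurable g).enorm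
  have he : AEMeasurable (fun s => ENNReal.ofReal (efun z s)) ZM :=
    (measurable_efun z).ennreal_ofReal.aemeasurable
  set r : ℝ → ENNReal := fun s => ENNReal.ofReal (efun z s) ^ (1/2 : ℝ) with hr
  have hrm : AEMeasurable r ZM := he.pow_const _
  have hrr : ∀ s, r s * r s = ENNReal.ofReal (efun z s) := by
    intro s
    simp only [hr]
    rw [← ENNReal.rpow_add_of_nonneg _ _ (by norm_num) (by norm_num)]
    norm_num
  have h1 : ‖ev z g‖ₑ ≤ ∫⁻ s, (r * (fun s => r s * ‖g s‖ₑ)) s ∂ZM := by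
    unfold ev
    rw [inner_EV hz]
    refine (enorm_integral_le_lintegral_enorm _).trans (le_of_eq ?_)
    apply lintegral_congr
    intro s
    simp only [Pi.mul_apply, ← mul_assoc, hrr]
    rw [enorm_mul]
    congr 1
    rw [← ofReal_norm]
    simp [abs_of_nonneg (efun_nonneg z s)]
  have h2 := ENNReal.lintegral_mul_le_Lp_mul_Lq ZM (p := 2) (q := 2)
    ⟨by norm_num, by norm_num, by norm_num⟩ hrm (hrm.mul hg)
  have h3 := h1.trans h2
  have e1 : ∀ s, r s ^ (2:ℝ) = ENNReal.ofReal (efun z s) := by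
    intro s
    rw [show (2:ℝ) = ((2:ℕ):ℝ) by norm_num, ENNReal.rpow_natCast, sq, hrr]
  have e2 : ∀ s, (r s * ‖g s‖ₑ) ^ (2:ℝ) = ENNReal.ofReal (efun z s) * ‖g s‖ₑ ^ 2 := by
    intro s
    rw [ENNReal.mul_rpow_of_nonneg _ _ (by norm_num), e1]
    norm_num
  have h4 : (∫⁻ s, r s ^ (2:ℝ) ∂ZM) ^ (1/2:ℝ) ≤ 1 := by
    simp_rw [e1]
    calc _ ≤ (1:ENNReal) ^ (1/2:ℝ) :=
          ENNReal.rpow_le_rpow (lintegral_efun_le z hz) (by norm_num)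
      _ = 1 := by simp
  calc ‖ev z g‖ₑ ^ 2 ≤ ((∫⁻ s, ENNReal.ofReal (efun z s) * ‖g s‖ₑ ^ 2 ∂ZM) ^ (1/2:ℝ)) ^ 2 := by
        gcongr
        refine h3.trans ?_
        refine (mul_le_mul_left h4 _).trans ?_
        rw [one_mul]
        apply le_of_eq
        congr 1
        apply lintegral_congr
        intro s
        exact e2 s
    _ = _ := by
        rw [← ENNReal.rpow_natCast, ← ENNReal.rpow_mul]; norm_num

lemma memLp_ev (g : ZS) : MemLp (fun z => ev z g) 2 ZM ∧
    eLpNorm (fun z => ev z g) 2 ZM ≤ eLpNorm g 2 ZM := by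
  have hle : eLpNorm (fun z => ev z g) 2 ZM ≤ eLpNorm g 2 ZM := by
    rw [eLpNorm_eq_lintegral_rpow_enorm_toReal (by norm_num) (by norm_num),
      eLpNorm_eq_lintegral_rpow_enorm_toReal (by norm_num) (by norm_num)]
    simp only [ENNReal.toReal_ofNat]
    apply ENNReal.rpow_le_rpow _ (by norm_num)
    have hg : AEMeasurable (fun s => ‖g s‖ₑ) ZM := (Lp.aestronglyMeasurable g).enorm
    calc ∫⁻ z, ‖ev z g‖ₑ ^ (2:ℝ) ∂ZM
        ≤ ∫⁻ z, ∫⁻ s, ENNReal.ofReal (efun z s) * ‖g s‖ₑ ^ 2 ∂ZM ∂ZM := by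
          apply setLIntegral_mono' measurableSet_Iic
          intro z hz
          rw [show (2:ℝ) = ((2:ℕ):ℝ) by norm_num, ENNReal.rpow_natCast]
          exact enorm_ev_sq_le hz g
      _ = ∫⁻ s, ∫⁻ z, ENNReal.ofReal (efun z s) * ‖g s‖ₑ ^ 2 ∂ZM ∂ZM := by
          apply lintegral_lintegral_swap
          exact (measurable_efun_uncurry.ennreal_ofReal.aemeasurable
            (μ := ZM.prod ZM)).mul ((hg.pow_const 2).comp_snd)
      _ ≤ ∫⁻ s, ‖g s‖ₑ ^ (2:ℝ) ∂ZM := by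
          apply lintegral_mono
          intro s
          simp only
          rw [lintegral_mul_const _ (by
            exact (measurable_efun_uncurry.comp (measurable_id.prodMk measurable_const)).ennreal_ofReal)]
          refine (mul_le_mul_left (lintegral_efun_le' s) _).trans ?_
          rw [one_mul, show (2:ℝ) = ((2:ℕ):ℝ) by norm_num, ENNReal.rpow_natCast]
  refine ⟨⟨(continuous_ev g).aestronglyMeasurable, ?_⟩, hle⟩
  exact hle.trans_lt (Lp.memLp g).2

/-- The operator `J = (1+∂)⁻¹`. -/
def JJ : ZS →L[ℂ] ZS :=
  LinearMap.mkContinuous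
    { toFun := fun g => (memLp_ev g).1.toLp _
      map_add' := by
        intro g k
        rw [← MemLp.toLp_add]
        congr 1
        ext z; simp [ev, inner_add_right]
      map_smul' := by
        intro c g
        simp only [RingHom.id_apply]
        rw [← MemLp.toLp_const_smul]
        congr 1
        ext z; simp [ev, inner_smul_right] } 1 (by
    intro g
    simp only [LinearMap.coe_mk, AddHom.coe_mk, one_mul]
    rw [Lp.norm_toLp, Lp.norm_def]
    exact ENNReal.toReal_mono (Lp.memLp g).2.ne (memLp_ev g).2)

lemma JJ_coe (g : ZS) : JJ g =ᵐ[ZM] fun z => ev z g := (memLp_ev g).1.coeFn_toLp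

lemma integrable_efun_g {z : ℝ} (hz : z ≤ 0) (g : ZS) :
    Integrable (fun s => (efun z s : ℂ) * g s) ZM := by
  have := (memLp_efun z).integrable_mul (Lp.memLp g)
  exact this

lemma ev_EV {z w : ℝ} (hz : z ≤ 0) (hw : w ≤ 0) :
    ev w (EV z) = ((Real.exp (- |z - w|) / 2 : ℝ) : ℂ) := by
  unfold ev; rw [inner_EV_EV hw hz, abs_sub_comm]

lemma inner_JEV {z : ℝ} (hz : z ≤ 0) (g : ZS) :
    Integrable (fun w => ((Real.exp (- |z - w|) / 2 : ℝ) : ℂ) * g w) ZM ∧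
    ⟪JJ (EV z), g⟫_ℂ = ∫ w, ((Real.exp (- |z - w|) / 2 : ℝ) : ℂ) * g w ∂ZM := by
  have hae : (fun w => ⟪JJ (EV z) w, g w⟫_ℂ) =ᵐ[ZM]
      fun w => ((Real.exp (- |z - w|) / 2 : ℝ) : ℂ) * g w := by
    filter_upwards [JJ_coe (EV z), ae_restrict_mem measurableSet_Iic] with w hw hw0
    rw [hw, ev_EV hz hw0, RCLike.inner_apply, Complex.conj_ofReal, mul_comm]
  refine ⟨(L2.integrable_inner (𝕜 := ℂ) (JJ (EV z)) g).congr hae, ?_⟩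
  rw [L2.inner_def]
  exact integral_congr_ae hae

lemma efun_add {z w : ℝ} (h : w ≠ z) : efun z w + efun w z = Real.exp (- |z - w|) := by
  unfold efun
  rcases lt_or_gt_of_ne h with h | h
  · rw [if_pos h.le, if_neg (not_le.2 h), abs_of_pos (by linarith)]; simp
  · rw [if_neg (not_le.2 h), if_pos h.le, abs_of_neg (by linarith)]; simp

lemma two_JEV {z : ℝ} (hz : z ≤ 0) (g : ZS) :
    2 * ⟪JJ (EV z), g⟫_ℂ - ev z g = ∫ w, (efun w z : ℂ) * g w ∂ZM := by
  unfold ev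
  rw [(inner_JEV hz g).2, inner_EV hz, ← integral_const_mul,
    ← integral_sub ((inner_JEV hz g).1.const_mul 2) (integrable_efun_g hz g)]
  apply integral_congr_ae
  have : ∀ᵐ w ∂ZM, w ≠ z := by
    apply ae_restrict_of_ae
    exact Measure.ae_ne volume z
  filter_upwards [this] with w hw
  have := efun_add hw
  have h2 : (efun w z : ℂ) = (Real.exp (- |z - w|) : ℂ) - efun z w := by
    rw [← this]; push_cast; ring
  rw [h2]; push_cast; ring

lemma integrable_prod_efun (g k : ZS) :
    Integrable (fun p : ℝ × ℝ => conj (g p.1) * ((efun p.2 p.1 : ℂ) * k p.2)) (ZM.prod ZM) := by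
  have hg : AEStronglyMeasurable g ZM := Lp.aestronglyMeasurable g
  have hk : AEStronglyMeasurable k ZM := Lp.aestronglyMeasurable k
  have hm : Measurable (fun p : ℝ × ℝ => efun p.2 p.1) :=
    measurable_efun_uncurry.comp measurable_swap
  constructor
  · refine AEStronglyMeasurable.mul ?_ (AEStronglyMeasurable.mul ?_ hk.comp_snd)
    · exact Complex.continuous_conj.comp_aestronglyMeasurable hg.comp_fst
    · exact (Complex.measurable_ofReal.comp hm).aestronglyMeasurable
  · have hb : ∀ p : ℝ × ℝ, ‖conj (g p.1) * ((efun p.2 p.1 : ℂ) * k p.2)‖ₑ ≤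
        ENNReal.ofReal (efun p.2 p.1) * ‖g p.1‖ₑ ^ 2 + ENNReal.ofReal (efun p.2 p.1) * ‖k p.2‖ₑ ^ 2 := by
      intro p
      rw [enorm_mul, enorm_mul]
      have e1 : ‖conj (g p.1)‖ₑ = ENNReal.ofReal ‖g p.1‖ := by rw [ofReal_norm]; simp [enorm]
      have e2 : ‖(efun p.2 p.1 : ℂ)‖ₑ = ENNReal.ofReal (efun p.2 p.1) := by
        rw [← ofReal_norm]; simp [abs_of_nonneg (efun_nonneg _ _)]
      rw [e1, e2, ← ofReal_norm (k p.2), ← ofReal_norm (g p.1)]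
      have h0 := efun_nonneg p.2 p.1
      have h1 := norm_nonneg (g p.1)
      have h2 := norm_nonneg (k p.2)
      rw [← ENNReal.ofReal_mul h0, ← ENNReal.ofReal_mul h1, ← ENNReal.ofReal_pow h1,
        ← ENNReal.ofReal_pow h2, ← ENNReal.ofReal_mul h0, ← ENNReal.ofReal_mul h0,
        ← ENNReal.ofReal_add (by positivity) (by positivity)]
      apply ENNReal.ofReal_le_ofReal
      nlinarith [mul_nonneg h0 (sq_nonneg (‖g p.1‖ - ‖k p.2‖)), mul_nonneg h0 (sq_nonneg (‖g p.1‖)),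
        mul_nonneg h0 (sq_nonneg (‖k p.2‖))]
    have hE := hm.ennreal_ofReal.aemeasurable (μ := ZM.prod ZM)
    have m1 : AEMeasurable (fun p : ℝ × ℝ => ENNReal.ofReal (efun p.2 p.1) * ‖g p.1‖ₑ ^ 2) (ZM.prod ZM) :=
      hE.mul (hg.enorm.pow_const 2).comp_fst
    have m2 : AEMeasurable (fun p : ℝ × ℝ => ENNReal.ofReal (efun p.2 p.1) * ‖k p.2‖ₑ ^ 2) (ZM.prod ZM) :=
      hE.mul (hk.enorm.pow_const 2).comp_snd
    have fin : ∀ g : ZS, ∫⁻ s, ‖g s‖ₑ ^ 2 ∂ZM < ⊤ := by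
      intro g
      have := (Lp.memLp g).2
      rw [eLpNorm_lt_top_iff_lintegral_rpow_enorm_lt_top (by norm_num) (by norm_num)] at this
      simpa using this
    refine lt_of_le_of_lt (lintegral_mono hb) ?_
    rw [lintegral_add_left' m1, lintegral_prod _ m1, lintegral_prod_symm _ m2, ENNReal.add_lt_top]
    constructor
    · refine lt_of_le_of_lt (lintegral_mono (g := fun s => ‖g s‖ₑ ^ 2) fun s => ?_) (fin g)
      simp only
      rw [lintegral_mul_const _ (by
        exact (measurable_efun_uncurry.comp (measurable_id.prodMk measurable_const)).ennreal_ofReal)]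
      refine (mul_le_mul_left (lintegral_efun_le' s) _).trans ?_
      rw [one_mul]
    · refine lt_of_le_of_lt (setLIntegral_mono' (g := fun s => ‖k s‖ₑ ^ 2) measurableSet_Iic
        fun s hs => ?_) (fin k)
      simp only
      rw [lintegral_mul_const _ (measurable_efun s).ennreal_ofReal]
      refine (mul_le_mul_left (lintegral_efun_le s hs) _).trans ?_
      rw [one_mul]

/-- The adjoint of `J`. -/
abbrev JA : ZS →L[ℂ] ZS := ContinuousLinearMap.adjoint JJ

lemma ev_JA (z : ℝ) (k : ZS) : ev z (JA k) = ⟪JJ (EV z), k⟫_ℂ := by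
  unfold ev; rw [ContinuousLinearMap.adjoint_inner_right]

lemma JJ_JA (k : ZS) : (2:ℂ) • JJ (JA k) - JJ k = JA k := by
  apply ext_inner_left ℂ
  intro g
  rw [ContinuousLinearMap.adjoint_inner_right, L2.inner_def, L2.inner_def]
  have h1 : (fun z => ⟪g z, ((2:ℂ) • JJ (JA k) - JJ k : ZS) z⟫_ℂ) =ᵐ[ZM]
      fun z => ∫ w, conj (g z) * ((efun w z : ℂ) * k w) ∂ZM := by
    filter_upwards [JJ_coe k, JJ_coe (JA k), Lp.coeFn_sub ((2:ℂ) • JJ (JA k)) (JJ k),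
      Lp.coeFn_smul (2:ℂ) (JJ (JA k)), ae_restrict_mem measurableSet_Iic] with z a1 a2 a3 a4 hz
    rw [a3, Pi.sub_apply, a4, Pi.smul_apply, a1, a2, ev_JA, smul_eq_mul, two_JEV hz,
      RCLike.inner_apply, mul_comm, integral_const_mul]
  rw [integral_congr_ae h1, integral_integral_swap (integrable_prod_efun g k)]
  apply integral_congr_ae
  filter_upwards [JJ_coe g, ae_restrict_mem measurableSet_Iic] with w a1 hw
  rw [a1, RCLike.inner_apply, ev, inner_EV hw, ← integral_conj, ← integral_const_mul]
  congr 1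
  ext z
  simp; ring

lemma two_J_EV0 : (2:ℂ) • JJ (EV 0) = EV 0 := by
  apply Lp.ext
  filter_upwards [JJ_coe (EV 0), Lp.coeFn_smul (2:ℂ) (JJ (EV 0)), EV_coe le_rfl,
    ae_restrict_mem measurableSet_Iic] with z a1 a2 a3 hz
  rw [a2, Pi.smul_apply, a1, ev_EV le_rfl hz, a3]
  unfold efun
  have hz' : z ≤ 0 := hz
  rw [if_pos hz', zero_sub, abs_neg, abs_of_nonpos hz']
  push_cast
  simp [mul_div_cancel₀]

lemma JJ_norm_le (g : ZS) : ‖JJ g‖ ≤ ‖g‖ := by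
  have h2 : ‖JJ‖ ≤ 1 := LinearMap.mkContinuous_norm_le _ zero_le_one _
  exact (JJ.le_opNorm g).trans (by nlinarith [norm_nonneg g])

lemma integrable_ev_sq (g : ZS) : Integrable (fun z => ‖ev z g‖ ^ 2) ZM :=
  (memLp_two_iff_integrable_sq_norm (continuous_ev g).aestronglyMeasurable).1 (memLp_ev g).1

lemma integral_ev_sq_le (g : ZS) : ∫ z, ‖ev z g‖ ^ 2 ∂ZM ≤ ‖g‖ ^ 2 := by
  have h1 : ‖JJ g‖ ^ 2 = ∫ z, ‖ev z g‖ ^ 2 ∂ZM := by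
    have := L2.inner_def (𝕜 := ℂ) (JJ g) (JJ g)
    rw [inner_self_eq_norm_sq_to_K] at this
    have h3 : ∫ z, ⟪JJ g z, JJ g z⟫_ℂ ∂ZM = ((∫ z, ‖ev z g‖ ^ 2 ∂ZM : ℝ) : ℂ) := by
      rw [← integral_complex_ofReal]
      apply integral_congr_ae
      filter_upwards [JJ_coe g] with z hz
      rw [hz, inner_self_eq_norm_sq_to_K]; simp
    rw [h3] at this
    apply Complex.ofReal_injective
    rw [← this]; simp
  rw [← h1]
  have := JJ_norm_le g
  gcongr

lemma ev_add (z : ℝ) (g k : ZS) : ev z (g + k) = ev z g + ev z k := by simp [ev, inner_add_right]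
lemma ev_sub (z : ℝ) (g k : ZS) : ev z (g - k) = ev z g - ev z k := by simp [ev, inner_sub_right]
lemma ev_smul (z : ℝ) (c : ℂ) (g : ZS) : ev z (c • g) = c * ev z g := by simp [ev, inner_smul_right]

/-- the main differentiation rule in the vertical variable -/
lemma hasDerivWithinAt_ev {k k2 : ZS} (hk : k = JJ k2) {z : ℝ} (hz : z ≤ 0) :
    HasDerivWithinAt (fun z => ev z k) (ev z k2 - ev z k) (Iic 0) z := by
  set f : ℝ → ℂ := fun s => (Real.exp s : ℂ) * ev s k2 with hf
  have hfc : Continuous f := by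
    have := continuous_ev k2
    simp only [hf]; fun_prop
  have key : ∀ z ≤ 0, IntegrableOn f (Iic z) ∧ ev z k = (Real.exp (-z) : ℂ) * ∫ s in Iic z, f s := by
    intro z hz
    have e1 : (fun s => (efun z s : ℂ) * k s) =ᵐ[ZM]
        (Iic z).indicator (fun s => (Real.exp (-z) : ℂ) * f s) := by
      have h := JJ_coe k2
      rw [← hk] at h
      filter_upwards [h] with s hs
      rw [hs]
      unfold efun
      by_cases hsz : s ≤ z
      · simp only [hsz, if_true, mem_Iic, indicator_of_mem, hf, ← mul_assoc]
        rw [← Complex.ofReal_mul, ← Real.exp_add]; ring_nf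
      · simp [hsz]
    have i1 := (integrable_efun_g hz k).congr e1
    rw [integrable_indicator_iff measurableSet_Iic, IntegrableOn,
      Measure.restrict_restrict measurableSet_Iic, Set.Iic_inter_Iic, min_eq_left hz] at i1
    constructor
    · have := i1.const_mul (Real.exp z : ℂ)
      refine this.congr (Eventually.of_forall fun s => ?_)
      simp only [← mul_assoc, ← Complex.ofReal_mul, ← Real.exp_add]
      simp
    · unfold ev
      rw [inner_EV hz, integral_congr_ae e1, integral_indicator measurableSet_Iic,
        Measure.restrict_restrict measurableSet_Iic, Set.Iic_inter_Iic, min_eq_left hz,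
        integral_const_mul]
  have key2 : ∀ z ∈ Iic (0:ℝ), ev z k = (Real.exp (-z) : ℂ) * ((∫ s in Iic 0, f s) + ∫ s in (0:ℝ)..z, f s) := by
    intro z hz
    rw [(key z hz).2, ← intervalIntegral.integral_Iic_sub_Iic (key 0 le_rfl).1 (key z hz).1]
    congr 1; ring
  have hd : HasDerivAt (fun z => (Real.exp (-z) : ℂ) * ((∫ s in Iic 0, f s) + ∫ s in (0:ℝ)..z, f s))
      ((-Real.exp (-z) : ℂ) * ((∫ s in Iic 0, f s) + ∫ s in (0:ℝ)..z, f s) + (Real.exp (-z) : ℂ) * f z) z := by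
    apply HasDerivAt.mul
    · have h1 : HasDerivAt (fun z : ℝ => Real.exp (-z)) (-Real.exp (-z)) z := by
        have := (hasDerivAt_neg z).exp
        simpa using this
      simpa using h1.ofReal_comp
    · exact ((hfc.integral_hasStrictDerivAt 0 z).hasDerivAt).const_add _
  refine (hd.hasDerivWithinAt (s := Iic 0)).congr key2 (key2 z hz) |>.congr_deriv ?_
  rw [key2 z hz]
  simp only [hf]
  have : (Real.exp (-z) : ℂ) * (Real.exp z : ℂ) = 1 := by
    rw [← Complex.ofReal_mul, ← Real.exp_add]; simp
  rw [← mul_assoc, this]; ring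

end HS
end


noncomputable section

namespace HS
open Set Filter Topology
open scoped ComplexConjugate InnerProductSpace ContDiff

/-! ### Part 2: Fourier series -/

lemma norm_iteratedFDeriv_comp_right_le {E F G : Type*} [NormedAddCommGroup E] [NormedSpace ℝ E]
    [NormedAddCommGroup F] [NormedSpace ℝ F] [NormedAddCommGroup G] [NormedSpace ℝ G]
    (g : G →L[ℝ] E) {f : E → F} {k : ℕ} (hf : ContDiff ℝ k f) (x : G) :
    ‖iteratedFDeriv ℝ k (f ∘ g) x‖ ≤ ‖iteratedFDeriv ℝ k f (g x)‖ * ‖g‖ ^ k := by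
  rw [g.iteratedFDeriv_comp_right hf x le_rfl]
  refine (ContinuousMultilinearMap.norm_compContinuousLinearMap_le _ _).trans ?_
  simp

section Fourier
variable {d : ℕ}

/-- phase -/
def lm (m : Fin d → ℤ) : (Fin d → ℝ) →L[ℝ] ℝ :=
  ∑ i, (2 * Real.pi * (m i : ℝ)) • ContinuousLinearMap.proj (R := ℝ) (φ := fun _ : Fin d => ℝ) i

lemma lm_apply (m : Fin d → ℤ) (x : Fin d → ℝ) :
    lm m x = ∑ i, 2 * Real.pi * (m i : ℝ) * x i := by
  simp [lm]

/-- characters -/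
def ee (m : Fin d → ℤ) (x : Fin d → ℝ) : ℂ := Complex.exp (Complex.I * (lm m x : ℝ))

lemma ee_norm (m : Fin d → ℤ) (x : Fin d → ℝ) : ‖ee m x‖ = 1 := by
  unfold ee; rw [mul_comm]; exact Complex.norm_exp_ofReal_mul_I _

lemma ee_ne_zero (m : Fin d → ℤ) (x : Fin d → ℝ) : ee m x ≠ 0 := Complex.exp_ne_zero _

lemma ee_add (m : Fin d → ℤ) (x y : Fin d → ℝ) : ee m (x + y) = ee m x * ee m y := by
  unfold ee; rw [map_add, ← Complex.exp_add]; push_cast; ring_nf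

lemma lm_add (m m' : Fin d → ℤ) (x : Fin d → ℝ) : lm (m + m') x = lm m x + lm m' x := by
  simp only [lm_apply, ← Finset.sum_add_distrib, Pi.add_apply]
  exact Finset.sum_congr rfl fun i _ => by push_cast; ring

lemma lm_neg (m : Fin d → ℤ) (x : Fin d → ℝ) : lm (-m) x = - lm m x := by
  simp only [lm_apply, ← Finset.sum_neg_distrib, Pi.neg_apply]
  exact Finset.sum_congr rfl fun i _ => by push_cast; ring

lemma ee_add_left (m m' : Fin d → ℤ) (x : Fin d → ℝ) : ee (m + m') x = ee m x * ee m' x := by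
  unfold ee; rw [lm_add, ← Complex.exp_add]; push_cast; ring_nf

lemma ee_neg (m : Fin d → ℤ) (x : Fin d → ℝ) : ee (-m) x = conj (ee m x) := by
  unfold ee; rw [lm_neg, ← Complex.exp_conj]; simp

lemma ee_zero (m : Fin d → ℤ) : ee m 0 = 1 := by simp [ee]

lemma ee_zero_left (x : Fin d → ℝ) : ee 0 x = 1 := by simp [ee, lm_apply]

lemma ee_int (m k : Fin d → ℤ) : ee m (fun i => (k i : ℝ)) = 1 := by
  unfold ee
  rw [Complex.exp_eq_one_iff]
  refine ⟨∑ i, m i * k i, ?_⟩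
  rw [lm_apply]; push_cast
  rw [Finset.mul_sum, Finset.sum_mul]
  exact Finset.sum_congr rfl fun i _ => by ring

lemma ee_single (m : Fin d → ℤ) (i : Fin d) (t : ℝ) :
    ee m (t • Pi.single i 1) = Complex.exp (2 * Real.pi * Complex.I * m i * t) := by
  unfold ee
  congr 1
  rw [map_smul, lm_apply]
  simp [Pi.single_apply]; ring

/-- Fourier symbol of `∂_i`. -/
def kap (i : Fin d) (m : Fin d → ℤ) : ℂ := 2 * Real.pi * Complex.I * m i

lemma kap_conj (i : Fin d) (m : Fin d → ℤ) : conj (kap i m) = - kap i m := by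
  have : (starRingEnd ℂ) 2 = 2 := Complex.conj_ofNat 2
  simp [kap, this]

lemma abs_le_norm_int (m : Fin d → ℤ) (i : Fin d) : |(m i : ℝ)| ≤ ‖m‖ := by
  have := norm_le_pi_norm m i
  rwa [Int.norm_eq_abs] at this

lemma kap_norm_le (i : Fin d) (m : Fin d → ℤ) : ‖kap i m‖ ≤ 7 * (1 + ‖m‖) := by
  have h := abs_le_norm_int m i
  have hn := norm_nonneg m
  simp only [kap, norm_mul, Complex.norm_ofNat, Complex.norm_real, Complex.norm_I, mul_one,
    Complex.norm_intCast, Real.norm_eq_abs, abs_of_pos Real.pi_pos]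
  have := Real.pi_lt_d2
  have := Real.pi_pos
  have : 2 * Real.pi ≤ 7 := by linarith
  nlinarith [abs_nonneg (m i : ℝ)]

lemma lm_norm_le (m : Fin d → ℤ) : ‖lm m‖ ≤ (7 * d) * ‖m‖ := by
  refine ContinuousLinearMap.opNorm_le_bound _ (by positivity) fun x => ?_
  rw [lm_apply]
  refine (norm_sum_le _ _).trans ?_
  calc ∑ i, ‖2 * Real.pi * (m i : ℝ) * x i‖ ≤ ∑ i : Fin d, 7 * ‖m‖ * ‖x‖ := by
        apply Finset.sum_le_sum
        intro i _
        have h := abs_le_norm_int m i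
        have h2 := norm_le_pi_norm x i
        have := Real.pi_lt_d2
        have := Real.pi_pos
        have h3 : 2 * Real.pi ≤ 7 := by linarith
        rw [norm_mul, norm_mul, Real.norm_of_nonneg (by positivity), Real.norm_eq_abs]
        gcongr
    _ = _ := by simp; ring

lemma iteratedDeriv_expI (k : ℕ) :
    iteratedDeriv k (fun t : ℝ => Complex.exp (Complex.I * (t : ℝ))) =
      fun t : ℝ => Complex.I ^ k * Complex.exp (Complex.I * (t : ℝ)) := by
  induction k with
  | zero => simp
  | succ k ih =>
    rw [iteratedDeriv_succ, ih]
    ext t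
    have h1 : HasDerivAt (fun t : ℝ => Complex.I * (t : ℂ)) (Complex.I * 1) t :=
      (Complex.ofRealCLM.hasDerivAt (x := t)).const_mul _
    have := (h1.cexp).const_mul (Complex.I ^ k)
    rw [this.deriv]; ring

lemma contDiff_ee (m : Fin d → ℤ) {N} : ContDiff ℝ N (ee m) := by
  unfold ee
  apply ContDiff.cexp
  exact contDiff_const.mul (Complex.ofRealCLM.contDiff.comp (lm m).contDiff)

lemma norm_iteratedFDeriv_ee (m : Fin d → ℤ) (k : ℕ) (x : Fin d → ℝ) :
    ‖iteratedFDeriv ℝ k (ee m) x‖ ≤ ((7 * d) * ‖m‖) ^ k := by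
  have hc : ContDiff ℝ k (fun t : ℝ => Complex.exp (Complex.I * (t : ℝ))) := by
    apply ContDiff.cexp
    exact contDiff_const.mul Complex.ofRealCLM.contDiff
  have := norm_iteratedFDeriv_comp_right_le (lm m) hc x
  have e : (fun t : ℝ => Complex.exp (Complex.I * (t : ℝ))) ∘ (lm m) = ee m := rfl
  rw [e] at this
  refine this.trans ?_
  rw [norm_iteratedFDeriv_eq_norm_iteratedDeriv, iteratedDeriv_expI]
  have h1 : ‖Complex.I ^ k * Complex.exp (Complex.I * ((lm m x : ℝ) : ℂ))‖ = 1 := by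
    rw [norm_mul, norm_pow, Complex.norm_I, mul_comm Complex.I, Complex.norm_exp_ofReal_mul_I]; simp
  rw [h1, one_mul]
  exact pow_le_pow_left₀ (norm_nonneg _) (lm_norm_le m) k

/-- rapid decay -/
def Rapid {Y : Type*} [Norm Y] (c : (Fin d → ℤ) → Y) : Prop :=
  ∀ N : ℕ, ∃ C : ℝ, ∀ m, (1 + ‖m‖) ^ N * ‖c m‖ ≤ C

lemma summable_int_sq : Summable (fun m : ℤ => (1 + (m:ℝ)^2)⁻¹) := by
  have h1 : Summable (fun m : ℤ => 1 / (m:ℝ)^2) := Real.summable_one_div_int_pow.2 (by norm_num)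
  refine Summable.of_norm_bounded_eventually h1 ?_
  filter_upwards [(Set.finite_singleton (0:ℤ)).compl_mem_cofinite] with m hm
  have : (m:ℝ) ≠ 0 := by simpa using hm
  rw [Real.norm_of_nonneg (by positivity), one_div]
  gcongr
  linarith

lemma summable_prod (d : ℕ) : Summable (fun m : Fin d → ℤ => ∏ i, (1 + (m i:ℝ)^2)⁻¹) := by
  induction d with
  | zero => exact Summable.of_finite
  | succ d ih =>
    rw [← (Fin.consEquiv (fun _ : Fin (d+1) => ℤ)).summable_iff]
    have := summable_int_sq.mul_of_nonneg ih (fun m => by positivity)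
      (fun m => Finset.prod_nonneg fun i _ => by positivity)
    refine this.congr fun p => ?_
    simp [Fin.consEquiv, Fin.prod_univ_succ, mul_comm]

lemma summable_weight : Summable (fun m : Fin d → ℤ => ((1 + ‖m‖) ^ (2 * d))⁻¹) := by
  refine Summable.of_nonneg_of_le (fun m => by positivity) (fun m => ?_) (summable_prod d)
  rw [Finset.prod_inv_distrib]
  apply inv_anti₀ (Finset.prod_pos fun i _ => by positivity)
  rw [pow_mul]
  calc ∏ i, (1 + (m i:ℝ)^2) ≤ ∏ i : Fin d, (1 + ‖m‖)^2 := by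
        apply Finset.prod_le_prod
        · intro i _; positivity
        · intro i _
          have h := abs_le_norm_int m i
          have hn := norm_nonneg m
          rw [← sq_abs (m i:ℝ)]
          nlinarith [abs_nonneg (m i : ℝ)]
    _ = _ := by simp

section Y
set_option linter.unusedSectionVars false
variable {Y : Type*} [NormedAddCommGroup Y]
variable {Y' : Type*} [NormedAddCommGroup Y']

lemma Rapid.of_le {c : (Fin d → ℤ) → Y} (hc : Rapid c) {c' : (Fin d → ℤ) → Y'} (K : ℝ) (N : ℕ)
    (h : ∀ m, ‖c' m‖ ≤ K * (1 + ‖m‖) ^ N * ‖c m‖) : Rapid c' := by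
  intro M
  obtain ⟨C, hC⟩ := hc (N + M)
  refine ⟨|K| * C, fun m => ?_⟩
  calc (1 + ‖m‖) ^ M * ‖c' m‖ ≤ (1 + ‖m‖) ^ M * (|K| * (1 + ‖m‖) ^ N * ‖c m‖) := by
        gcongr
        refine (h m).trans ?_
        gcongr
        exact le_abs_self K
    _ = |K| * ((1 + ‖m‖) ^ (N + M) * ‖c m‖) := by rw [pow_add]; ring
    _ ≤ _ := by gcongr; exact hC m

lemma Rapid.summable_pow {c : (Fin d → ℤ) → Y} (hc : Rapid c) (N : ℕ) :
    Summable (fun m => (1 + ‖m‖) ^ N * ‖c m‖) := by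
  obtain ⟨C, hC⟩ := hc (N + 2 * d)
  refine Summable.of_nonneg_of_le (fun m => by positivity) (fun m => ?_)
    (summable_weight.mul_left C)
  rw [← div_eq_mul_inv, le_div_iff₀ (by positivity)]
  refine le_trans (le_of_eq ?_) (hC m)
  rw [pow_add]; ring

lemma Rapid.summable_norm {c : (Fin d → ℤ) → Y} (hc : Rapid c) : Summable (fun m => ‖c m‖) := by
  simpa using hc.summable_pow 0

variable [NormedSpace ℂ Y] [NormedSpace ℝ Y] [IsScalarTower ℝ ℂ Y]

/-- Fourier synthesis -/
def FS (c : (Fin d → ℤ) → Y) (x : Fin d → ℝ) : Y := ∑' m, ee m x • c m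

lemma Rapid.kap_smul {c : (Fin d → ℤ) → Y} (hc : Rapid c) (i : Fin d) :
    Rapid (fun m => kap i m • c m) := by
  refine hc.of_le 7 1 fun m => ?_
  rw [norm_smul, pow_one]
  gcongr
  exact kap_norm_le i m

lemma norm_iteratedFDeriv_ee_smul (m : Fin d → ℤ) (c : Y) (k : ℕ) (x : Fin d → ℝ) :
    ‖iteratedFDeriv ℝ k (fun x => ee m x • c) x‖ ≤ (7 * d) ^ k * ((1 + ‖m‖) ^ k * ‖c‖) := by
  set L : ℂ →L[ℝ] Y := (ContinuousLinearMap.toSpanSingleton ℂ c).restrictScalars ℝ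
  have e : (fun x => ee m x • c) = L ∘ (ee m) := by ext x; simp [L]
  rw [e]
  refine (L.norm_iteratedFDeriv_comp_left (contDiff_ee m).contDiffAt (n := k) (le_refl _)).trans ?_
  have h1 : ‖L‖ ≤ ‖c‖ := by
    refine ContinuousLinearMap.opNorm_le_bound _ (norm_nonneg _) fun z => ?_
    simp [L, norm_smul, mul_comm]
  have h2 := norm_iteratedFDeriv_ee m k x
  calc _ ≤ ‖c‖ * ((7 * d) * ‖m‖) ^ k := by gcongr
    _ ≤ ‖c‖ * ((7 * d) * (1 + ‖m‖)) ^ k := by gcongr; linarith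
    _ = _ := by rw [mul_pow]; ring

variable [CompleteSpace Y]

lemma Rapid.summable_ee {c : (Fin d → ℤ) → Y} (hc : Rapid c) (x : Fin d → ℝ) :
    Summable (fun m => ee m x • c m) := by
  apply Summable.of_norm
  simpa [norm_smul, ee_norm] using hc.summable_norm

lemma Rapid.contDiff {c : (Fin d → ℤ) → Y} (hc : Rapid c) : ContDiff ℝ ∞ (FS c) := by
  refine contDiff_tsum (v := fun k m => (7 * d) ^ k * ((1 + ‖m‖) ^ k * ‖c m‖))
    (fun m => (contDiff_ee m).smul contDiff_const) (fun k _ => ?_) (fun k m x _ => ?_)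
  · exact (hc.summable_pow k).mul_left _
  · exact norm_iteratedFDeriv_ee_smul m (c m) k x

lemma hasFDerivAt_ee (m : Fin d → ℤ) (x : Fin d → ℝ) (i : Fin d) :
    fderiv ℝ (ee m) x (Pi.single i 1) = kap i m * ee m x := by
  have h1 : HasFDerivAt (fun x => Complex.I * ((lm m x : ℝ) : ℂ)) (Complex.I • (Complex.ofRealCLM.comp (lm m))) x :=
    ((Complex.ofRealCLM.comp (lm m)).hasFDerivAt).const_mul Complex.I
  have h2 := h1.cexp
  have e : ee m = fun x => Complex.exp (Complex.I * ((lm m x : ℝ) : ℂ)) := rfl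
  rw [e, h2.fderiv]
  simp [lm_apply, kap, Pi.single_apply]
  ring

lemma Rapid.fderiv {c : (Fin d → ℤ) → Y} (hc : Rapid c) (i : Fin d) (x : Fin d → ℝ) :
    fderiv ℝ (FS c) x (Pi.single i 1) = FS (fun m => kap i m • c m) x := by
  have hd : ∀ m, Differentiable ℝ (fun x => ee m x • c m) := fun m =>
    ((contDiff_ee m (N := 1)).smul contDiff_const).differentiable (by norm_num)
  have hb : ∀ m x, ‖_root_.fderiv ℝ (fun x => ee m x • c m) x‖ ≤ (7 * d) ^ 1 * ((1 + ‖m‖) ^ 1 * ‖c m‖) := by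
    intro m x
    rw [← norm_iteratedFDeriv_one]
    exact norm_iteratedFDeriv_ee_smul m (c m) 1 x
  have hs : Summable (fun m => (7 * (d:ℝ)) ^ 1 * ((1 + ‖m‖) ^ 1 * ‖c m‖)) := (hc.summable_pow 1).mul_left _
  have := fderiv_tsum_apply (𝕜 := ℝ) hs hd hb (x₀ := 0) (hc.summable_ee 0) x
  have e : FS c = fun y => ∑' m, ee m y • c m := rfl
  have hap := (ContinuousLinearMap.apply ℝ Y (Pi.single i (1:ℝ) : Fin d → ℝ)).map_tsum
    (Summable.of_norm_bounded hs fun m => hb m x)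
  simp only [ContinuousLinearMap.apply_apply] at hap
  rw [e, this, hap]
  unfold FS
  congr 1
  ext m
  have h3 := (((contDiff_ee m (N := 1)).differentiable (by norm_num)) x).hasFDerivAt.smul_const (c m)
  rw [h3.fderiv]
  simp only [ContinuousLinearMap.smulRight_apply, hasFDerivAt_ee]
  rw [mul_comm, mul_smul]

end Y
end Fourier

end HS
end


noncomputable section

namespace HS
open Set Filter Topology
open scoped ComplexConjugate InnerProductSpace ContDiff

section Fourier2
variable {d : ℕ}

/-- periodicity -/
def Per {Y : Type*} (f : (Fin d → ℝ) → Y) : Prop :=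
  ∀ (x : Fin d → ℝ) (k : Fin d → ℤ), f (x + fun i => (k i : ℝ)) = f x

/-- unit box -/
def bx (a : Fin d → ℝ) : Set (Fin d → ℝ) := {x | ∀ i, x i ∈ Ioc (a i) (a i + 1)}

lemma measurableSet_bx (a : Fin d → ℝ) : MeasurableSet (bx a) :=
  MeasurableSet.univ_pi' (fun _ => measurableSet_Ioc)

lemma bx_subset (a : Fin d → ℝ) : bx a ⊆ Icc a (a + 1) :=
  fun x hx => ⟨fun i => (hx i).1.le, fun i => (hx i).2⟩

lemma volume_bx_lt (a : Fin d → ℝ) : volume (bx a) < ⊤ :=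
  (measure_mono (bx_subset a)).trans_lt isCompact_Icc.measure_lt_top

lemma volume_bx_zero : volume (bx (0 : Fin d → ℝ)) = 1 := by
  have : bx (0 : Fin d → ℝ) = Set.univ.pi fun _ => Ioc (0:ℝ) 1 := by
    ext x; simp [bx]
  rw [this, Real.volume_pi_Ioc]; simp

lemma setIntegral_bx {Y : Type*} [NormedAddCommGroup Y] [NormedSpace ℝ Y]
    (g : (Fin d → ℝ) → Y) (a : Fin d → ℝ) :
    ∫ x in bx a, g x = ∫ x in bx 0, g (x + a) := by
  have h := (measurePreserving_add_right (volume : Measure (Fin d → ℝ)) a).setIntegral_preimage_emb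
    (MeasurableEquiv.addRight a).measurableEmbedding g (bx a)
  rw [← h]
  have : (fun x => x + a) ⁻¹' bx a = bx 0 := by
    ext x; simp [bx]
    refine forall_congr' fun i => ?_
    rw [add_comm (x i) (a i)]
    simp
  rw [this]

lemma Per.bounded {Y : Type*} [NormedAddCommGroup Y] {f : (Fin d → ℝ) → Y} (hp : Per f)
    (hf : Continuous f) : ∃ C, ∀ x, ‖f x‖ ≤ C := by
  obtain ⟨C, hC⟩ := (isCompact_Icc (a := (0 : Fin d → ℝ)) (b := 1)).exists_bound_of_continuousOn
    hf.continuousOn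
  refine ⟨C, fun x => ?_⟩
  rw [← hp x (fun i => -⌊x i⌋)]
  apply hC
  constructor
  · intro i; simp [Int.floor_le]
  · intro i; simp; have := Int.lt_floor_add_one (x i); linarith

/-- partial derivative -/
def DD {Y : Type*} [NormedAddCommGroup Y] [NormedSpace ℝ Y] (i : Fin d) (f : (Fin d → ℝ) → Y)
    (x : Fin d → ℝ) : Y := fderiv ℝ f x (Pi.single i 1)

lemma contDiff_DD {Y : Type*} [NormedAddCommGroup Y] [NormedSpace ℝ Y] {i : Fin d}
    {f : (Fin d → ℝ) → Y} (hf : ContDiff ℝ ∞ f) : ContDiff ℝ ∞ (DD i f) :=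
  (hf.fderiv_right (m := ∞) (by simp)).clm_apply contDiff_const

lemma Per.DD {Y : Type*} [NormedAddCommGroup Y] [NormedSpace ℝ Y] {i : Fin d}
    {f : (Fin d → ℝ) → Y} (hf : Per f) : Per (DD i f) := by
  intro x k
  unfold HS.DD
  rw [← fderiv_comp_add_right]
  simp only [hf _ k]

lemma mFourier_coe (m : Fin d → ℤ) (x : Fin d → ℝ) :
    UnitAddTorus.mFourier m (fun i => (x i : UnitAddCircle)) = ee m x := by
  simp only [UnitAddTorus.mFourier, ContinuousMap.coe_mk, fourier_coe_apply, ee, lm_apply]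
  rw [← Complex.exp_sum]
  congr 1
  push_cast
  rw [Finset.mul_sum]
  exact Finset.sum_congr rfl fun i _ => by ring

/-- lift to the torus -/
def tl (f : (Fin d → ℝ) → ℂ) : UnitAddTorus (Fin d) → ℂ :=
  fun θ => f (fun i => (AddCircle.equivIoc 1 0 (θ i)).1)

lemma tl_coe {f : (Fin d → ℝ) → ℂ} (hf : Per f) (x : Fin d → ℝ) :
    tl f (fun i => (x i : UnitAddCircle)) = f x := by
  unfold tl
  have h : ∀ i, ∃ k : ℤ, ((AddCircle.equivIoc 1 0 (x i : UnitAddCircle)).1 : ℝ) = x i + k := by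
    intro i
    have h1 : (((AddCircle.equivIoc 1 0 (x i : UnitAddCircle)).1 : ℝ) : UnitAddCircle) = (x i : UnitAddCircle) :=
      (AddCircle.equivIoc 1 0).symm_apply_apply _
    have h2 := (QuotientAddGroup.eq.1 h1.symm)
    obtain ⟨k, hk⟩ := AddSubgroup.mem_zmultiples_iff.1 h2
    refine ⟨k, ?_⟩
    simp at hk
    linarith
  choose k hk using h
  rw [← hf x k]
  congr 1
  ext i; exact hk i

lemma continuous_tl {f : (Fin d → ℝ) → ℂ} (hf : Per f) (hc : Continuous f) : Continuous (tl f) := by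
  have hq : IsOpenQuotientMap (Pi.map (fun _ : Fin d => ((↑) : ℝ → UnitAddCircle))) :=
    IsOpenQuotientMap.piMap fun _ => QuotientAddGroup.isOpenQuotientMap_mk
  rw [← hq.continuous_comp_iff]
  have : tl f ∘ (Pi.map (fun _ : Fin d => ((↑) : ℝ → UnitAddCircle))) = f := by
    ext x; exact tl_coe hf x
  rw [this]; exact hc

/-- Fourier coefficient -/
def fc (f : (Fin d → ℝ) → ℂ) (m : Fin d → ℤ) : ℂ := UnitAddTorus.mFourierCoeff (tl f) m

lemma fc_eq {f : (Fin d → ℝ) → ℂ} (hf : Per f) (m : Fin d → ℤ) (a : Fin d → ℝ) :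
    fc f m = ∫ x in bx a, ee (-m) x * f x := by
  unfold fc
  rw [UnitAddTorus.mFourierCoeff_eq_integral _ m a]
  apply setIntegral_congr_fun (measurableSet_bx a)
  intro x _
  simp only [mFourier_coe, tl_coe hf, smul_eq_mul]

lemma fc_bound {f : (Fin d → ℝ) → ℂ} (hf : Per f) (hc : Continuous f) :
    ∃ C, ∀ m, ‖fc f m‖ ≤ C := by
  obtain ⟨C, hC⟩ := hf.bounded hc
  refine ⟨C, fun m => ?_⟩
  rw [fc_eq hf m 0]
  refine (norm_setIntegral_le_of_norm_le_const (C := C) (volume_bx_lt _) fun x _ => ?_).trans ?_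
  · rw [norm_mul, ee_norm, one_mul]; exact hC x
  · simp [Measure.real, volume_bx_zero]

lemma fc_trans {f : (Fin d → ℝ) → ℂ} (hf : Per f) (m : Fin d → ℤ) (a : Fin d → ℝ) :
    ∫ x in bx 0, ee (-m) x * f (x + a) = ee m a * fc f m := by
  rw [fc_eq hf m a, setIntegral_bx _ a, ← integral_const_mul]
  congr 1
  ext x
  rw [ee_add, ee_neg m a]
  have : ee m a * conj (ee m a) = 1 := by
    rw [Complex.mul_conj, Complex.normSq_eq_norm_sq, ee_norm]; simp
  calc ee (-m) x * f (x + a) = (ee m a * conj (ee m a)) * (ee (-m) x * f (x + a)) := by rw [this, one_mul]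
    _ = _ := by ring

lemma fc_DD {f : (Fin d → ℝ) → ℂ} (hf : Per f) (hs : ContDiff ℝ ∞ f) (m : Fin d → ℤ) (i : Fin d) :
    fc (DD i f) m = kap i m * fc f m := by
  obtain ⟨C, hC⟩ := (hf.DD (i := i)).bounded (contDiff_DD hs).continuous
  have h1 : HasDerivAt (fun t : ℝ => ∫ x in bx 0, ee (-m) x * f (x + t • Pi.single i 1))
      (∫ x in bx 0, ee (-m) x * DD i f (x + (0:ℝ) • Pi.single i 1)) 0 := by
    have hDDv : ∀ y, DD i f y = fderiv ℝ f y (Pi.single i 1) := fun y => rfl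
    have cD := (contDiff_DD (i := i) hs).continuous
    generalize DD i f = Df at hC cD hDDv
    generalize (Pi.single i 1 : Fin d → ℝ) = v at hDDv
    have cf := hs.continuous
    have ce := (contDiff_ee (-m) (N := 1)).continuous
    have p1 : ∀ t : ℝ, Continuous (fun x => ee (-m) x * f (x + t • v)) := fun t => by fun_prop
    have p2 : ∀ t : ℝ, Continuous (fun x => ee (-m) x * Df (x + t • v)) := fun t => by fun_prop
    have p3 : ∀ (x : Fin d → ℝ) (t : ℝ), HasDerivAt (fun t : ℝ => ee (-m) x * f (x + t • v))
        (ee (-m) x * Df (x + t • v)) t := by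
      intro x t
      refine HasDerivAt.const_mul (ee (-m) x) ?_
      have hd : HasFDerivAt f (fderiv ℝ f (x + t • v)) (x + t • v) :=
        (hs.differentiable (by simp) _).hasFDerivAt
      have hl : HasDerivAt (fun t : ℝ => x + t • v) ((1:ℝ) • v) t :=
        ((hasDerivAt_id t).smul_const _).const_add x
      rw [one_smul] at hl
      rw [hDDv]
      exact hd.comp_hasDerivAt t hl
    have p4 : ∀ (x : Fin d → ℝ) (t : ℝ), ‖ee (-m) x * Df (x + t • v)‖ ≤ C := by
      intro x t
      rw [norm_mul, ee_norm, one_mul]; exact hC _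
    have p5 : Integrable (fun x => ee (-m) x * f (x + (0:ℝ) • v)) (volume.restrict (bx 0)) :=
      ((p1 0).continuousOn.integrableOn_compact (isCompact_Icc (a := (0 : Fin d → ℝ)) (b := 0 + 1))).mono_set
        (bx_subset 0)
    have p6 : Integrable (fun _ : Fin d → ℝ => C) (volume.restrict (bx 0)) :=
      integrableOn_const (volume_bx_lt 0).ne
    have := hasDerivAt_integral_of_dominated_loc_of_deriv_le
      (F := fun (t : ℝ) (x : Fin d → ℝ) => ee (-m) x * f (x + t • v))
      (F' := fun (t : ℝ) (x : Fin d → ℝ) => ee (-m) x * Df (x + t • v))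
      (x₀ := (0:ℝ)) (univ_mem)
      (Eventually.of_forall fun t => (p1 t).aestronglyMeasurable) p5
      ((p2 0).aestronglyMeasurable)
      (Eventually.of_forall fun x t _ => p4 x t) p6 (Eventually.of_forall fun x t _ => p3 x t)
    exact this.2
  have h2 : HasDerivAt (fun t : ℝ => ee m (t • Pi.single i 1) * fc f m) (kap i m * fc f m) 0 := by
    apply HasDerivAt.mul_const
    simp_rw [ee_single]
    have h3 : HasDerivAt (fun t : ℝ => kap i m * (t : ℂ)) (kap i m * 1) 0 :=
      (Complex.ofRealCLM.hasDerivAt (x := 0)).const_mul _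
    have := h3.cexp
    simpa [kap] using this
  have e : (fun t : ℝ => ∫ x in bx 0, ee (-m) x * f (x + t • Pi.single i 1)) =
      fun t : ℝ => ee m (t • Pi.single i 1) * fc f m := by
    ext t; exact fc_trans hf m _
  rw [e] at h1
  rw [fc_eq hf.DD m 0, ← h1.unique h2]
  simp

lemma iter_DD {f : (Fin d → ℝ) → ℂ} (hf : Per f) (hs : ContDiff ℝ ∞ f) (i : Fin d) (N : ℕ) :
    Per ((DD i)^[N] f) ∧ ContDiff ℝ ∞ ((DD i)^[N] f) ∧
    ∀ m, fc ((DD i)^[N] f) m = kap i m ^ N * fc f m := by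
  induction N with
  | zero => exact ⟨hf, hs, fun m => by simp⟩
  | succ N ih =>
    rw [Function.iterate_succ_apply']
    refine ⟨ih.1.DD, contDiff_DD ih.2.1, fun m => ?_⟩
    rw [fc_DD ih.1 ih.2.1, ih.2.2, pow_succ]; ring

lemma le_kap_norm (i : Fin d) (m : Fin d → ℤ) : |(m i : ℝ)| ≤ ‖kap i m‖ := by
  simp only [kap, norm_mul, Complex.norm_ofNat, Complex.norm_real, Complex.norm_I, mul_one,
    Complex.norm_intCast, Real.norm_eq_abs, abs_of_pos Real.pi_pos]
  have := Real.pi_gt_three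
  nlinarith [abs_nonneg (m i : ℝ)]

lemma Rapid.of_coord {Y : Type*} [NormedAddCommGroup Y] {c : (Fin d → ℤ) → Y}
    (h0 : ∃ C, ∀ m, ‖c m‖ ≤ C) (h : ∀ (i : Fin d) (N : ℕ), ∃ C, ∀ m, ‖kap i m‖ ^ N * ‖c m‖ ≤ C) :
    Rapid c := by
  intro N
  obtain ⟨C0, hC0⟩ := h0
  choose C hC using fun i => h i N
  refine ⟨2 ^ N * (C0 + ∑ i, |C i|), fun m => ?_⟩
  have key : ‖m‖ ^ N * ‖c m‖ ≤ C0 + ∑ i, |C i| := by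
    have hC0' : 0 ≤ C0 := (norm_nonneg _).trans (hC0 m)
    rcases Nat.eq_zero_or_pos d with hd | hd
    · subst hd
      have : ‖m‖ = 0 := by rw [Subsingleton.elim m 0]; simp
      rw [this]
      have h1 : (0:ℝ) ^ N ≤ 1 := pow_le_one₀ le_rfl zero_le_one
      simp
      nlinarith [hC0 m, norm_nonneg (c m)]
    · obtain ⟨i, _, hi⟩ := Finset.exists_mem_eq_sup (Finset.univ : Finset (Fin d)) ⟨⟨0, hd⟩, Finset.mem_univ _⟩
        (fun i => ‖m i‖₊)
      have hm : ‖m‖ = |(m i : ℝ)| := by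
        rw [Pi.norm_def, hi, coe_nnnorm, Int.norm_eq_abs]
      calc ‖m‖ ^ N * ‖c m‖ ≤ ‖kap i m‖ ^ N * ‖c m‖ := by rw [hm]; gcongr; exact le_kap_norm i m
        _ ≤ |C i| := (hC i m).trans (le_abs_self _)
        _ ≤ ∑ i, |C i| := Finset.single_le_sum (f := fun i => |C i|) (fun i _ => abs_nonneg _) (Finset.mem_univ i)
        _ ≤ _ := by linarith
  have hsum : 0 ≤ ∑ i, |C i| := Finset.sum_nonneg fun i _ => abs_nonneg _
  have key0 : ‖c m‖ ≤ C0 + ∑ i, |C i| := (hC0 m).trans (by linarith)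
  rcases le_total ‖m‖ 1 with hm | hm
  · have : 1 + ‖m‖ ≤ 2 := by linarith
    gcongr
  · calc (1 + ‖m‖) ^ N * ‖c m‖ ≤ (2 * ‖m‖) ^ N * ‖c m‖ := by gcongr; linarith
      _ = 2 ^ N * (‖m‖ ^ N * ‖c m‖) := by rw [mul_pow]; ring
      _ ≤ _ := by gcongr

lemma rapid_fc {f : (Fin d → ℝ) → ℂ} (hf : Per f) (hs : ContDiff ℝ ∞ f) : Rapid (fc f) := by
  apply Rapid.of_coord (fc_bound hf hs.continuous)
  intro i N
  obtain ⟨h1, h2, h3⟩ := iter_DD hf hs i N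
  obtain ⟨C, hC⟩ := fc_bound h1 h2.continuous
  refine ⟨C, fun m => ?_⟩
  rw [← norm_pow, ← norm_mul, ← h3]
  exact hC m

lemma FS_fc {f : (Fin d → ℝ) → ℂ} (hf : Per f) (hs : ContDiff ℝ ∞ f) (x : Fin d → ℝ) :
    FS (fc f) x = f x := by
  have h := UnitAddTorus.hasSum_mFourier_series_apply_of_summable
    (f := ⟨tl f, continuous_tl hf hs.continuous⟩) (rapid_fc hf hs).summable_norm.of_norm
    (fun i => (x i : UnitAddCircle))
  simp only [ContinuousMap.coe_mk, tl_coe hf, mFourier_coe] at h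
  unfold FS
  rw [← h.tsum_eq]
  congr 1
  ext m
  simp only [fc, smul_eq_mul, mul_comm]

lemma fc_conj {f : (Fin d → ℝ) → ℂ} (hf : Per f) (hr : ∀ x, conj (f x) = f x) (m : Fin d → ℤ) :
    fc f (-m) = conj (fc f m) := by
  rw [fc_eq hf _ 0, fc_eq hf _ 0, ← integral_conj]
  congr 1
  ext x
  rw [map_mul, hr, ← ee_neg]

lemma integral_DD_eq_zero {f : (Fin d → ℝ) → ℂ} (hf : Per f) (hs : ContDiff ℝ ∞ f) (i : Fin d) :
    ∫ x in bx 0, DD i f x = 0 := by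
  have h := fc_DD hf hs 0 i
  rw [fc_eq hf.DD _ 0] at h
  simpa [kap, ee_zero_left] using h

end Fourier2

end HS
end

noncomputable section
namespace HS
open Set Filter Topology
open scoped ComplexConjugate InnerProductSpace ContDiff

section abstractSolve
variable {V : Type*} [NormedAddCommGroup V] [InnerProductSpace ℂ V] [CompleteSpace V]
variable {E : Type*} [NormedAddCommGroup E] [NormedSpace ℝ E]

lemma contDiff_appC {A : E → V →L[ℂ] V} {p : E → V} (hA : ContDiff ℝ ∞ A) (hp : ContDiff ℝ ∞ p) :
    ContDiff ℝ ∞ (fun a => A a (p a)) := by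
  have hb : IsBoundedBilinearMap ℝ (fun q : (V →L[ℂ] V) × V => q.1 q.2) :=
    { add_left := fun x y z => by simp
      smul_left := fun c x y => by simp
      add_right := fun x y z => by simp
      smul_right := fun c x y => by
        simp only [← Complex.coe_smul, map_smul]
      bound := ⟨1, one_pos, fun x y => by simpa using x.le_opNorm y⟩ }
  exact hb.contDiff.comp (hA.prodMk hp)

lemma contDiff_compC {A B : E → V →L[ℂ] V} (hA : ContDiff ℝ ∞ A) (hB : ContDiff ℝ ∞ B) :
    ContDiff ℝ ∞ (fun a => (A a).comp (B a)) := by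
  have hb : IsBoundedBilinearMap ℝ (fun q : (V →L[ℂ] V) × (V →L[ℂ] V) => q.1.comp q.2) :=
    { add_left := fun x y z => by simp
      smul_left := fun c x y => by ext; simp
      add_right := fun x y z => by simp
      smul_right := fun c x y => by
        ext; simp only [← Complex.coe_smul, ContinuousLinearMap.comp_apply, ContinuousLinearMap.smul_apply, map_smul]
      bound := ⟨1, one_pos, fun x y => by simpa using x.opNorm_comp_le y⟩ }
  exact hb.contDiff.comp (hA.prodMk hB)

lemma contDiff_adjC {A : E → V →L[ℂ] V} (hA : ContDiff ℝ ∞ A) :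
    ContDiff ℝ ∞ (fun a => ContinuousLinearMap.adjoint (A a)) := by
  have hb : IsBoundedLinearMap ℝ (fun q : (V →L[ℂ] V) => ContinuousLinearMap.adjoint q) :=
    { map_add := fun x y => by simp
      map_smul := fun c x => by
        rw [← Complex.coe_smul, map_smulₛₗ]; simp
      bound := ⟨1, one_pos, fun x => by simp⟩ }
  exact hb.contDiff.comp hA

lemma contDiff_invC {A : E → V →L[ℂ] V} (hA : ContDiff ℝ ∞ A) (hu : ∀ a, IsUnit (A a)) :
    ContDiff ℝ ∞ (fun a => Ring.inverse (A a)) := by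
  rw [contDiff_iff_contDiffAt]
  intro a
  obtain ⟨u, hu⟩ := hu a
  have h := contDiffAt_ringInverse (n := ∞) ℝ u
  rw [hu] at h
  exact h.comp a hA.contDiffAt

theorem abstract_solve (G : Submodule ℂ V) [G.HasOrthogonalProjection]
    (N : E → V →L[ℂ] V) (hN : ContDiff ℝ ∞ N) (hlow : ∀ a, ∃ c : ℝ, 0 < c ∧ ∀ p, c * ‖p‖ ≤ ‖N a p‖)
    (b : E → V) (hb : ContDiff ℝ ∞ b) :
    ∃ q : E → V, ContDiff ℝ ∞ q ∧ (∀ a, q a ∈ G) ∧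
      (∀ a, ∀ g ∈ G, ⟪N a (q a + b a), N a g⟫_ℂ = 0) ∧
      (∀ a, ∀ p ∈ G, (∀ g ∈ G, ⟪N a (p + b a), N a g⟫_ℂ = 0) → p = q a) := by
  set Pi : V →L[ℂ] V := G.starProjection with hPi
  set A : E → V →L[ℂ] V := fun a => (ContinuousLinearMap.adjoint (N a)).comp (N a) with hA
  set T : E → V →L[ℂ] V := fun a => (Pi.comp ((A a).comp Pi)) + (1 - Pi) with hT
  have hPs : ∀ x y, ⟪Pi x, y⟫_ℂ = ⟪x, Pi y⟫_ℂ := fun x y => G.inner_starProjection_left_eq_right x y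
  have hPP : ∀ x, Pi (Pi x) = Pi x := fun x =>
    Submodule.starProjection_eq_self_iff.2 (Submodule.starProjection_apply_mem G x)
  have hAs : ContDiff ℝ ∞ A := contDiff_compC (contDiff_adjC hN) hN
  have hTs : ContDiff ℝ ∞ T :=
    (contDiff_compC contDiff_const (contDiff_compC hAs contDiff_const)).add contDiff_const
  have hTin : ∀ a x, ⟪T a x, x⟫_ℂ = ((‖N a (Pi x)‖ ^ 2 + ‖x - Pi x‖ ^ 2 : ℝ) : ℂ) := by
    intro a x
    simp only [hT, hA, ContinuousLinearMap.add_apply, ContinuousLinearMap.comp_apply,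
      ContinuousLinearMap.sub_apply, ContinuousLinearMap.one_apply, inner_add_left]
    rw [hPs, ContinuousLinearMap.adjoint_inner_left, inner_self_eq_norm_sq_to_K]
    have e : ⟪x - Pi x, x⟫_ℂ = ⟪x - Pi x, x - Pi x⟫_ℂ := by
      rw [inner_sub_right (x - Pi x) x]
      have : ⟪x - Pi x, Pi x⟫_ℂ = 0 := by
        rw [inner_sub_left, hPs x, hPP, sub_self]
      rw [this, sub_zero]
    rw [e, inner_self_eq_norm_sq_to_K]
    push_cast; rfl
  have hTu : ∀ a, IsUnit (T a) := by
    intro a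
    obtain ⟨c, hc, hlo⟩ := hlow a
    have hd : 0 < min (c^2) 1 / 2 := by positivity
    refine ContinuousLinearMap.isUnit_of_forall_le_norm_inner_map (T a)
      (c := ⟨min (c^2) 1 / 2, hd.le⟩) (by exact_mod_cast hd) fun x => ?_
    rw [hTin, Complex.norm_real, Real.norm_eq_abs, abs_of_nonneg (by positivity)]
    show ‖x‖ ^ 2 * (min (c^2) 1 / 2) ≤ _
    have h1 : ‖x‖ ≤ ‖Pi x‖ + ‖x - Pi x‖ := by
      calc ‖x‖ = ‖Pi x + (x - Pi x)‖ := by congr 1; abel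
        _ ≤ _ := norm_add_le _ _
    have h2 : ‖x‖ ^ 2 ≤ 2 * (‖Pi x‖ ^ 2 + ‖x - Pi x‖ ^ 2) := by
      nlinarith [norm_nonneg x, sq_nonneg (‖Pi x‖ - ‖x - Pi x‖)]
    have h3 : c ^ 2 * ‖Pi x‖ ^ 2 ≤ ‖N a (Pi x)‖ ^ 2 := by
      rw [← mul_pow]; exact pow_le_pow_left₀ (by positivity) (hlo _) 2
    have h4 : min (c^2) 1 * ‖Pi x‖ ^ 2 ≤ c ^ 2 * ‖Pi x‖ ^ 2 := by gcongr; exact min_le_left _ _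
    have h5 : min (c^2) 1 * ‖x - Pi x‖ ^ 2 ≤ 1 * ‖x - Pi x‖ ^ 2 := by gcongr; exact min_le_right _ _
    have h6 := mul_le_mul_of_nonneg_right h2 hd.le
    linarith
  set q : E → V := fun a => - (Ring.inverse (T a)) (Pi (A a (b a))) with hq
  have hqs : ContDiff ℝ ∞ q :=
    (contDiff_appC (contDiff_invC hTs hTu) (contDiff_appC contDiff_const (contDiff_appC hAs hb))).neg
  have hTq : ∀ a, T a (q a) = - Pi (A a (b a)) := by
    intro a
    have : T a * Ring.inverse (T a) = 1 := Ring.mul_inverse_cancel _ (hTu a)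
    have h2 := congrArg (fun L : V →L[ℂ] V => L (Pi (A a (b a)))) this
    simp only [hq, map_neg]
    simpa using h2
  have hinj : ∀ a x y, T a x = T a y → x = y := by
    intro a x y hxy
    have : Ring.inverse (T a) * T a = 1 := Ring.inverse_mul_cancel _ (hTu a)
    have h2 := fun z => congrArg (fun L : V →L[ℂ] V => L z) this
    simp only [ContinuousLinearMap.mul_apply, ContinuousLinearMap.one_apply] at h2
    rw [← h2 x, hxy, h2 y]
  have key : ∀ a, ∀ p ∈ G, (∀ g ∈ G, ⟪N a (p + b a), N a g⟫_ℂ = 0) ↔ T a p = - Pi (A a (b a)) := by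
    intro a p hp
    have hp' : Pi p = p := Submodule.starProjection_eq_self_iff.2 hp
    have e1 : T a p + Pi (A a (b a)) = Pi (A a (p + b a)) := by
      simp only [hT, ContinuousLinearMap.add_apply, ContinuousLinearMap.comp_apply,
        ContinuousLinearMap.sub_apply, ContinuousLinearMap.one_apply, hp', map_add]
      abel
    have e2 : ∀ g, ⟪N a (p + b a), N a g⟫_ℂ = ⟪A a (p + b a), g⟫_ℂ := by
      intro g
      simp only [hA, ContinuousLinearMap.comp_apply, ContinuousLinearMap.adjoint_inner_left]
    rw [eq_neg_iff_add_eq_zero, e1]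
    constructor
    · intro h
      have := h (Pi (A a (p + b a))) (Submodule.starProjection_apply_mem G _)
      rw [e2, ← hPP, ← hPs] at this
      exact inner_self_eq_zero.1 this
    · intro h g hg
      have hg' : Pi g = g := Submodule.starProjection_eq_self_iff.2 hg
      rw [e2, ← hg', ← hPs, h, inner_zero_left]
  have hqG : ∀ a, q a ∈ G := by
    intro a
    rw [← Submodule.starProjection_eq_self_iff]
    change Pi (q a) = q a
    have h := hTq a
    have h2 := congrArg (fun v => v - Pi v) h
    simp only [hT, ContinuousLinearMap.add_apply, ContinuousLinearMap.comp_apply,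
        ContinuousLinearMap.sub_apply, ContinuousLinearMap.one_apply, map_add, map_sub, map_neg, hPP] at h2
    have h3 : q a - Pi (q a) = 0 := by
      rw [sub_self, sub_self, add_zero] at h2
      rw [add_sub_right_comm, sub_self, zero_add] at h2
      rw [h2]
    exact (sub_eq_zero.1 h3).symm
  refine ⟨q, hqs, hqG, fun a => (key a _ (hqG a)).2 (hTq a), fun a p hp h => ?_⟩
  exact hinj a _ _ (((key a p hp).1 h).trans (hTq a).symm)

end abstractSolve
end HS
end

noncomputable section
namespace HS
open Set Filter Topology
open scoped ComplexConjugate InnerProductSpace ContDiff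

/-- square summable families -/
def VV (ι Z : Type) [NormedAddCommGroup Z] : Type := lp (fun _ : ι => Z) 2

section VVsec
variable {ι Z : Type} [NormedAddCommGroup Z]
instance : NormedAddCommGroup (VV ι Z) := inferInstanceAs (NormedAddCommGroup (lp (fun _ : ι => Z) 2))
variable [InnerProductSpace ℂ Z]
instance : InnerProductSpace ℂ (VV ι Z) := inferInstanceAs (InnerProductSpace ℂ (lp (fun _ : ι => Z) 2))
variable [CompleteSpace Z]
instance : CompleteSpace (VV ι Z) := inferInstanceAs (CompleteSpace (lp (fun _ : ι => Z) 2))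

def cp (κ : ι) : VV ι Z →L[ℂ] Z := lp.evalCLM ℂ (fun _ : ι => Z) 2 κ

lemma VV.ext {p q : VV ι Z} (h : ∀ κ, cp κ p = cp κ q) : p = q :=
  lp.ext (funext h)

lemma hasSum_inner_VV (p q : VV ι Z) : HasSum (fun κ => ⟪cp κ p, cp κ q⟫_ℂ) ⟪p, q⟫_ℂ :=
  lp.hasSum_inner (𝕜 := ℂ) (G := fun _ : ι => Z) p q

lemma norm_cp_le (κ : ι) (p : VV ι Z) : ‖cp κ p‖ ≤ ‖p‖ :=
  lp.norm_apply_le_norm (p := 2) (E := fun _ : ι => Z) (by norm_num) p κ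

def sg (κ : ι) (z : Z) : VV ι Z := lp.single (E := fun _ : ι => Z) 2 κ z

lemma cp_sg (κ κ' : ι) (z : Z) : cp κ' (sg κ z) = if κ' = κ then z else 0 := by
  change (lp.single (E := fun _ : ι => Z) 2 κ z : lp (fun _ : ι => Z) 2) κ' = _
  split_ifs with h
  · subst h; simp
  · rw [lp.single_apply]; simp [h]

lemma norm_sg (κ : ι) (z : Z) : ‖(sg κ z : VV ι Z)‖ = ‖z‖ :=
  lp.norm_single (E := fun _ : ι => Z) (p := 2) (by norm_num) κ z

lemma inner_sg (p : VV ι Z) (κ : ι) (z : Z) : ⟪p, sg κ z⟫_ℂ = ⟪cp κ p, z⟫_ℂ :=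
  lp.inner_single_right (𝕜 := ℂ) (G := fun _ : ι => Z) κ z p

/-- weighted composition operators -/
def WC (u : ι → ℂ) (hu : ∀ κ, ‖u κ‖ ≤ 1) (σ : ι ≃ ι) : VV ι Z →L[ℂ] VV ι Z := by
  have hm : ∀ p : lp (fun _ : ι => Z) 2, Summable (fun κ => ‖p κ‖ ^ (2:ENNReal).toReal) := fun p =>
    (memℓp_gen_iff (E := fun _ : ι => Z) (p := 2) (by norm_num)).1 p.2
  have hle : ∀ (p : lp (fun _ : ι => Z) 2) κ, ‖u κ • p (σ κ)‖ ^ (2:ENNReal).toReal ≤ ‖p (σ κ)‖ ^ (2:ENNReal).toReal := by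
    intro p κ
    gcongr
    rw [norm_smul]
    exact mul_le_of_le_one_left (norm_nonneg _) (hu κ)
  have hs : ∀ p : lp (fun _ : ι => Z) 2, Summable (fun κ => ‖u κ • p (σ κ)‖ ^ (2:ENNReal).toReal) := fun p =>
    Summable.of_nonneg_of_le (fun κ => by positivity) (hle p) ((σ.summable_iff).2 (hm p))
  exact LinearMap.mkContinuous (σ := RingHom.id ℂ) (E := lp (fun _ : ι => Z) 2) (F := lp (fun _ : ι => Z) 2)
    { toFun := fun p => ⟨fun κ => u κ • p (σ κ),
        (memℓp_gen_iff (E := fun _ : ι => Z) (p := 2) (by norm_num)).2 (hs p)⟩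
      map_add' := fun p q => by
        apply lp.ext; funext κ; exact smul_add _ _ _
      map_smul' := fun c p => by
        apply lp.ext; funext κ; exact smul_comm _ _ _ } 1 (fun p => by
        rw [one_mul]
        have h2 : (0:ℝ) < (2:ENNReal).toReal := by norm_num
        rw [← Real.rpow_le_rpow_iff (norm_nonneg _) (norm_nonneg _) h2,
          lp.norm_rpow_eq_tsum h2, lp.norm_rpow_eq_tsum h2, ← σ.tsum_eq (fun κ => ‖p κ‖ ^ (2:ENNReal).toReal)]
        exact Summable.tsum_le_tsum (hle p) (hs p) ((σ.summable_iff).2 (hm p)))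

lemma cp_WC (u : ι → ℂ) (hu : ∀ κ, ‖u κ‖ ≤ 1) (σ : ι ≃ ι) (p : VV ι Z) (κ : ι) :
    cp κ (WC u hu σ p) = u κ • cp (σ κ) p := rfl

lemma norm_WC_le (u : ι → ℂ) (hu : ∀ κ, ‖u κ‖ ≤ 1) (σ : ι ≃ ι) :
    ‖(WC u hu σ : VV ι Z →L[ℂ] VV ι Z)‖ ≤ 1 := by
  refine ContinuousLinearMap.opNorm_le_bound _ zero_le_one fun p => ?_
  rw [one_mul]
  have h1 := hasSum_inner_VV (WC u hu σ p) (WC u hu σ p)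
  have h2 := (σ.hasSum_iff).2 (hasSum_inner_VV p p)
  simp only [inner_self_eq_norm_sq_to_K, Function.comp_def] at h1 h2
  norm_cast at h1 h2
  have h3 : ‖WC u hu σ p‖ ^ 2 ≤ ‖p‖ ^ 2 := by
    refine hasSum_le (fun κ => ?_) h1 h2
    rw [cp_WC, norm_smul]
    gcongr
    exact mul_le_of_le_one_left (norm_nonneg _) (hu κ)
  exact (sq_le_sq₀ (norm_nonneg _) (norm_nonneg _)).1 h3

end VVsec

section ops
variable {n : ℕ} {Z : Type} [NormedAddCommGroup Z] [InnerProductSpace ℂ Z] [CompleteSpace Z]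

abbrev II (n : ℕ) := Fin (n+1) → ℤ
abbrev VN (n : ℕ) (Z : Type) [NormedAddCommGroup Z] := VV (Fin (n+1) × II n) Z

def Eo (i : Fin n) (m : II n) : VN n Z →L[ℂ] VN n Z :=
  WC (fun κ => if κ.1 = i.succ then 1 else 0) (fun κ => by split_ifs <;> simp)
    ((Equiv.swap 0 i.succ).prodCongr (Equiv.subRight m))

lemma cp_Eo (i : Fin n) (m : II n) (p : VN n Z) (j : Fin (n+1)) (k : II n) :
    cp (j, k) (Eo i m p) = if j = i.succ then cp (0, k - m) p else 0 := by
  unfold Eo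
  rw [cp_WC]
  by_cases h : j = i.succ
  · subst h; simp
  · simp [h]

def tau (a : Fin (n+1) → ℝ) : VN n Z →L[ℂ] VN n Z :=
  WC (fun κ => ee κ.2 a) (fun κ => (ee_norm _ _).le) (Equiv.refl _)

lemma cp_tau (a : Fin (n+1) → ℝ) (p : VN n Z) (κ : Fin (n+1) × II n) :
    cp κ (tau a p) = ee κ.2 a • cp κ p := by
  unfold tau; rw [cp_WC]; rfl

lemma inner_tau (a : Fin (n+1) → ℝ) (p q : VN n Z) : ⟪tau a p, tau a q⟫_ℂ = ⟪p, q⟫_ℂ := by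
  refine (hasSum_inner_VV _ _).unique ?_
  convert hasSum_inner_VV p q using 2 with κ
  rw [cp_tau, cp_tau, inner_smul_left, inner_smul_right, ← mul_assoc, ← Complex.normSq_eq_conj_mul_self,
    Complex.normSq_eq_norm_sq, ee_norm]
  simp

lemma tau_neg (a : Fin (n+1) → ℝ) (p : VN n Z) : tau a (tau (-a) p) = p := by
  apply VV.ext; intro κ
  rw [cp_tau, cp_tau, smul_smul, ← ee_add, add_neg_cancel, ee_zero, one_smul]

variable {c : Fin n → II n → ℂ}

lemma rapid_Eo (hc : ∀ i, Rapid (c i)) (i : Fin n) :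
    Rapid (fun m => c i m • (Eo i m : VN n Z →L[ℂ] VN n Z)) := by
  refine (hc i).of_le 1 0 fun m => ?_
  rw [norm_smul]
  have : ‖(Eo i m : VN n Z →L[ℂ] VN n Z)‖ ≤ 1 := norm_WC_le _ _ _
  simpa using mul_le_mul_of_nonneg_left this (norm_nonneg (c i m))

variable (c) in
def HO (a : Fin (n+1) → ℝ) : VN n Z →L[ℂ] VN n Z :=
  ∑ i, FS (fun m => c i m • (Eo i m : VN n Z →L[ℂ] VN n Z)) a

lemma contDiff_HO (hc : ∀ i, Rapid (c i)) : ContDiff ℝ ∞ (HO (Z := Z) c) := by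
  unfold HO
  exact ContDiff.sum fun i _ => (rapid_Eo hc i).contDiff

lemma hasSum_HO (hc : ∀ i, Rapid (c i)) (a : Fin (n+1) → ℝ) (p : VN n Z) (i : Fin n) :
    HasSum (fun m => (ee m a * c i m) • Eo i m p)
      ((FS (fun m => c i m • (Eo i m : VN n Z →L[ℂ] VN n Z)) a) p) := by
  have h := ((rapid_Eo (Z := Z) hc i).summable_ee a).hasSum
  have h2 := h.mapL (ContinuousLinearMap.apply ℂ (VN n Z) p)
  simpa [smul_smul, FS] using h2

lemma cp_HO_zero (hc : ∀ i, Rapid (c i)) (a : Fin (n+1) → ℝ) (p : VN n Z) (k : II n) :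
    cp (0, k) (HO c a p) = 0 := by
  unfold HO
  rw [ContinuousLinearMap.sum_apply, map_sum]
  refine Finset.sum_eq_zero fun i _ => ?_
  refine ((hasSum_HO hc a p i).mapL (cp (0,k))).unique ?_
  convert hasSum_zero with m
  rw [map_smul, cp_Eo, if_neg (Fin.succ_ne_zero i).symm, smul_zero]

lemma cp_HO_succ (hc : ∀ i, Rapid (c i)) (a : Fin (n+1) → ℝ) (p : VN n Z) (i : Fin n) (k : II n) :
    HasSum (fun m => (ee m a * c i m) • cp (0, k - m) p) (cp (i.succ, k) (HO c a p)) := by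
  unfold HO
  rw [ContinuousLinearMap.sum_apply, map_sum, Finset.sum_eq_single i]
  · have h := (hasSum_HO hc a p i).mapL (cp (i.succ,k))
    convert h using 2 with m
    rw [map_smul, cp_Eo, if_pos rfl]
  · intro i' _ hi
    refine ((hasSum_HO hc a p i').mapL (cp (i.succ,k))).unique ?_
    convert hasSum_zero with m
    rw [map_smul, cp_Eo, if_neg (fun h => hi (Fin.succ_injective _ h).symm), smul_zero]
  · simp

lemma HO_tau (hc : ∀ i, Rapid (c i)) (a : Fin (n+1) → ℝ) (p : VN n Z) :
    HO c a (tau a p) = tau a (HO c 0 p) := by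
  apply VV.ext
  rintro ⟨j, k⟩
  rw [cp_tau]
  refine Fin.cases ?_ (fun i => ?_) j
  · rw [cp_HO_zero hc, cp_HO_zero hc, smul_zero]
  · have h1 := cp_HO_succ hc a (tau a p) i k
    have h2 := (cp_HO_succ hc 0 p i k).const_smul (ee k a)
    refine h1.unique ?_
    convert h2 using 2 with m
    rw [cp_tau, smul_smul, smul_smul, ee_zero, one_mul]
    congr 1
    have : ee k a = ee m a * ee (k - m) a := by rw [← ee_add_left]; congr 1; abel
    rw [this]; ring

lemma HO_HO (hc : ∀ i, Rapid (c i)) (a : Fin (n+1) → ℝ) (p : VN n Z) : HO c a (HO c a p) = 0 := by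
  apply VV.ext
  rintro ⟨j, k⟩
  rw [map_zero]
  refine Fin.cases ?_ (fun i => ?_) j
  · rw [cp_HO_zero hc]
  · refine (cp_HO_succ hc a _ i k).unique ?_
    convert hasSum_zero with m
    rw [cp_HO_zero hc, smul_zero]

lemma low_HO (hc : ∀ i, Rapid (c i)) (a : Fin (n+1) → ℝ) :
    ∃ C : ℝ, 0 < C ∧ ∀ p : VN n Z, C * ‖p‖ ≤ ‖(1 - HO c a : VN n Z →L[ℂ] VN n Z) p‖ := by
  set L : VN n Z →L[ℂ] VN n Z := 1 + HO c a
  refine ⟨(‖L‖ + 1)⁻¹, by positivity, fun p => ?_⟩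
  rw [inv_mul_le_iff₀ (by positivity)]
  have e : L ((1 - HO c a : VN n Z →L[ℂ] VN n Z) p) = p := by
    simp [L, HO_HO hc]
  calc ‖p‖ = ‖L ((1 - HO c a : VN n Z →L[ℂ] VN n Z) p)‖ := by rw [e]
    _ ≤ ‖L‖ * _ := L.le_opNorm _
    _ ≤ _ := by gcongr; linarith

end ops
end HS
end

noncomputable section
namespace HS
open Set Filter Topology
open scoped ComplexConjugate InnerProductSpace ContDiff

section
variable {n : ℕ} {Z : Type} [NormedAddCommGroup Z] [InnerProductSpace ℂ Z] [CompleteSpace Z]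

lemma DD_clm {d : ℕ} {Y Y' : Type*} [NormedAddCommGroup Y] [NormedSpace ℂ Y] [NormedSpace ℝ Y] [IsScalarTower ℝ ℂ Y]
    [NormedAddCommGroup Y'] [NormedSpace ℂ Y'] [NormedSpace ℝ Y'] [IsScalarTower ℝ ℂ Y']
    (L : Y →L[ℂ] Y') {f : (Fin d → ℝ) → Y}
    (hf : ContDiff ℝ ∞ f) (i : Fin d) (x : Fin d → ℝ) :
    DD i (fun x => L (f x)) x = L (DD i f x) := by
  unfold DD
  have h := ((L.restrictScalars ℝ).hasFDerivAt (x := f x)).comp x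
    ((hf.differentiable (by simp)) x).hasFDerivAt
  have h' : HasFDerivAt (fun x => L (f x)) ((L.restrictScalars ℝ).comp (fderiv ℝ f x)) x := h
  rw [h'.fderiv]; rfl

lemma DD_ee_smul {d : ℕ} {Y : Type*} [NormedAddCommGroup Y] [NormedSpace ℂ Y] [NormedSpace ℝ Y] [IsScalarTower ℝ ℂ Y]
    (k : Fin d → ℤ) (z : Y) (i : Fin d) (x : Fin d → ℝ) :
    DD i (fun x => ee k x • z) x = kap i k • ee k x • z := by
  have h := DD_clm (ContinuousLinearMap.toSpanSingleton ℂ z) (contDiff_ee k) i x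
  simp only [ContinuousLinearMap.toSpanSingleton_apply] at h
  rw [h, DD, hasFDerivAt_ee, smul_smul]

lemma rapid_of_orbit {q : (Fin (n+1) → ℝ) → VN n Z} (hq : ContDiff ℝ ∞ q)
    (h : ∀ a, q a = tau a (q 0)) (j : Fin (n+1)) : Rapid (fun k => cp (j, k) (q 0)) := by
  have hper : Per q := by
    intro x k
    rw [h (x + _), h x]
    apply VV.ext; intro κ
    rw [cp_tau, cp_tau, ee_add, ee_int, mul_one]
  have key : ∀ (i : Fin (n+1)) (N : ℕ), ∃ f : (Fin (n+1) → ℝ) → VN n Z, ContDiff ℝ ∞ f ∧ Per f ∧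
      ∀ k a, cp (j, k) (f a) = ee k a • (kap i k ^ N • cp (j, k) (q 0)) := by
    intro i N
    induction N with
    | zero => exact ⟨q, hq, hper, fun k a => by rw [h a, cp_tau]; simp⟩
    | succ N ih =>
      obtain ⟨f, h1, h2, h3⟩ := ih
      refine ⟨DD i f, contDiff_DD h1, h2.DD, fun k a => ?_⟩
      rw [← DD_clm (cp (j,k)) h1 i a]
      simp only [h3 k]
      rw [DD_ee_smul, smul_comm (kap i k), smul_smul (kap i k), pow_succ']
  apply Rapid.of_coord
  · exact ⟨‖q 0‖, fun k => norm_cp_le _ _⟩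
  · intro i N
    obtain ⟨f, h1, h2, h3⟩ := key i N
    refine ⟨‖f 0‖, fun k => ?_⟩
    have := norm_cp_le (j, k) (f 0)
    rwa [h3, ee_zero, one_smul, norm_smul, norm_pow] at this

/-- discrete convolution -/
def cv {Y : Type*} [NormedAddCommGroup Y] [NormedSpace ℂ Y] {d : ℕ} (c : (Fin d → ℤ) → ℂ)
    (p : (Fin d → ℤ) → Y) (k : Fin d → ℤ) : Y := ∑' m, c m • p (k - m)

/-- the compatibility subspace -/
def GS (n : ℕ) (J : Z →L[ℂ] Z) : Submodule ℂ (VN n Z) :=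
  ⨅ (i : Fin n), ⨅ (k : II n), LinearMap.ker
    ((cp (i.succ, k) - (ContinuousLinearMap.adjoint J).comp
      (cp (i.succ, k) - kap i.succ k • cp (0, k)) : VN n Z →L[ℂ] Z) : VN n Z →ₗ[ℂ] Z)

lemma mem_GS {J : Z →L[ℂ] Z} {p : VN n Z} : p ∈ GS n J ↔ ∀ (i : Fin n) (k : II n),
    cp (i.succ, k) p = ContinuousLinearMap.adjoint J (cp (i.succ, k) p - kap i.succ k • cp (0, k) p) := by
  simp only [GS, Submodule.mem_iInf, LinearMap.mem_ker, ContinuousLinearMap.coe_coe]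
  refine forall_congr' fun i => forall_congr' fun k => ?_
  exact sub_eq_zero

lemma isClosed_GS (J : Z →L[ℂ] Z) : IsClosed (GS n J : Set (VN n Z)) := by
  unfold GS
  simp only [Submodule.coe_iInf]
  refine isClosed_iInter fun i => isClosed_iInter fun k => ?_
  exact ContinuousLinearMap.isClosed_ker (cp (i.succ, k) - (ContinuousLinearMap.adjoint J).comp
      (cp (i.succ, k) - kap i.succ k • cp (0, k)) : VN n Z →L[ℂ] Z)

lemma tau_mem_GS {J : Z →L[ℂ] Z} {p : VN n Z} (hp : p ∈ GS n J) (a : Fin (n+1) → ℝ) :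
    tau a p ∈ GS n J := by
  rw [mem_GS] at hp ⊢
  intro i k
  simp only [cp_tau]
  rw [smul_comm, ← smul_sub, map_smul, ← hp]

theorem coeff_solve (J : Z →L[ℂ] Z)
    (hJ : ∀ k, (2:ℂ) • J (ContinuousLinearMap.adjoint J k) - J k = ContinuousLinearMap.adjoint J k)
    (e : Z) (he : (2:ℂ) • J e = e) (hee : ⟪e, e⟫_ℂ = 1 / 2)
    (c : Fin n → II n → ℂ) (hc : ∀ i, Rapid (c i)) (hcr : ∀ i m, c i (-m) = conj (c i m))
    (ψ : II n → ℂ) (hψ : Rapid ψ) :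
    ∃ P : Fin (n+1) → II n → Z, (∀ j, Rapid (P j)) ∧
      (∀ (i : Fin n) k, P i.succ k = J (P i.succ k + kap i.succ k • P 0 k)) ∧
      (∀ (i : Fin n) k, ⟪e, P i.succ k + kap i.succ k • P 0 k⟫_ℂ = kap i.succ k * ψ k) ∧
      ∀ (F : Fin n → II n → Z) (Fz : II n → Z), (∀ i k, F i k = P i.succ k - cv (c i) (P 0) k) →
        (∀ k, Fz k = P 0 k - ∑ i, cv (c i) (F i) k) →
        ∀ k, Fz k = J (Fz k - ∑ i : Fin n, kap i.succ k • F i k) := by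
  set b' : Fin (n+1) → II n → Z := fun j k => (Fin.cases (motive := fun _ => ℂ) 1 (fun i => kap i.succ k) j * ψ k) • e with hb'
  have hb'0 : ∀ k, b' 0 k = ψ k • e := fun k => by simp [hb']
  have hb's : ∀ (i : Fin n) k, b' i.succ k = (kap i.succ k * ψ k) • e := fun i k => by simp [hb']
  have hbr : ∀ j, Rapid (b' j) := by
    intro j
    refine Fin.cases ?_ (fun i => ?_) j
    · refine hψ.of_le ‖e‖ 0 fun m => ?_
      rw [hb'0, norm_smul]; simp [mul_comm]
    · refine hψ.of_le (7 * ‖e‖) 1 fun m => ?_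
      rw [hb's, norm_smul, norm_mul, pow_one]
      have := kap_norm_le i.succ m
      calc ‖kap i.succ m‖ * ‖ψ m‖ * ‖e‖ ≤ (7 * (1 + ‖m‖)) * ‖ψ m‖ * ‖e‖ := by gcongr
        _ = _ := by ring
  have hbrs : ∀ j, Rapid (fun k => (sg (j, k) (b' j k) : VN n Z)) := fun j =>
    (hbr j).of_le 1 0 fun m => by rw [norm_sg]; simp
  set b : (Fin (n+1) → ℝ) → VN n Z := fun a => ∑ j, FS (fun k => (sg (j, k) (b' j k) : VN n Z)) a with hb
  have hbs : ContDiff ℝ ∞ b := ContDiff.sum fun j _ => (hbrs j).contDiff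
  have hcb : ∀ a j k, cp (j, k) (b a) = ee k a • b' j k := by
    intro a j k
    simp only [hb]
    rw [map_sum, Finset.sum_eq_single j]
    · have h := ((hbrs j).summable_ee a).hasSum.mapL (cp (j, k))
      refine h.unique ?_
      convert hasSum_ite_eq k (ee k a • b' j k) using 2 with m
      rw [map_smul, cp_sg]
      by_cases hm : m = k
      · subst hm; simp
      · have : ¬ ((j, k) : Fin (n+1) × II n) = (j, m) := fun h => hm (Prod.ext_iff.1 h).2.symm
        simp [hm, this]
    · intro j' _ hj
      have h := ((hbrs j').summable_ee a).hasSum.mapL (cp (j, k))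
      refine h.unique ?_
      convert hasSum_zero with m
      have : ¬ ((j, k) : Fin (n+1) × II n) = (j', m) := fun h => hj (Prod.ext_iff.1 h).1.symm
      rw [map_smul, cp_sg, if_neg this, smul_zero]
    · simp
  have hbt : ∀ a, b a = tau a (b 0) := by
    intro a; apply VV.ext; rintro ⟨j, k⟩
    rw [cp_tau, hcb, hcb, ee_zero, one_smul]
  haveI : CompleteSpace (GS n J) := (isClosed_GS J).completeSpace_coe
  obtain ⟨q, hqs, hqG, hqo, hqu⟩ := abstract_solve (GS n J) (fun a => 1 - HO c a)
    (contDiff_const.sub (contDiff_HO hc)) (low_HO hc) b hbs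
  have hNt : ∀ a p, (1 - HO c a : VN n Z →L[ℂ] VN n Z) (tau a p) = tau a ((1 - HO c 0 : VN n Z →L[ℂ] VN n Z) p) := by
    intro a p
    rw [sub_apply, sub_apply, HO_tau hc, map_sub]; rfl
  have hqt : ∀ a, q a = tau a (q 0) := by
    intro a
    refine (hqu a _ (tau_mem_GS (hqG 0) a) fun g hg => ?_).symm
    rw [hbt a, ← map_add, ← tau_neg a g, hNt, hNt, inner_tau]
    exact hqo 0 _ (tau_mem_GS hg _)
  set P : Fin (n+1) → II n → Z := fun j k => cp (j, k) (q 0 + b 0) with hP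
  have hPe : ∀ j k, P j k = cp (j, k) (q 0) + b' j k := by
    intro j k
    simp only [hP]
    rw [map_add, hcb, ee_zero, one_smul]
  have hw : ∀ (i : Fin n) k, ∃ w, cp (i.succ, k) (q 0) = ContinuousLinearMap.adjoint J w ∧
      P i.succ k + kap i.succ k • P 0 k = (2:ℂ) • ContinuousLinearMap.adjoint J w - w + (2 * (kap i.succ k * ψ k)) • e := by
    intro i k
    have h := mem_GS.1 (hqG 0) i k
    refine ⟨_, h, ?_⟩
    rw [← h, hPe, hPe, hb'0, hb's, smul_add, smul_smul]
    module
  refine ⟨P, fun j => ?_, fun i k => ?_, fun i k => ?_, fun F Fz hF hFz k => ?_⟩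
  · have h : ∀ a, q a + b a = tau a (q 0 + b 0) := fun a => by rw [hqt a, hbt a, map_add]
    exact rapid_of_orbit (q := fun a => q a + b a) (hqs.add hbs) h j
  · obtain ⟨w, h1, h2⟩ := hw i k
    rw [h2, map_add, map_sub, map_smul, hJ, map_smul, mul_comm, mul_smul, he, ← h1, ← hb's, hPe]
  · obtain ⟨w, h1, h2⟩ := hw i k
    rw [h2, inner_add_right, inner_sub_right, inner_smul_right, inner_smul_right, hee,
      ContinuousLinearMap.adjoint_inner_right]
    have : 2 * ⟪J e, w⟫_ℂ = ⟪e, w⟫_ℂ := by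
      conv_rhs => rw [← he]
      have h2 : (starRingEnd ℂ) 2 = 2 := Complex.conj_ofNat 2
      rw [inner_smul_left, h2]
    rw [this]; ring
  · set R : VN n Z := (1 - HO c 0 : VN n Z →L[ℂ] VN n Z) (q 0 + b 0) with hR
    have hR0 : ∀ k, cp (0, k) R = P 0 k := by
      intro k
      rw [hR, sub_apply, map_sub, cp_HO_zero hc, sub_zero]; rfl
    have hRs : ∀ i k, cp (i.succ, k) R = F i k := by
      intro i k
      have h := (cp_HO_succ hc 0 (q 0 + b 0) i k).tsum_eq
      rw [hR, sub_apply, map_sub, ← h, hF]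
      simp only [ee_zero, one_mul]; rfl
    have hRb : ∀ i k, ‖F i k‖ ≤ ‖R‖ := fun i k => by rw [← hRs]; exact norm_cp_le _ _
    have hsum : ∀ i k, HasSum (fun m => c i m • F i (k - m)) (cv (c i) (F i) k) := by
      intro i k
      refine Summable.hasSum (Summable.of_norm ?_)
      refine Summable.of_nonneg_of_le (fun m => norm_nonneg _) (fun m => ?_) ((hc i).summable_norm.mul_right ‖R‖)
      rw [norm_smul]; gcongr; exact hRb _ _
    apply ext_inner_right ℂ
    intro w
    set JA' := ContinuousLinearMap.adjoint J
    set g0 : Z := JA' w - w with hg0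
    set g : VN n Z := (∑ i : Fin n, sg (i.succ, k) (kap i.succ k • JA' w)) + sg (0, k) g0 with hg
    have hg_0 : ∀ k', cp (0, k') g = if k' = k then g0 else 0 := by
      intro k'
      rw [hg, map_add, map_sum, Finset.sum_eq_zero, zero_add, cp_sg]
      · simp
      · intro i _
        rw [cp_sg, if_neg (fun h => (Fin.succ_ne_zero i).symm (Prod.ext_iff.1 h).1)]
    have hg_s : ∀ (i : Fin n) k', cp (i.succ, k') g = if k' = k then kap i.succ k • JA' w else 0 := by
      intro i k'
      rw [hg, map_add, map_sum, Finset.sum_eq_single i, cp_sg, cp_sg]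
      · simp [Fin.succ_ne_zero]
      · intro i' _ hi
        rw [cp_sg, if_neg (fun h => hi (Fin.succ_injective _ (Prod.ext_iff.1 h).1).symm)]
      · simp
    have hgG : g ∈ GS n J := by
      rw [mem_GS]
      intro i k'
      rw [hg_s, hg_0]
      split_ifs with hk
      · subst hk
        rw [← smul_sub, map_smul, hg0, sub_sub_cancel]
      · simp
    have horth := hqo 0 g hgG
    change ⟪R, (1 - HO c 0 : VN n Z →L[ℂ] VN n Z) g⟫_ℂ = 0 at horth
    rw [sub_apply, inner_sub_right] at horth
    have e1 : ⟪R, (1 : VN n Z →L[ℂ] VN n Z) g⟫_ℂ = (∑ i : Fin n, kap i.succ k * ⟪F i k, JA' w⟫_ℂ) + ⟪P 0 k, g0⟫_ℂ := by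
      change ⟪R, g⟫_ℂ = _
      rw [hg, inner_add_right, inner_sum, inner_sg, hR0]
      congr 1
      refine Finset.sum_congr rfl fun i _ => ?_
      rw [inner_sg, hRs, inner_smul_right]
    have e2 : ⟪R, HO c 0 g⟫_ℂ = ∑ i, ⟪cv (c i) (F i) k, g0⟫_ℂ := by
      unfold HO
      rw [ContinuousLinearMap.sum_apply, inner_sum]
      refine Finset.sum_congr rfl fun i _ => ?_
      have h1 := (hasSum_HO hc 0 g i).mapL (innerSL ℂ R)
      have h2 := (hsum i k).mapL (innerSL ℂ g0)
      rw [← (Equiv.neg (II n)).hasSum_iff] at h2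
      refine h1.unique ?_
      have h3 := h2.star
      convert h3 using 1
      · funext m
        simp only [Function.comp, Equiv.neg_apply, innerSL_apply_apply, ee_zero, one_mul, inner_smul_right, sub_neg_eq_add]
        have hEo : Eo i m g = sg (i.succ, k + m) g0 := by
          apply VV.ext; rintro ⟨j, k'⟩
          rw [cp_Eo, cp_sg, hg_0]
          by_cases hj : j = i.succ
          · subst hj
            have : (k' - m = k) ↔ (k' = k + m) := sub_eq_iff_eq_add
            simp [this]
          · simp [hj]
        rw [hEo, inner_sg, hRs, hcr, star_mul', ← starRingEnd_apply, Complex.conj_conj, ← starRingEnd_apply, inner_conj_symm]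
      · simp only [innerSL_apply_apply]
        rw [← starRingEnd_apply, inner_conj_symm]
    rw [e1, e2] at horth
    have e3 : ⟪Fz k, g0⟫_ℂ = - ∑ i : Fin n, kap i.succ k * ⟪F i k, JA' w⟫_ℂ := by
      rw [hFz, inner_sub_left, sum_inner]
      linear_combination horth
    rw [← ContinuousLinearMap.adjoint_inner_right, inner_sub_left, sum_inner]
    simp only [inner_smul_left, kap_conj]
    rw [hg0, inner_sub_right] at e3
    have e4 : ∑ i : Fin n, -kap i.succ k * ⟪F i k, JA' w⟫_ℂ = - ∑ i : Fin n, kap i.succ k * ⟪F i k, JA' w⟫_ℂ := by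
      rw [← Finset.sum_neg_distrib]; exact Finset.sum_congr rfl fun i _ => by ring
    rw [e4]
    linear_combination -e3
end
end HS
end

noncomputable section
namespace HS
open Set Filter Topology
open scoped ComplexConjugate InnerProductSpace ContDiff

section
variable {d : ℕ} {Y : Type*} [NormedAddCommGroup Y]
variable {Y' : Type*} [NormedAddCommGroup Y']

lemma Rapid.add {c c' : (Fin d → ℤ) → Y} (hc : Rapid c) (hc' : Rapid c') :
    Rapid (fun m => c m + c' m) := by
  intro N
  obtain ⟨C, hC⟩ := hc N
  obtain ⟨C', hC'⟩ := hc' N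
  refine ⟨C + C', fun m => ?_⟩
  have h1 := norm_add_le (c m) (c' m)
  have h2 : (1 + ‖m‖) ^ N * ‖c m + c' m‖ ≤ (1 + ‖m‖) ^ N * (‖c m‖ + ‖c' m‖) := by gcongr
  linarith [hC m, hC' m, mul_add ((1 + ‖m‖) ^ N) ‖c m‖ ‖c' m‖]

lemma Rapid.neg {c : (Fin d → ℤ) → Y} (hc : Rapid c) : Rapid (fun m => - c m) :=
  hc.of_le 1 0 fun m => by simp

lemma Rapid.sub {c c' : (Fin d → ℤ) → Y} (hc : Rapid c) (hc' : Rapid c') :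
    Rapid (fun m => c m - c' m) := by
  simpa [sub_eq_add_neg] using hc.add hc'.neg

lemma Rapid.sum {ι : Type*} (s : Finset ι) {c : ι → (Fin d → ℤ) → Y} (hc : ∀ i, Rapid (c i)) :
    Rapid (fun m => ∑ i ∈ s, c i m) := by
  induction s using Finset.induction_on with
  | empty => intro N; exact ⟨0, fun m => by simp⟩
  | insert a s ha ih => simpa [Finset.sum_insert ha] using (hc a).add ih

variable [NormedSpace ℂ Y] [NormedSpace ℂ Y']

lemma Rapid.clm {c : (Fin d → ℤ) → Y} (hc : Rapid c) (L : Y →L[ℂ] Y') : Rapid (fun m => L (c m)) :=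
  hc.of_le ‖L‖ 0 fun m => by simpa using L.le_opNorm (c m)

lemma FS_per (c : (Fin d → ℤ) → Y) : Per (FS c) := by
  intro x k
  unfold FS
  refine tsum_congr fun m => ?_
  rw [ee_add, ee_int, mul_one]

lemma Rapid.cv {c : (Fin d → ℤ) → ℂ} {p : (Fin d → ℤ) → Y} (hc : Rapid c) (hp : Rapid p) :
    Rapid (cv c p) := by
  intro N
  obtain ⟨C, hC⟩ := hp N
  refine ⟨∑' m, ((1 + ‖m‖) ^ N * ‖c m‖) * C, fun k => ?_⟩
  have hC0 : 0 ≤ C := le_trans (by positivity) (hC 0)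
  have hb : ∀ m, (1 + ‖k‖) ^ N * ‖c m • p (k - m)‖ ≤ ((1 + ‖m‖) ^ N * ‖c m‖) * C := by
    intro m
    have h1 : 1 + ‖k‖ ≤ (1 + ‖m‖) * (1 + ‖k - m‖) := by
      have : ‖k‖ ≤ ‖m‖ + ‖k - m‖ := by
        calc ‖k‖ = ‖m + (k - m)‖ := by congr 1; abel
          _ ≤ _ := norm_add_le _ _
      nlinarith [norm_nonneg m, norm_nonneg (k - m), mul_nonneg (norm_nonneg m) (norm_nonneg (k - m))]
    calc (1 + ‖k‖) ^ N * ‖c m • p (k - m)‖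
        ≤ ((1 + ‖m‖) * (1 + ‖k - m‖)) ^ N * ‖c m • p (k - m)‖ := by gcongr
      _ = ((1 + ‖m‖) ^ N * ‖c m‖) * ((1 + ‖k - m‖) ^ N * ‖p (k - m)‖) := by
          rw [norm_smul, mul_pow]; ring
      _ ≤ _ := by gcongr; exact hC _
  have hs2 := (hc.summable_pow N).mul_right C
  have hs1 : Summable (fun m => (1 + ‖k‖) ^ N * ‖c m • p (k - m)‖) :=
    Summable.of_nonneg_of_le (fun m => by positivity) hb hs2
  have hs0 : Summable (fun m => ‖c m • p (k - m)‖) :=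
    (summable_mul_left_iff (by positivity)).1 hs1
  calc (1 + ‖k‖) ^ N * ‖HS.cv c p k‖ ≤ (1 + ‖k‖) ^ N * ∑' m, ‖c m • p (k - m)‖ := by
        gcongr; exact norm_tsum_le_tsum_norm hs0
    _ = ∑' m, (1 + ‖k‖) ^ N * ‖c m • p (k - m)‖ := by rw [tsum_mul_left]
    _ ≤ _ := Summable.tsum_le_tsum hb hs1 hs2

variable [CompleteSpace Y] [CompleteSpace Y']

lemma FS_clm {c : (Fin d → ℤ) → Y} (hc : Rapid c) (L : Y →L[ℂ] Y') (x : Fin d → ℝ) :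
    L (FS c x) = FS (fun m => L (c m)) x := by
  unfold FS
  rw [L.map_tsum (by
    apply Summable.of_norm
    simpa [norm_smul, ee_norm] using hc.summable_norm)]
  simp

lemma hasSum_FS {c : (Fin d → ℤ) → Y} (hc : Rapid c) (x : Fin d → ℝ) :
    HasSum (fun m => ee m x • c m) (FS c x) := by
  refine Summable.hasSum (Summable.of_norm ?_)
  simpa [norm_smul, ee_norm] using hc.summable_norm

lemma FS_add {c c' : (Fin d → ℤ) → Y} (hc : Rapid c) (hc' : Rapid c') (x : Fin d → ℝ) :
    FS (fun m => c m + c' m) x = FS c x + FS c' x := by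
  refine (hasSum_FS (hc.add hc') x).unique ?_
  simpa using (hasSum_FS hc x).add (hasSum_FS hc' x)

lemma FS_sub {c c' : (Fin d → ℤ) → Y} (hc : Rapid c) (hc' : Rapid c') (x : Fin d → ℝ) :
    FS (fun m => c m - c' m) x = FS c x - FS c' x := by
  refine (hasSum_FS (hc.sub hc') x).unique ?_
  simpa [smul_sub] using (hasSum_FS hc x).sub (hasSum_FS hc' x)

lemma FS_sum {ι : Type*} (s : Finset ι) {c : ι → (Fin d → ℤ) → Y} (hc : ∀ i, Rapid (c i))
    (x : Fin d → ℝ) : FS (fun m => ∑ i ∈ s, c i m) x = ∑ i ∈ s, FS (c i) x := by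
  refine (hasSum_FS (Rapid.sum s hc) x).unique ?_
  simpa [Finset.smul_sum] using hasSum_sum (s := s) fun i _ => hasSum_FS (hc i) x

lemma FS_cv {c : (Fin d → ℤ) → ℂ} {p : (Fin d → ℤ) → Y} (hc : Rapid c) (hp : Rapid p)
    (x : Fin d → ℝ) : FS (cv c p) x = FS c x • FS p x := by
  have hS : Summable (fun q : (Fin d → ℤ) × (Fin d → ℤ) => (ee q.1 x * c q.1) • (ee q.2 x • p q.2)) := by
    apply Summable.of_norm
    have := hc.summable_norm.mul_of_nonneg hp.summable_norm (fun _ => norm_nonneg _) (fun _ => norm_nonneg _)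
    simpa [norm_smul, ee_norm] using this
  have h1 : HasSum (fun q : (Fin d → ℤ) × (Fin d → ℤ) => (ee q.1 x * c q.1) • (ee q.2 x • p q.2))
      (FS c x • FS p x) := by
    have h := hS.hasSum
    have h2 := h.prod_fiberwise (fun m => (hasSum_FS hp x).const_smul (ee m x * c m))
    have h3 := (hasSum_FS hc x).smul_const (FS p x)
    simp only [smul_eq_mul] at h3
    rw [← h2.unique h3]; exact h
  let eq : (Fin d → ℤ) × (Fin d → ℤ) ≃ (Fin d → ℤ) × (Fin d → ℤ) :=
    { toFun := fun q => (q.2, q.1 - q.2)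
      invFun := fun q => (q.1 + q.2, q.1)
      left_inv := fun q => by simp
      right_inv := fun q => by simp }
  have h4 := (eq.hasSum_iff).2 h1
  have h5 := h4.prod_fiberwise (g := fun k => ee k x • cv c p k) (fun k => ?_)
  · exact (hasSum_FS (hc.cv hp) x).unique h5
  · simp only [Function.comp, eq, Equiv.coe_fn_mk]
    have h6 : HasSum (fun m => c m • p (k - m)) (cv c p k) := by
      refine Summable.hasSum (Summable.of_norm ?_)
      obtain ⟨C, hC⟩ := hp 0
      refine Summable.of_nonneg_of_le (fun m => norm_nonneg _) (fun m => ?_) (hc.summable_norm.mul_right C)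
      rw [norm_smul]; gcongr; simpa using hC (k - m)
    convert h6.const_smul (ee k x) using 2 with m
    have : ee k x = ee m x * ee (k - m) x := by rw [← ee_add_left]; congr 1; abel
    rw [this, smul_smul, smul_smul]; congr 1; ring

variable [NormedSpace ℝ Y] [IsScalarTower ℝ ℂ Y]
lemma DD_FS {c : (Fin d → ℤ) → Y} (hc : Rapid c) (i : Fin d) (x : Fin d → ℝ) :
    DD i (FS c) x = FS (fun m => kap i m • c m) x := hc.fderiv i x
end

theorem fun_solve {n : ℕ} (g : Fin n → (Fin (n+1) → ℝ) → ℂ) (hg : ∀ i, ContDiff ℝ ∞ (g i))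
    (hgp : ∀ i, Per (g i)) (hgr : ∀ i x, conj (g i x) = g i x)
    (ψ : (Fin (n+1) → ℝ) → ℂ) (hψ : ContDiff ℝ ∞ ψ) (hψp : Per ψ) :
    ∃ P : Fin (n+1) → (Fin (n+1) → ℝ) → ZS, (∀ j, ContDiff ℝ ∞ (P j)) ∧ (∀ j, Per (P j)) ∧
      (∀ (i : Fin n) x, P i.succ x = JJ (P i.succ x + DD i.succ (P 0) x)) ∧
      (∀ (i : Fin n) x, ev 0 (P i.succ x + DD i.succ (P 0) x) = DD i.succ ψ x) ∧
      ∀ (F : Fin n → (Fin (n+1) → ℝ) → ZS) (Fz : (Fin (n+1) → ℝ) → ZS),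
        (F = fun i x => P i.succ x - g i x • P 0 x) →
        (Fz = fun x => P 0 x - ∑ i, g i x • F i x) →
        ∀ x, Fz x = JJ (Fz x - ∑ i : Fin n, DD i.succ (F i) x) := by
  have hee : ⟪EV 0, EV 0⟫_ℂ = 1 / 2 := by
    rw [inner_EV_EV le_rfl le_rfl]; simp
  have hc : ∀ i, Rapid (fc (g i)) := fun i => rapid_fc (hgp i) (hg i)
  have hψr := rapid_fc hψp hψ
  obtain ⟨P, hP, h1, h2, h3⟩ := coeff_solve JJ JJ_JA (EV 0) two_J_EV0 hee (fun i => fc (g i)) hc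
    (fun i m => fc_conj (hgp i) (hgr i) m) (fc ψ) hψr
  have hk : ∀ i : Fin n, Rapid (fun m => P i.succ m + kap i.succ m • P 0 m) := fun i =>
    (hP i.succ).add ((hP 0).kap_smul i.succ)
  have hsum : ∀ (i : Fin n) x, FS (P i.succ) x + DD i.succ (FS (P 0)) x = FS (fun m => P i.succ m + kap i.succ m • P 0 m) x := by
    intro i x
    rw [DD_FS (hP 0), FS_add (hP i.succ) ((hP 0).kap_smul i.succ)]
  refine ⟨fun j => FS (P j), fun j => (hP j).contDiff, fun j => FS_per _, fun i x => ?_, fun i x => ?_, ?_⟩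
  · simp only
    rw [hsum, FS_clm (hk i)]
    congr 1; funext m; exact h1 i m
  · simp only
    rw [hsum]
    have := FS_clm (hk i) (innerSL ℂ (EV 0)) x
    have e : ev 0 (FS (fun m => P i.succ m + kap i.succ m • P 0 m) x) =
      innerSL ℂ (EV 0) (FS (fun m => P i.succ m + kap i.succ m • P 0 m) x) := rfl
    have e2 : ψ = FS (fc ψ) := funext fun x => (FS_fc hψp hψ x).symm
    have e3 : DD i.succ ψ x = FS (fun m => kap i.succ m • fc ψ m) x := by
      rw [← DD_FS hψr, ← e2]
    rw [e, this, e3]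
    congr 1; funext m; exact h2 i m
  · intro F Fz hF hFz x
    set F' : Fin n → II n → ZS := fun i k => P i.succ k - cv (fc (g i)) (P 0) k with hF'
    set Fz' : II n → ZS := fun k => P 0 k - ∑ i, cv (fc (g i)) (F' i) k with hFz'
    have hF'r : ∀ i, Rapid (F' i) := fun i => (hP i.succ).sub ((hc i).cv (hP 0))
    have hcF : ∀ i, Rapid (cv (fc (g i)) (F' i)) := fun i => (hc i).cv (hF'r i)
    have hFz'r : Rapid Fz' := (hP 0).sub (Rapid.sum _ hcF)
    have eF : ∀ i, F i = FS (F' i) := by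
      intro i; funext x
      rw [hF, hF', FS_sub (hP i.succ) ((hc i).cv (hP 0)), FS_cv (hc i) (hP 0), FS_fc (hgp i) (hg i)]
    have eFz : ∀ x, Fz x = FS Fz' x := by
      intro x
      rw [hFz, hFz', FS_sub (hP 0) (Rapid.sum _ hcF), FS_sum _ hcF]
      show FS (P 0) x - ∑ i, g i x • F i x = _
      congr 1
      refine Finset.sum_congr rfl fun i _ => ?_
      rw [FS_cv (hc i) (hF'r i), FS_fc (hgp i) (hg i), eF]
    have hkF : ∀ i : Fin n, Rapid (fun m => kap i.succ m • F' i m) := fun i => (hF'r i).kap_smul i.succ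
    have e5 : ∑ i : Fin n, DD i.succ (F i) x = FS (fun m => ∑ i : Fin n, kap i.succ m • F' i m) x := by
      rw [FS_sum _ hkF]
      refine Finset.sum_congr rfl fun i _ => ?_
      rw [eF, DD_FS (hF'r i)]
    rw [e5, eFz, ← FS_sub hFz'r (Rapid.sum _ hkF), FS_clm (hFz'r.sub (Rapid.sum _ hkF))]
    congr 1; funext m
    exact h3 F' Fz' (fun i k => rfl) (fun k => rfl) m

end HS
end

noncomputable section
namespace HS
open Set Filter Topology
open scoped ComplexConjugate InnerProductSpace ContDiff

lemma contDiff_smulC {E Y : Type*} [NormedAddCommGroup E] [NormedSpace ℝ E]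
    [NormedAddCommGroup Y] [NormedSpace ℂ Y] [NormedSpace ℝ Y] [IsScalarTower ℝ ℂ Y]
    {f : E → ℂ} {g : E → Y} (hf : ContDiff ℝ ∞ f) (hg : ContDiff ℝ ∞ g) :
    ContDiff ℝ ∞ (fun x => f x • g x) := hf.smul hg

section
variable {d : ℕ} {Y : Type*} [NormedAddCommGroup Y] [NormedSpace ℂ Y] [NormedSpace ℝ Y] [IsScalarTower ℝ ℂ Y]
lemma DD_add {f g : (Fin d → ℝ) → Y} (hf : ContDiff ℝ ∞ f) (hg : ContDiff ℝ ∞ g) (i : Fin d) (x) :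
    DD i (fun x => f x + g x) x = DD i f x + DD i g x := by
  unfold DD
  rw [fderiv_fun_add (hf.differentiable (by simp) x) (hg.differentiable (by simp) x)]; rfl
end


section
variable {d : ℕ} {Y : Type*} [NormedAddCommGroup Y] [NormedSpace ℂ Y] [NormedSpace ℝ Y] [IsScalarTower ℝ ℂ Y]
lemma DD_sum {ι : Type*} (s : Finset ι) {f : ι → (Fin d → ℝ) → Y} (hf : ∀ i, ContDiff ℝ ∞ (f i)) (i : Fin d) (x) :
    DD i (fun x => ∑ j ∈ s, f j x) x = ∑ j ∈ s, DD i (f j) x := by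
  unfold DD
  rw [fderiv_fun_sum (fun j _ => (hf j).differentiable (by simp) x)]; simp
lemma DD_neg (f : (Fin d → ℝ) → Y) (i : Fin d) (x) :
    DD i (fun x => - f x) x = - DD i f x := by
  unfold DD
  rw [fderiv_fun_neg]; rfl
end

/-- flux components -/
def FF {n : ℕ} (g : Fin n → (Fin (n+1) → ℝ) → ℂ) (P : Fin (n+1) → (Fin (n+1) → ℝ) → ZS) (i : Fin n)
    (x : Fin (n+1) → ℝ) : ZS := P i.succ x - g i x • P 0 x

def alp {n : ℕ} (g : Fin n → (Fin (n+1) → ℝ) → ℂ) (x : Fin (n+1) → ℝ) : ℂ := 1 + ∑ i, g i x * g i x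

def Fv {n : ℕ} (g : Fin n → (Fin (n+1) → ℝ) → ℂ) (P : Fin (n+1) → (Fin (n+1) → ℝ) → ZS)
    (x : Fin (n+1) → ℝ) : ZS := alp g x • P 0 x - ∑ i : Fin n, g i x • P i.succ x

/-- divergence of flux -/
def dvF {n : ℕ} (g : Fin n → (Fin (n+1) → ℝ) → ℂ) (P : Fin (n+1) → (Fin (n+1) → ℝ) → ZS)
    (x : Fin (n+1) → ℝ) : ZS := ∑ i : Fin n, DD i.succ (FF g P i) x

structure Sys {n : ℕ} (g : Fin n → (Fin (n+1) → ℝ) → ℂ) (P : Fin (n+1) → (Fin (n+1) → ℝ) → ZS) : Prop where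
  sm : ∀ j, ContDiff ℝ ∞ (P j)
  per : ∀ j, Per (P j)
  curl : ∀ (i : Fin n) x, P i.succ x = JJ (P i.succ x + DD i.succ (P 0) x)
  div : ∀ x, Fv g P x = JJ (Fv g P x - dvF g P x)

def nxt {n : ℕ} (g : Fin n → (Fin (n+1) → ℝ) → ℂ) (P : Fin (n+1) → (Fin (n+1) → ℝ) → ZS) :
    Fin (n+1) → (Fin (n+1) → ℝ) → ZS :=
  Fin.cases (fun x => (alp g x)⁻¹ • (- dvF g P x + ∑ i : Fin n, g i x • DD i.succ (P 0) x))
    (fun i => DD i.succ (P 0))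

section
variable {n : ℕ} {g : Fin n → (Fin (n+1) → ℝ) → ℂ}

lemma contDiff_alp (hg : ∀ i, ContDiff ℝ ∞ (g i)) : ContDiff ℝ ∞ (alp g) :=
  contDiff_const.add (ContDiff.sum fun i _ => (hg i).mul (hg i))

lemma Sys.contDiff_FF (hg : ∀ i, ContDiff ℝ ∞ (g i)) {P} (h : Sys g P) (i) : ContDiff ℝ ∞ (FF g P i) :=
  (h.sm i.succ).sub (contDiff_smulC (hg i) (h.sm 0))

lemma Sys.contDiff_dvF (hg : ∀ i, ContDiff ℝ ∞ (g i)) {P} (h : Sys g P) : ContDiff ℝ ∞ (dvF g P) :=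
  ContDiff.sum fun i _ => contDiff_DD (h.contDiff_FF hg i)

lemma Sys.step (hg : ∀ i, ContDiff ℝ ∞ (g i)) (hα : ∀ x, alp g x ≠ 0) {P} (h : Sys g P) (j x) : P j x = JJ (P j x + nxt g P j x) := by
  refine Fin.cases ?_ (fun i => h.curl i x) j
  have h0 : alp g x • (P 0 x + nxt g P 0 x) =
      (Fv g P x - dvF g P x) + ∑ i : Fin n, g i x • (P i.succ x + DD i.succ (P 0) x) := by
    have : nxt g P 0 x = (alp g x)⁻¹ • (- dvF g P x + ∑ i : Fin n, g i x • DD i.succ (P 0) x) := rfl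
    rw [this, smul_add, smul_inv_smul₀ (hα x)]
    simp only [Fv, smul_add, Finset.sum_add_distrib]
    abel
  have h1 : alp g x • JJ (P 0 x + nxt g P 0 x) = alp g x • P 0 x := by
    rw [← map_smul, h0, map_add, ← h.div, map_sum]
    simp only [map_smul, ← h.curl, Fv]
    abel
  have := congrArg (fun y => (alp g x)⁻¹ • y) h1
  simpa [inv_smul_smul₀ (hα x)] using this.symm

lemma Sys.next_sm (hg : ∀ i, ContDiff ℝ ∞ (g i)) (hα : ∀ x, alp g x ≠ 0) {P} (h : Sys g P) (j) : ContDiff ℝ ∞ (nxt g P j) := by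
  refine Fin.cases ?_ (fun i => contDiff_DD (h.sm 0)) j
  refine contDiff_smulC ((contDiff_alp hg).inv hα) ((h.contDiff_dvF hg).neg.add (ContDiff.sum fun i _ => ?_))
  exact contDiff_smulC (hg i) (contDiff_DD (h.sm 0))

lemma Fv_nxt (hg : ∀ i, ContDiff ℝ ∞ (g i)) (hα : ∀ x, alp g x ≠ 0) (P) (x) : Fv g (nxt g P) x = - dvF g P x := by
  have : nxt g P 0 x = (alp g x)⁻¹ • (- dvF g P x + ∑ i : Fin n, g i x • DD i.succ (P 0) x) := rfl
  rw [Fv, this, smul_inv_smul₀ (hα x)]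
  have : ∀ i : Fin n, nxt g P i.succ x = DD i.succ (P 0) x := fun i => rfl
  simp only [this]; abel

lemma Sys.next (hg : ∀ i, ContDiff ℝ ∞ (g i)) (hgp : ∀ i, Per (g i)) (hα : ∀ x, alp g x ≠ 0) {P} (h : Sys g P) : Sys g (nxt g P) := by
  have hFp : ∀ i, Per (FF g P i) := by
    intro i x k; simp only [FF, h.per _ x k, hgp _ x k]
  have hαp : Per (alp g) := by intro x k; simp only [alp, hgp _ x k]
  have hsm := h.next_sm hg hα
  have hst := h.step hg hα
  have hFF : ∀ (i : Fin n) x, FF g P i x = JJ (FF g P i x + FF g (nxt g P) i x) := by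
    intro i x
    have e : FF g P i x + FF g (nxt g P) i x = (P i.succ x + nxt g P i.succ x) - g i x • (P 0 x + nxt g P 0 x) := by
      simp only [FF, smul_add]; abel
    rw [e, map_sub, map_smul, ← hst, ← hst]; rfl
  refine ⟨hsm, ?_, ?_, ?_⟩
  · intro j
    refine Fin.cases ?_ (fun i => (h.per 0).DD) j
    intro x k
    have e1 : ∀ i : Fin n, DD i.succ (FF g P i) (x + fun i => (k i : ℝ)) = DD i.succ (FF g P i) x := fun i =>
      (hFp i).DD x k
    have e2 : ∀ i : Fin n, DD i.succ (P 0) (x + fun i => (k i : ℝ)) = DD i.succ (P 0) x := fun i => (h.per 0).DD x k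
    simp only [nxt, Fin.cases_zero, dvF, e1, e2, hαp x k, hgp _ x k]
  · intro i x
    have e : nxt g P i.succ x = DD i.succ (fun x => JJ (P 0 x + nxt g P 0 x)) x := by
      show DD i.succ (P 0) x = _
      congr 1; funext x; exact hst 0 x
    rw [e, DD_clm JJ ((h.sm 0).add (hsm 0)), DD_add (h.sm 0) (hsm 0)]
    congr 2
    rw [DD_clm JJ ((h.sm 0).add (hsm 0)), ← DD_add (h.sm 0) (hsm 0)] at *
    rw [← e]; rfl
  · intro x
    rw [Fv_nxt hg hα]
    have hF' : ∀ i, ContDiff ℝ ∞ (FF g (nxt g P) i) := fun i => (hsm i.succ).sub (contDiff_smulC (hg i) (hsm 0))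
    have e : dvF g P x = JJ (dvF g P x + dvF g (nxt g P) x) := by
      simp only [dvF]
      rw [← Finset.sum_add_distrib, map_sum]
      refine Finset.sum_congr rfl fun i _ => ?_
      rw [← DD_add (h.contDiff_FF hg i) (hF' i), ← DD_clm JJ ((h.contDiff_FF hg i).add (hF' i))]
      congr 1; funext x; exact hFF i x
    calc - dvF g P x = - JJ (dvF g P x + dvF g (nxt g P) x) := by rw [← e]
      _ = _ := by rw [← map_neg]; congr 1; abel
end

end HS
end

noncomputable section
namespace HS
open Set Filter Topology
open scoped ComplexConjugate InnerProductSpace ContDiff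

lemma nat_le_inf (k : ℕ) : ((k : ℕ∞) : WithTop ℕ∞) ≤ ∞ := by exact_mod_cast le_top
lemma nat_le_inf' (k : ℕ) : (k : WithTop ℕ∞) ≤ ∞ := nat_le_inf k

section dvsec
variable {E Y : Type*} [NormedAddCommGroup E] [NormedSpace ℝ E] [NormedAddCommGroup Y] [NormedSpace ℝ Y]

/-- directional derivative -/
def dv (v : E) (f : E → Y) (p : E) : Y := fderiv ℝ f p v

lemma contDiff_dv (v : E) {f : E → Y} (hf : ContDiff ℝ ∞ f) : ContDiff ℝ ∞ (dv v f) :=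
  (hf.fderiv_right (m := ∞) (by simp)).clm_apply contDiff_const

lemma dv_comm (v w : E) {f : E → Y} (hf : ContDiff ℝ ∞ f) : dv v (dv w f) = dv w (dv v f) := by
  funext p
  have hd : DifferentiableAt ℝ (fderiv ℝ f) p :=
    ((hf.fderiv_right (m := ∞) (by simp)).differentiable (by simp)) p
  have e : ∀ a b : E, dv a (dv b f) p = fderiv ℝ (fderiv ℝ f) p a b := by
    intro a b
    show fderiv ℝ (fun q => fderiv ℝ f q b) p a = _
    rw [fderiv_clm_apply hd (differentiableAt_const _)]; simp
  rw [e, e]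
  exact (hf.contDiffAt.isSymmSndFDerivAt (by simpa using nat_le_inf' 2)) v w

lemma contDiff_dv_iter (v : E) {f : E → Y} (hf : ContDiff ℝ ∞ f) (l : ℕ) : ContDiff ℝ ∞ ((dv v)^[l] f) := by
  induction l with
  | zero => exact hf
  | succ l ih => rw [Function.iterate_succ_apply']; exact contDiff_dv v ih

lemma dv_iter_comm (v w : E) {f : E → Y} (hf : ContDiff ℝ ∞ f) (l : ℕ) :
    (dv v)^[l] (dv w f) = dv w ((dv v)^[l] f) := by
  induction l with
  | zero => rfl
  | succ l ih => rw [Function.iterate_succ_apply', ih, dv_comm v w (contDiff_dv_iter v hf l), Function.iterate_succ_apply']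

lemma dv_iter_eq (v : E) {f : E → Y} (hf : ContDiff ℝ ∞ f) (l : ℕ) (p : E) :
    (dv v)^[l] f p = iteratedFDeriv ℝ l f p (fun _ => v) := by
  induction l generalizing p with
  | zero => simp
  | succ l ih =>
    rw [Function.iterate_succ_apply', iteratedFDeriv_succ_apply_left]
    have : (dv v)^[l] f = fun p => iteratedFDeriv ℝ l f p (fun _ => v) := funext ih
    rw [this]
    have hd : DifferentiableAt ℝ (iteratedFDeriv ℝ l f) p :=
      (hf.differentiable_iteratedFDeriv (WithTop.coe_lt_coe.2 (ENat.coe_lt_top l))) p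
    show fderiv ℝ (fun p => iteratedFDeriv ℝ l f p (fun _ => v)) p v = _
    have h2 := ((ContinuousMultilinearMap.apply ℝ (fun _ : Fin l => E) Y (fun _ => v)).hasFDerivAt.comp p hd.hasFDerivAt).fderiv
    have e3 : (fun p => iteratedFDeriv ℝ l f p (fun _ => v)) =
       (ContinuousMultilinearMap.apply ℝ (fun _ : Fin l => E) Y (fun _ => v)) ∘ (iteratedFDeriv ℝ l f) := rfl
    rw [e3, h2]; rfl
end dvsec

section borel
variable {d : ℕ} {Y : Type*} [NormedAddCommGroup Y] [NormedSpace ℝ Y] [CompleteSpace Y]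

def chi : ContDiffBump (0:ℝ) := ⟨1, 2, one_pos, one_lt_two⟩

lemma bdd_iter_per {om : (Fin d → ℝ) → Y} (h : ContDiff ℝ ∞ om) (hp : Per om) (k : ℕ) :
    ∃ C, ∀ x, ‖iteratedFDeriv ℝ k om x‖ ≤ C := by
  refine Per.bounded (f := iteratedFDeriv ℝ k om) (fun x m => ?_)
    (h.continuous_iteratedFDeriv (by exact_mod_cast le_top))
  rw [← iteratedFDeriv_comp_add_right]
  congr 1; funext y; exact hp y m

def th (l : ℕ) (z : ℝ) : ℝ := z ^ l / (l.factorial) * chi z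

lemma contDiff_th (l : ℕ) : ContDiff ℝ ∞ (th l) :=
  ((contDiff_id.pow l).div_const _).mul chi.contDiff

lemma bdd_iter_th (l k : ℕ) : ∃ C, ∀ x, ‖iteratedFDeriv ℝ k (th l) x‖ ≤ C := by
  have hs : HasCompactSupport (th l) := HasCompactSupport.mul_left chi.hasCompactSupport
  exact (hs.iteratedFDeriv k).exists_bound_of_continuous
    ((contDiff_th l).continuous_iteratedFDeriv (by exact_mod_cast le_top))

def gl (om : (Fin d → ℝ) → Y) (l : ℕ) (p : (Fin d → ℝ) × ℝ) : Y := th l p.2 • om p.1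

lemma contDiff_gl {om : (Fin d → ℝ) → Y} (h : ContDiff ℝ ∞ om) (l : ℕ) : ContDiff ℝ ∞ (gl om l) :=
  ((contDiff_th l).comp contDiff_snd).smul (h.comp contDiff_fst)

lemma bdd_gl {om : (Fin d → ℝ) → Y} (h : ContDiff ℝ ∞ om) (hp : Per om) (l k : ℕ) :
    ∃ C, 0 ≤ C ∧ ∀ p, ‖iteratedFDeriv ℝ k (gl om l) p‖ ≤ C := by
  choose A hA using bdd_iter_per h hp
  choose B hB using bdd_iter_th l
  have hA0 : ∀ k, 0 ≤ A k := fun k => (norm_nonneg _).trans (hA k 0)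
  have hB0 : ∀ k, 0 ≤ B k := fun k => (norm_nonneg _).trans (hB k 0)
  refine ⟨∑ i ∈ Finset.range (k + 1), (k.choose i : ℝ) * B i * A (k - i),
    Finset.sum_nonneg fun i _ => by have := hA0 (k-i); have := hB0 i; positivity, fun p => ?_⟩
  have := norm_iteratedFDeriv_smul_le (𝕜 := ℝ) (f := fun p : (Fin d → ℝ) × ℝ => th l p.2) (g := fun p => om p.1)
    ((contDiff_th l).comp contDiff_snd) (h.comp contDiff_fst) p (n := k) (by exact_mod_cast le_top)
  refine this.trans (Finset.sum_le_sum fun i _ => ?_)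
  have e1 := norm_iteratedFDeriv_comp_right_le (ContinuousLinearMap.snd ℝ (Fin d → ℝ) ℝ) (k := i) ((contDiff_th l).of_le (by exact_mod_cast le_top)) p
  have e2 := norm_iteratedFDeriv_comp_right_le (ContinuousLinearMap.fst ℝ (Fin d → ℝ) ℝ) (k := k - i) (h.of_le (nat_le_inf' _)) p
  have f1 : ‖iteratedFDeriv ℝ i (fun p : (Fin d → ℝ) × ℝ => th l p.2) p‖ ≤ B i := by
    refine e1.trans ?_
    calc _ ≤ B i * 1 ^ i := by
          gcongr
          · exact hB0 i
          · exact hB i _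
          · exact ContinuousLinearMap.norm_snd_le ..
      _ = B i := by simp
  have f2 : ‖iteratedFDeriv ℝ (k - i) (fun p : (Fin d → ℝ) × ℝ => om p.1) p‖ ≤ A (k - i) := by
    refine e2.trans ?_
    calc _ ≤ A (k - i) * 1 ^ (k - i) := by
          gcongr
          · exact hA0 _
          · exact hA _ _
          · exact ContinuousLinearMap.norm_fst_le ..
      _ = _ := by simp
  have := hB0 i
  gcongr

/-- scaling in the vertical variable -/
def scl (d : ℕ) (e : ℝ) : ((Fin d → ℝ) × ℝ) →L[ℝ] ((Fin d → ℝ) × ℝ) :=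
  (ContinuousLinearMap.fst ℝ _ _).prod (e⁻¹ • ContinuousLinearMap.snd ℝ _ _)

lemma scl_norm {e : ℝ} (he : 0 < e) (he1 : e ≤ 1) : ‖scl d e‖ ≤ e⁻¹ := by
  have h1 : 1 ≤ e⁻¹ := (one_le_inv₀ he).2 he1
  refine ContinuousLinearMap.opNorm_le_bound _ (by positivity) fun p => ?_
  rw [Prod.norm_def]
  refine max_le ?_ ?_
  · show ‖p.1‖ ≤ _
    calc ‖p.1‖ ≤ 1 * ‖p‖ := by rw [one_mul]; exact norm_fst_le p
      _ ≤ _ := by gcongr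
  · show ‖e⁻¹ • p.2‖ ≤ _
    rw [norm_smul, Real.norm_of_nonneg (by positivity)]
    gcongr; exact norm_snd_le p

lemma dv_iter_prod {θ : ℝ → ℝ} (hθ : ContDiff ℝ ∞ θ) {w : (Fin d → ℝ) → Y} (hw : ContDiff ℝ ∞ w) (k : ℕ) :
    (dv ((0:Fin d → ℝ), (1:ℝ)))^[k] (fun p => θ p.2 • w p.1) = fun p => iteratedDeriv k θ p.2 • w p.1 := by
  induction k with
  | zero => simp
  | succ k ih =>
    rw [Function.iterate_succ_apply', ih]
    funext p
    have h1 : DifferentiableAt ℝ (iteratedDeriv k θ) p.2 :=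
      hθ.differentiable_iteratedDeriv k (WithTop.coe_lt_coe.2 (ENat.coe_lt_top k)) p.2
    have h2 : HasFDerivAt (fun p : (Fin d → ℝ) × ℝ => iteratedDeriv k θ p.2) _ p :=
      h1.hasDerivAt.hasFDerivAt.comp p hasFDerivAt_snd
    have h3 : HasFDerivAt (fun p : (Fin d → ℝ) × ℝ => w p.1) _ p :=
      ((hw.differentiable (by simp)) p.1).hasFDerivAt.comp p hasFDerivAt_fst
    have := (h2.fun_smul h3).fderiv
    show fderiv ℝ (fun p : (Fin d → ℝ) × ℝ => iteratedDeriv k θ p.2 • w p.1) p (0, 1) = _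
    rw [this, iteratedDeriv_succ]
    simp

theorem borel (om : ℕ → (Fin d → ℝ) → Y) (h : ∀ l, ContDiff ℝ ∞ (om l)) (hp : ∀ l, Per (om l)) :
    ∃ b : (Fin d → ℝ) × ℝ → Y, ContDiff ℝ ∞ b ∧ (∀ z, Per (fun u => b (u, z))) ∧
      ∀ l u, (dv ((0:Fin d → ℝ), (1:ℝ)))^[l] b (u, 0) = om l u := by
  choose C hC0 hC using fun l k => bdd_gl (h l) (hp l) l k
  set D : ℕ → ℝ := fun l => 1 + ∑ k ∈ Finset.range l, C l k with hD
  have hD1 : ∀ l, 1 ≤ D l := fun l => by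
    have : 0 ≤ ∑ k ∈ Finset.range l, C l k := Finset.sum_nonneg fun k _ => hC0 l k
    simp only [hD]; linarith
  set e : ℕ → ℝ := fun l => (1/2) ^ l / D l with he
  have he0 : ∀ l, 0 < e l := fun l => by have := hD1 l; simp only [he]; positivity
  have he1 : ∀ l, e l ≤ 1 := fun l => by
    simp only [he]; rw [div_le_one (by linarith [hD1 l])]
    exact (pow_le_one₀ (by norm_num) (by norm_num)).trans (hD1 l)
  set f : ℕ → (Fin d → ℝ) × ℝ → Y := fun l => (e l ^ l) • (gl (om l) l ∘ scl d (e l)) with hf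
  have hfs : ∀ l, ContDiff ℝ ∞ (f l) := fun l =>
    contDiff_const.smul ((contDiff_gl (h l) l).comp (scl d (e l)).contDiff)
  set v : ℕ → ℕ → ℝ := fun k l => e l ^ l * (C l k * (e l)⁻¹ ^ k) with hv
  have hb : ∀ k l p, ‖iteratedFDeriv ℝ k (f l) p‖ ≤ v k l := by
    intro k l p
    have hg : ContDiff ℝ k (gl (om l) l ∘ scl d (e l)) :=
      ((contDiff_gl (h l) l).comp (scl d (e l)).contDiff).of_le (by exact_mod_cast le_top)
    simp only [hf, hv]
    rw [iteratedFDeriv_const_smul_apply hg.contDiffAt, norm_smul, Real.norm_of_nonneg (by have := he0 l; positivity)]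
    have := he0 l
    gcongr
    refine (norm_iteratedFDeriv_comp_right_le _ ((contDiff_gl (h l) l).of_le (by exact_mod_cast le_top)) p).trans ?_
    gcongr
    · exact hC0 l k
    · exact hC l k _
    · exact scl_norm (he0 l) (he1 l)
  have hvs : ∀ k, Summable (v k) := by
    intro k
    refine Summable.of_norm_bounded_eventually_nat (g := fun l => (1/2:ℝ)^l) (summable_geometric_of_lt_one (by norm_num) (by norm_num)) ?_
    filter_upwards [eventually_gt_atTop k] with l hl
    have h0 := he0 l
    have hCk : C l k ≤ D l := by
      have := Finset.single_le_sum (f := fun k => C l k) (fun k _ => hC0 l k) (Finset.mem_range.2 hl)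
      simp only [hD]; linarith
    rw [Real.norm_of_nonneg (by have := hC0 l k; simp only [hv]; positivity)]
    have e1 : v k l = e l ^ (l - k) * C l k := by
      simp only [hv]
      have : e l ^ l = e l ^ (l - k) * e l ^ k := by rw [← pow_add]; congr 1; omega
      rw [this, inv_pow]
      have h1 : e l ^ k ≠ 0 := (pow_pos h0 k).ne'
      rw [mul_assoc, mul_left_comm (e l ^ k), mul_inv_cancel₀ h1, mul_one]
    rw [e1]
    calc e l ^ (l - k) * C l k ≤ e l ^ 1 * D l := by
          apply mul_le_mul _ hCk (hC0 l k) (by positivity)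
          exact pow_le_pow_of_le_one h0.le (he1 l) (by omega)
      _ = (1/2)^l := by have := hD1 l; simp only [he, pow_one]; field_simp
  have hsm : ContDiff ℝ ∞ (fun p => ∑' l, f l p) :=
    contDiff_tsum (N := ⊤) hfs (fun k _ => hvs k) (fun k l p _ => hb k l p)
  refine ⟨fun p => ∑' l, f l p, hsm, ?_, ?_⟩
  · intro z u m
    refine tsum_congr fun l => ?_
    show e l ^ l • (th l _ • om l (u + fun i => (m i : ℝ))) = e l ^ l • (th l _ • om l u)
    rw [hp l]; rfl
  · intro k u
    rw [dv_iter_eq _ hsm, iteratedFDeriv_tsum_apply (N := ⊤) hfs (fun k _ => hvs k) (fun k l p _ => hb k l p) le_top]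
    have hsum : Summable (fun l => iteratedFDeriv ℝ k (f l) (u, 0)) :=
      Summable.of_norm_bounded (hvs k) (fun l => hb k l _)
    have h2 := (ContinuousMultilinearMap.apply ℝ (fun _ : Fin k => (Fin d → ℝ) × ℝ) Y (fun _ => ((0:Fin d → ℝ), (1:ℝ)))).map_tsum hsum
    have h3 : ∀ l z, (dv ((0:Fin d → ℝ), (1:ℝ)))^[k] (f l) (u, z) = iteratedDeriv k (fun z => e l ^ l * th l ((e l)⁻¹ * z)) z • om l u := by
      intro l z
      have e0 : f l = fun p : (Fin d → ℝ) × ℝ => (fun z => e l ^ l * th l ((e l)⁻¹ * z)) p.2 • om l p.1 := by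
        funext p
        show e l ^ l • (th l ((e l)⁻¹ • p.2) • om l p.1) = _
        rw [smul_smul]; rfl
      rw [e0, dv_iter_prod (θ := fun z => e l ^ l * th l ((e l)⁻¹ * z)) (contDiff_const.mul ((contDiff_th l).comp (contDiff_const.mul contDiff_id))) (h l) k]
    have h4 : ∀ l, iteratedDeriv k (fun z => e l ^ l * th l ((e l)⁻¹ * z)) 0 = if l = k then 1 else 0 := by
      intro l
      have e1 : (fun z => e l ^ l * th l ((e l)⁻¹ * z)) =ᶠ[𝓝 0] fun z => ((l.factorial : ℝ))⁻¹ * z ^ l := by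
        have hc : Tendsto (fun z : ℝ => (e l)⁻¹ * z) (𝓝 0) (𝓝 0) := by
          have : Continuous (fun z : ℝ => (e l)⁻¹ * z) := by fun_prop
          simpa using this.tendsto 0
        filter_upwards [hc.eventually chi.eventuallyEq_one] with z hz
        have h0 := he0 l
        have hz' : chi ((e l)⁻¹ * z) = 1 := hz
        rw [th, hz', mul_pow, inv_pow]
        have h1 : e l ^ l ≠ 0 := (pow_pos h0 l).ne'
        generalize e l ^ l = a at h1
        field_simp
      rw [e1.iteratedDeriv_eq]
      rw [iteratedDeriv_const_mul_field, iteratedDeriv_fun_pow_zero]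
      by_cases hl : k = l
      · simp [hl, Nat.factorial_ne_zero]
      · simp [hl, Ne.symm hl]
    have h5 : ∀ l, iteratedFDeriv ℝ k (f l) (u, 0) (fun _ => ((0:Fin d → ℝ), (1:ℝ))) = if l = k then om k u else 0 := by
      intro l
      rw [← dv_iter_eq _ (hfs l), h3, h4]
      split_ifs with hl
      · rw [hl, one_smul]
      · rw [zero_smul]
    refine h2.trans ?_
    show ∑' l, iteratedFDeriv ℝ k (f l) (u, 0) (fun _ => ((0:Fin d → ℝ), (1:ℝ))) = _
    simp only [h5, tsum_ite_eq]
end borel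
end HS
end

noncomputable section
namespace HS
open Set Filter Topology
open scoped ComplexConjugate InnerProductSpace ContDiff

/-- integrated evaluation vector -/
def EI (z : ℝ) : ZS := ∫ s in (0:ℝ)..z, EV s

lemma hasDerivAt_EI (z : ℝ) : HasDerivAt EI (EV z) z :=
  intervalIntegral.integral_hasDerivAt_right (continuous_EV.intervalIntegrable _ _)
    (continuous_EV.stronglyMeasurableAtFilter _ _) continuous_EV.continuousAt

lemma EI_zero : EI 0 = 0 := by simp [EI]

lemma continuous_EI : Continuous EI := continuous_iff_continuousAt.2 fun z => (hasDerivAt_EI z).continuousAt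

def eI (z : ℝ) (k : ZS) : ℂ := ⟪EI z, k⟫_ℂ

lemma eI_zero (k : ZS) : eI 0 k = 0 := by simp [eI, EI_zero]

lemma hasDerivAt_inner_left {E : ℝ → ZS} {E' : ZS} {z : ℝ} (h : HasDerivAt E E' z) (k : ZS) :
    HasDerivAt (fun z => ⟪E z, k⟫_ℂ) ⟪E', k⟫_ℂ z := by
  have := h.inner ℂ (hasDerivAt_const z k)
  simpa using this

lemma hasDerivAt_eI (z : ℝ) (k : ZS) : HasDerivAt (fun z => eI z k) (ev z k) z :=
  hasDerivAt_inner_left (hasDerivAt_EI z) k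

lemma ev_ftc {k k2 : ZS} (hk : k = JJ k2) {z : ℝ} (hz : z ≤ 0) :
    ev z k = ev 0 k + eI z (k2 - k) := by
  have hd : ∀ s ∈ Iic (0:ℝ), HasDerivWithinAt (fun s => ev s k - eI s (k2 - k)) 0 (Iic 0) s := by
    intro s hs
    have := (hasDerivWithinAt_ev hk hs).sub (hasDerivAt_eI s (k2 - k)).hasDerivWithinAt
    rw [ev_sub, sub_self] at this
    exact this
  have h := (convex_Iic (0:ℝ)).norm_image_sub_le_of_norm_hasDerivWithin_le (C := 0) hd (fun x _ => by simp)
    (show z ∈ Iic (0:ℝ) from hz) (show (0:ℝ) ∈ Iic (0:ℝ) from le_refl (0:ℝ))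
  rw [zero_mul] at h
  have h2 := sub_eq_zero.1 (norm_le_zero_iff.1 h)
  simp only [eI_zero] at h2
  rw [sub_zero] at h2
  rw [h2]; ring

lemma glue_deriv {p q p' q' : ℝ → ℂ} (hp : ∀ z, HasDerivAt p (p' z) z) (hq : ∀ z, HasDerivAt q (q' z) z)
    (h0 : p 0 = q 0) (h1 : p' 0 = q' 0) (z : ℝ) :
    HasDerivAt (fun z => if z ≤ 0 then p z else q z) (if z ≤ 0 then p' z else q' z) z := by
  rcases lt_trichotomy z 0 with h | h | h
  · rw [if_pos h.le]
    refine (hp z).congr_of_eventuallyEq ?_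
    filter_upwards [Iio_mem_nhds h] with w hw
    rw [if_pos (le_of_lt hw)]
  · subst h
    rw [if_pos le_rfl]
    have a : HasDerivWithinAt (fun z => if z ≤ 0 then p z else q z) (p' 0) (Iic 0) 0 :=
      (hp 0).hasDerivWithinAt.congr (fun w hw => if_pos hw) (if_pos le_rfl)
    have b : HasDerivWithinAt (fun z => if z ≤ 0 then p z else q z) (p' 0) (Ici 0) 0 := by
      rw [h1]
      refine (hq 0).hasDerivWithinAt.congr (fun w hw => ?_) ?_
      · by_cases hw0 : w ≤ 0
        · have : w = 0 := le_antisymm hw0 hw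
          subst this; rw [if_pos le_rfl, h0]
        · rw [if_neg hw0]
      · rw [if_pos le_rfl, h0]
    have := a.union b
    rwa [Iic_union_Ici, hasDerivWithinAt_univ] at this
  · rw [if_neg (not_le.2 h)]
    refine (hq z).congr_of_eventuallyEq ?_
    filter_upwards [Ioi_mem_nhds h] with w hw
    rw [if_neg (not_le.2 hw)]

section
variable {d : ℕ} {Y : Type*} [NormedAddCommGroup Y] [NormedSpace ℝ Y]

def ez (d : ℕ) : (Fin d → ℝ) × ℝ := (0, 1)
def ex {d : ℕ} (j : Fin d) : (Fin d → ℝ) × ℝ := (Pi.single j 1, 0)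

/-- the linear form with given partial derivatives -/
def gradL (a : Fin d → Y) : (Fin d → ℝ) →L[ℝ] Y :=
  ∑ j, (ContinuousLinearMap.proj (R := ℝ) (φ := fun _ : Fin d => ℝ) j).smulRight (a j)

lemma gradL_apply (a : Fin d → Y) (x : Fin d → ℝ) : gradL a x = ∑ j, x j • a j := by
  simp [gradL]

lemma fderiv_eq_gradL (f : (Fin d → ℝ) → Y) (x : Fin d → ℝ) :
    fderiv ℝ f x = gradL (fun j => DD j f x) := by
  ext v
  rw [gradL_apply]
  conv_lhs => rw [pi_eq_sum_univ' v]
  rw [map_sum]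
  refine Finset.sum_congr rfl fun j _ => ?_
  rw [map_smul, DD]

lemma contDiff_gradL {E : Type*} [NormedAddCommGroup E] [NormedSpace ℝ E] {N} {a : Fin d → E → Y}
    (h : ∀ j, ContDiff ℝ N (a j)) : ContDiff ℝ N (fun p => gradL (fun j => a j p)) :=
  ContDiff.sum fun j _ => contDiff_const.smulRight (h j)

lemma dv_ex (F : (Fin d → ℝ) × ℝ → Y) (hF : ContDiff ℝ ∞ F) (j : Fin d) (u : Fin d → ℝ) (z : ℝ) :
    dv (ex j) F (u, z) = DD j (fun u => F (u, z)) u := by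
  have h := HasFDerivAt.comp (g := F) (f := fun e => (e, z)) u ((hF.differentiable (by simp)) (u, z)).hasFDerivAt (hasFDerivAt_prodMk_left u z)
  have h2 : fderiv ℝ (fun u => F (u, z)) u = _ := h.fderiv
  rw [DD, h2]; simp [dv, ex]

lemma hasDerivAt_z (F : (Fin d → ℝ) × ℝ → Y) (hF : ContDiff ℝ ∞ F) (u : Fin d → ℝ) (z : ℝ) :
    HasDerivAt (fun z => F (u, z)) (dv (ez d) F (u, z)) z := by
  have h := HasFDerivAt.comp (g := F) (f := fun e => (u, e)) z ((hF.differentiable (by simp)) (u, z)).hasFDerivAt (hasFDerivAt_prodMk_right u z)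
  have := h.hasDerivAt
  simp only [ContinuousLinearMap.comp_apply, ContinuousLinearMap.inr_apply] at this
  exact this

theorem contDiff_family {S : Set ((Fin d → ℝ) × ℝ → Y)} (hc : ∀ f ∈ S, Continuous f)
    (hx : ∀ f ∈ S, ∃ a : Fin d → ((Fin d → ℝ) × ℝ → Y), (∀ j, a j ∈ S) ∧
      ∀ u z, HasFDerivAt (fun u => f (u, z)) (gradL (fun j => a j (u, z))) u)
    (hz : ∀ f ∈ S, ∃ b ∈ S, ∀ u z, HasDerivAt (fun z => f (u, z)) (b (u, z)) z) :
    ∀ f ∈ S, ContDiff ℝ ∞ f := by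
  have key : ∀ k : ℕ, ∀ f ∈ S, ContDiff ℝ k f := by
    intro k
    induction k with
    | zero => intro f hf; simpa using hc f hf
    | succ k ih =>
      intro f hf
      obtain ⟨a, ha, ha'⟩ := hx f hf
      obtain ⟨b, hb, hb'⟩ := hz f hf
      have hca : Continuous (fun p : (Fin d → ℝ) × ℝ => gradL (fun j => a j p)) :=
        (contDiff_gradL (N := 0) fun j => by simpa using hc _ (ha j)).continuous
      have hcb : Continuous (fun p : (Fin d → ℝ) × ℝ => ContinuousLinearMap.toSpanSingleton ℝ (b p)) := by
        have := hc b hb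
        exact (ContinuousLinearMap.toSpanSingletonCLE (𝕜 := ℝ) (E := Y)).continuous.comp this
      have hd : ∀ p, HasFDerivAt f ((gradL (fun j => a j p)).coprod (ContinuousLinearMap.toSpanSingleton ℝ (b p))) p := by
        intro p
        exact (hasStrictFDerivAt_uncurry_coprod (𝕜 := ℝ) (u := p) (f := fun u z => f (u, z))
          (f₁ := fun u z => gradL (fun j => a j (u, z))) (f₂ := fun u z => ContinuousLinearMap.toSpanSingleton ℝ (b (u, z)))
          (Eventually.of_forall fun v => ha' v.1 v.2) (Eventually.of_forall fun v => (hb' v.1 v.2).hasFDerivAt)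
          hca.continuousAt hcb.continuousAt).hasFDerivAt
      have : ((k + 1 : ℕ) : WithTop ℕ∞) = (k : WithTop ℕ∞) + 1 := by norm_cast
      rw [this, contDiff_succ_iff_hasFDerivAt]
      refine ⟨_, ?_, hd⟩
      have e : ∀ p, (gradL (fun j => a j p)).coprod (ContinuousLinearMap.toSpanSingleton ℝ (b p)) =
          (gradL (fun j => a j p)).comp (ContinuousLinearMap.fst ℝ _ _) +
          (ContinuousLinearMap.snd ℝ (Fin d → ℝ) ℝ).smulRight (b p) := by
        intro p; ext <;> simp
      simp only [e]
      exact ((contDiff_gradL fun j => ih _ (ha j)).clm_comp contDiff_const).add (contDiff_const.smulRight (ih b hb))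
  intro f hf
  exact contDiff_infty.2 fun k => key k f hf
end

section
variable {d : ℕ}

def GG (c : (Fin d → ℝ) → ℂ) (k : (Fin d → ℝ) → ZS) (b : (Fin d → ℝ) × ℝ → ℂ) (p : (Fin d → ℝ) × ℝ) : ℂ :=
  if p.2 ≤ 0 then c p.1 + eI p.2 (k p.1) else b p

structure Glu (f : (Fin d → ℝ) × ℝ → ℂ) (G : ℕ → (Fin d → ℝ) → ZS) (c : (Fin d → ℝ) → ℂ) (b : (Fin d → ℝ) × ℝ → ℂ) : Prop where
  hG : ∀ l, ContDiff ℝ ∞ (G l)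
  hJ : ∀ l x, G l x = JJ (G l x + G (l+1) x)
  hc : ContDiff ℝ ∞ c
  hb : ContDiff ℝ ∞ b
  h0 : ∀ u, b (u, 0) = c u
  h1 : ∀ l u, (dv (ez d))^[l+1] b (u, 0) = ev 0 (G l u + G (l+1) u)
  hf : f = GG c (fun u => G 0 u + G 1 u) b

variable {f : (Fin d → ℝ) × ℝ → ℂ} {G : ℕ → (Fin d → ℝ) → ZS} {c : (Fin d → ℝ) → ℂ} {b : (Fin d → ℝ) × ℝ → ℂ}

lemma Glu.continuous (h : Glu f G c b) : Continuous f := by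
  rw [h.hf]
  refine Continuous.if_le ?_ h.hb.continuous continuous_snd continuous_const ?_
  · refine (h.hc.continuous.comp continuous_fst).add ?_
    exact (continuous_EI.comp continuous_snd).inner (((h.hG 0).continuous.comp continuous_fst).add ((h.hG 1).continuous.comp continuous_fst))
  · rintro ⟨u, z⟩ hz
    simp only at hz
    subst hz
    simp [eI_zero, h.h0]

lemma Glu.dz (h : Glu f G c b) : Glu (GG (fun u => ev 0 (G 0 u + G 1 u)) (fun u => G 1 u + G 2 u) (dv (ez d) b))
    (fun l => G (l+1)) (fun u => ev 0 (G 0 u + G 1 u)) (dv (ez d) b) := by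
  refine ⟨fun l => h.hG _, fun l => h.hJ _, ?_, contDiff_dv _ h.hb, fun u => h.h1 0 u, fun l u => h.h1 (l+1) u, rfl⟩
  exact ContDiff.inner ℂ contDiff_const ((h.hG 0).add (h.hG 1))

lemma Glu.hasDeriv (h : Glu f G c b) (u z) : HasDerivAt (fun z => f (u, z))
    (GG (fun u => ev 0 (G 0 u + G 1 u)) (fun u => G 1 u + G 2 u) (dv (ez d) b) (u, z)) z := by
  have := glue_deriv (p := fun z => c u + eI z (G 0 u + G 1 u)) (q := fun z => b (u, z))
    (fun z => (hasDerivAt_eI z _).const_add (c u)) (fun z => hasDerivAt_z b h.hb u z) (by simp [eI_zero, h.h0])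
    (h.h1 0 u).symm z
  rw [h.hf]
  refine HasDerivAt.congr_deriv (f := fun z => GG c (fun u => G 0 u + G 1 u) b (u, z)) this ?_
  unfold GG
  simp only
  split_ifs with hz
  · have hk : G 0 u + G 1 u = JJ ((G 0 u + G 1 u) + (G 1 u + G 2 u)) := by
      rw [map_add, ← h.hJ, ← h.hJ]
    have := ev_ftc hk hz
    rw [this]; congr 2; rw [add_sub_cancel_left]
  · rfl

lemma Glu.dx (h : Glu f G c b) (j : Fin d) : Glu (GG (DD j c) (fun u => DD j (G 0) u + DD j (G 1) u) (dv (ex j) b))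
    (fun l => DD j (G l)) (DD j c) (dv (ex j) b) := by
  refine ⟨fun l => contDiff_DD (h.hG l), fun l x => ?_, contDiff_DD h.hc, contDiff_dv _ h.hb, fun u => ?_, fun l u => ?_, rfl⟩
  · rw [← DD_add (h.hG l) (h.hG _), ← DD_clm JJ ((h.hG l).add (h.hG _))]
    congr 1; funext x; exact h.hJ l x
  · rw [dv_ex b h.hb]; congr 1; funext u; exact h.h0 u
  · rw [dv_iter_comm _ _ h.hb, dv_ex _ (contDiff_dv_iter _ h.hb _)]
    have : (fun u => (dv (ez d))^[l+1] b (u, 0)) = fun u => (innerSL ℂ (EV 0)) (G l u + G (l+1) u) :=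
      funext fun u => h.h1 l u
    rw [this, DD_clm _ ((h.hG l).add (h.hG _)), DD_add (h.hG l) (h.hG _)]; rfl

lemma DD_eI {k : (Fin d → ℝ) → ZS} (hk : ContDiff ℝ ∞ k) (z : ℝ) (j u) :
    DD j (fun u => eI z (k u)) u = eI z (DD j k u) := DD_clm (innerSL ℂ (EI z)) hk j u

lemma Glu.hasFDeriv (h : Glu f G c b) (u z) : HasFDerivAt (fun u => f (u, z))
    (gradL (fun j => GG (DD j c) (fun u => DD j (G 0) u + DD j (G 1) u) (dv (ex j) b) (u, z))) u := by
  rw [h.hf]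
  unfold GG
  by_cases hz : z ≤ 0
  · simp only [hz, if_true]
    have hs : ContDiff ℝ ∞ (fun u => c u + eI z (G 0 u + G 1 u)) :=
      h.hc.add (ContDiff.inner ℂ contDiff_const ((h.hG 0).add (h.hG 1)))
    have := ((hs.differentiable (by simp)) u).hasFDerivAt
    rw [fderiv_eq_gradL] at this
    refine this.congr_fderiv ?_
    congr 1; funext j
    erw [DD_add h.hc (ContDiff.inner ℂ contDiff_const ((h.hG 0).add (h.hG 1))), DD_eI ((h.hG 0).add (h.hG 1)), DD_add (h.hG 0) (h.hG 1)]
  · simp only [hz, if_false]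
    have hs : ContDiff ℝ ∞ (fun u => b (u, z)) := h.hb.comp (contDiff_id.prodMk contDiff_const)
    have := ((hs.differentiable (by simp)) u).hasFDerivAt
    rw [fderiv_eq_gradL] at this
    refine this.congr_fderiv ?_
    congr 1; funext j
    exact (dv_ex b h.hb j u z).symm

lemma Glu.contDiff (h : Glu f G c b) : ContDiff ℝ ∞ f := by
  refine contDiff_family (S := {f | ∃ G c b, Glu f G c b}) ?_ ?_ ?_ f ⟨G, c, b, h⟩
  · rintro f ⟨G, c, b, h⟩; exact h.continuous
  · rintro f ⟨G, c, b, h⟩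
    exact ⟨_, fun j => ⟨_, _, _, h.dx j⟩, h.hasFDeriv⟩
  · rintro f ⟨G, c, b, h⟩
    exact ⟨_, ⟨_, _, _, h.dz⟩, h.hasDeriv⟩

theorem exists_Glu (hG : ∀ l, ContDiff ℝ ∞ (G l)) (hJ : ∀ l x, G l x = JJ (G l x + G (l+1) x))
    (hGp : ∀ l, Per (G l)) (hc : ContDiff ℝ ∞ c) (hcp : Per c) :
    ∃ b f, Glu f G c b ∧ ∀ z, Per (fun u => f (u, z)) := by
  obtain ⟨b, hb, hbp, hb1⟩ := borel (fun l => Nat.casesOn l c (fun l u => ev 0 (G l u + G (l+1) u)))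
    (fun l => by
      cases l with
      | zero => exact hc
      | succ l => exact ContDiff.inner ℂ contDiff_const ((hG l).add (hG _)))
    (fun l => by
      cases l with
      | zero => exact hcp
      | succ l => intro x k; simp only [hGp _ x k])
  refine ⟨b, _, ⟨hG, hJ, hc, hb, fun u => hb1 0 u, fun l u => hb1 (l+1) u, rfl⟩, ?_⟩
  intro z x k
  have := hbp z x k
  simp only at this
  simp only [GG, hGp _ x k, hcp x k, this]
end
end HS
end

noncomputable section
namespace HS
open Set Filter Topology
open scoped ComplexConjugate InnerProductSpace ContDiff

section
variable {d : ℕ}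
structure L2S (w : (Fin d → ℝ) × ℝ → ℂ) (K : ℕ → (Fin d → ℝ) → ZS) : Prop where
  sm : ContDiff ℝ ∞ w
  hK : ∀ l, ContDiff ℝ ∞ (K l)
  hp : ∀ l, Per (K l)
  hJ : ∀ l x, K l x = JJ (K l x + K (l+1) x)
  hw : ∀ u z, z ≤ 0 → w (u, z) = ev z (K 0 u + K 1 u)

variable {w w' : (Fin d → ℝ) × ℝ → ℂ} {K K' : ℕ → (Fin d → ℝ) → ZS}

lemma L2S.dz (h : L2S w K) : L2S (dv (ez d) w) (fun l => K (l+1)) := by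
  refine ⟨contDiff_dv _ h.sm, fun l => h.hK _, fun l => h.hp _, fun l => h.hJ _, fun u z hz => ?_⟩
  have h1 := (hasDerivAt_z w h.sm u z).hasDerivWithinAt (s := Iic 0)
  have hk : K 0 u + K 1 u = JJ ((K 0 u + K 1 u) + (K 1 u + K 2 u)) := by
      rw [map_add, ← h.hJ, ← h.hJ]
  have h2 := hasDerivWithinAt_ev hk hz
  have h3 : HasDerivWithinAt (fun z => w (u, z)) (ev z (K 0 u + K 1 u + (K 1 u + K 2 u)) - ev z (K 0 u + K 1 u)) (Iic 0) z :=
    h2.congr (fun y hy => h.hw u y hy) (h.hw u z hz)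
  have := (uniqueDiffOn_Iic (0:ℝ) z hz).eq_deriv _ h1 h3
  rw [this, ← ev_sub, add_sub_cancel_left]

lemma L2S.dx (h : L2S w K) (j : Fin d) : L2S (dv (ex j) w) (fun l => DD j (K l)) := by
  refine ⟨contDiff_dv _ h.sm, fun l => contDiff_DD (h.hK l), fun l => (h.hp l).DD, fun l x => ?_, fun u z hz => ?_⟩
  · rw [← DD_add (h.hK l) (h.hK _), ← DD_clm JJ ((h.hK l).add (h.hK _))]
    congr 1; funext x; exact h.hJ l x
  · rw [dv_ex w h.sm]
    have : (fun u => w (u, z)) = fun u => (innerSL ℂ (EV z)) (K 0 u + K 1 u) := funext fun u => h.hw u z hz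
    rw [this, DD_clm _ ((h.hK 0).add (h.hK 1)), DD_add (h.hK 0) (h.hK 1)]; rfl

lemma L2S.add (h : L2S w K) (h' : L2S w' K') : L2S (fun p => w p + w' p) (fun l u => K l u + K' l u) := by
  refine ⟨h.sm.add h'.sm, fun l => (h.hK l).add (h'.hK l), fun l x k => ?_, fun l x => ?_, fun u z hz => ?_⟩
  · simp only [h.hp l x k, h'.hp l x k]
  · have e : K l x + K' l x + (K (l+1) x + K' (l+1) x) = (K l x + K (l+1) x) + (K' l x + K' (l+1) x) := by abel
    rw [e, map_add, ← h.hJ, ← h'.hJ]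
  · rw [h.hw u z hz, h'.hw u z hz, ← ev_add]; congr 1; abel

lemma L2S.mul (h : L2S w K) {a : (Fin d → ℝ) → ℂ} (ha : ContDiff ℝ ∞ a) (hap : Per a) :
    L2S (fun p => a p.1 * w p) (fun l u => a u • K l u) := by
  refine ⟨(ha.comp contDiff_fst).mul h.sm, fun l => contDiff_smulC ha (h.hK l), fun l x k => ?_, fun l x => ?_, fun u z hz => ?_⟩
  · simp only [h.hp l x k, hap x k]
  · rw [← smul_add, map_smul, ← h.hJ]
  · rw [h.hw u z hz, ← ev_smul]; congr 1; rw [smul_add]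

lemma L2S.sum {ι : Type*} (s : Finset ι) {w : ι → (Fin d → ℝ) × ℝ → ℂ} {K : ι → ℕ → (Fin d → ℝ) → ZS}
    (h : ∀ i, L2S (w i) (K i)) : L2S (fun p => ∑ i ∈ s, w i p) (fun l u => ∑ i ∈ s, K i l u) := by
  refine ⟨ContDiff.sum fun i _ => (h i).sm, fun l => ContDiff.sum fun i _ => (h i).hK l, fun l x k => ?_, fun l x => ?_, fun u z hz => ?_⟩
  · simp only [fun i => (h i).hp l x k]
  · rw [← Finset.sum_add_distrib, map_sum]; simp only [← fun i => (h i).hJ l x]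
  · rw [← Finset.sum_add_distrib]
    have : ev z (∑ i ∈ s, (K i 0 u + K i 1 u)) = ∑ i ∈ s, ev z (K i 0 u + K i 1 u) := by
      simp only [ev, inner_sum]
    rw [this]
    exact Finset.sum_congr rfl fun i _ => (h i).hw u z hz

/-- square root growth of the integrated evaluation -/
lemma norm_eI_le (z : ℝ) (hz : z ≤ 0) (k : ZS) : ‖eI z k‖ ≤ Real.sqrt |z| * ‖k‖ := by
  have h1 : eI z k = ∫ s in (0:ℝ)..z, ev s k := by
    have := intervalIntegral.integral_eq_sub_of_hasDerivAt (a := 0) (b := z) (fun s _ => hasDerivAt_eI s k)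
      ((continuous_ev k).intervalIntegrable _ _)
    rw [this, eI_zero, sub_zero]
  rw [h1, intervalIntegral.integral_symm, norm_neg, intervalIntegral.integral_of_le hz]
  have hsub : Ioc z 0 ⊆ Iic (0:ℝ) := Ioc_subset_Iic_self
  have hi : IntegrableOn (fun s => ‖ev s k‖^2) (Ioc z 0) := (integrable_ev_sq k).mono_measure (Measure.restrict_mono hsub le_rfl)
  have hle : ∫ s in Ioc z 0, ‖ev s k‖^2 ≤ ‖k‖^2 := by
    refine le_trans ?_ (integral_ev_sq_le k)
    exact setIntegral_mono_set (integrable_ev_sq k) (Eventually.of_forall fun s => by positivity) hsub.eventuallyLE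
  have hI : IntegrableOn (fun s => ‖ev s k‖) (Ioc z 0) := ((continuous_ev k).norm.integrableOn_Icc).mono_set Ioc_subset_Icc_self
  refine (norm_integral_le_integral_norm _).trans ?_
  set Iv := ∫ s in Ioc z 0, ‖ev s k‖ with hIdef
  -- quadratic argument
  have hI0 : 0 ≤ Iv := setIntegral_nonneg measurableSet_Ioc fun s _ => norm_nonneg _
  have hsq : Iv ^ 2 ≤ |z| * ‖k‖^2 := by
    rcases eq_or_lt_of_le hz with h0 | h0
    · have : Iv = 0 := by rw [hIdef, h0]; simp
      rw [this]; simp; positivity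
    have hz' : |z| = -z := abs_of_neg h0
    set t := Iv / |z| with ht
    have hpz : 0 < |z| := abs_pos.2 h0.ne
    have hn : 0 ≤ ∫ s in Ioc z 0, (‖ev s k‖ - t)^2 := setIntegral_nonneg measurableSet_Ioc fun s _ => sq_nonneg _
    have he : ∫ s in Ioc z 0, (‖ev s k‖ - t)^2 = (∫ s in Ioc z 0, ‖ev s k‖^2) - 2 * t * Iv + t^2 * |z| := by
      have : (fun s => (‖ev s k‖ - t)^2) = fun s => (‖ev s k‖^2 - 2 * t * ‖ev s k‖) + t^2 := by funext s; ring
      have hA : IntegrableOn (fun s => ‖ev s k‖^2 - 2 * t * ‖ev s k‖) (Ioc z 0) := hi.sub (hI.const_mul _)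
      have hC : IntegrableOn (fun _ : ℝ => t^2) (Ioc z 0) := integrableOn_const (by simp)
      rw [this, integral_add hA hC, integral_sub hi (hI.const_mul _), integral_const_mul]
      simp [hz', h0.le]; ring
    rw [he] at hn
    have h2 : Iv = t * |z| := by rw [ht]; field_simp
    have : t * t * |z| ≤ ‖k‖^2 := by
      rw [h2] at hn; nlinarith
    rw [h2]; nlinarith
  calc Iv = Real.sqrt (Iv^2) := (Real.sqrt_sq hI0).symm
    _ ≤ Real.sqrt (|z| * ‖k‖^2) := Real.sqrt_le_sqrt hsq
    _ = _ := by rw [Real.sqrt_mul (abs_nonneg z), Real.sqrt_sq (norm_nonneg _)]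
end

section
variable {n : ℕ}

theorem v_exists (ht : (Fin (n+1) → ℝ) → ℝ) (hs : ContDiff ℝ ∞ ht) (hper : Per ht) :
    ∃ v : (Fin (n+1) → ℝ) × ℝ → ℂ, ContDiff ℝ ∞ v ∧ (∀ z, Per (fun u => v (u, z))) ∧
      (∀ u, v (u, 0) = ht u) ∧ (∃ K, L2S (dv (ez _) v) K) ∧ (∀ i : Fin n, ∃ K, L2S (dv (ex i.succ) v) K) ∧
      (∃ C, ∀ u z, z ≤ 0 → ‖dv (ex 0) v (u, z)‖ ≤ C * (1 + Real.sqrt |z|)) ∧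
      ∀ F : Fin n → (Fin (n+1) → ℝ) × ℝ → ℂ,
       (F = fun i p => dv (ex i.succ) v p - ((DD i.succ ht p.1 : ℝ) : ℂ) * dv (ez _) v p) →
       ∀ u z, z ≤ 0 → dv (ez _) (dv (ez _) v) (u, z) +
        ∑ i : Fin n, (dv (ex i.succ) (F i) (u, z) - ((DD i.succ ht u : ℝ) : ℂ) * dv (ez _) (F i) (u, z)) = 0 := by
  set g : Fin n → (Fin (n+1) → ℝ) → ℂ := fun i u => ((DD i.succ ht u : ℝ) : ℂ) with hgdef
  have hg : ∀ i, ContDiff ℝ ∞ (g i) := fun i => Complex.ofRealCLM.contDiff.comp (contDiff_DD hs)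
  have hgp : ∀ i, Per (g i) := fun i x k => by
    have := hper.DD (i := i.succ) x k
    simp only [hgdef, this]
  have hgr : ∀ i x, conj (g i x) = g i x := fun i x => Complex.conj_ofReal _
  set ψ : (Fin (n+1) → ℝ) → ℂ := fun u => (ht u : ℂ) with hψdef
  have hψ : ContDiff ℝ ∞ ψ := Complex.ofRealCLM.contDiff.comp hs
  have hψp : Per ψ := fun x k => by simp only [hψdef, hper x k]
  obtain ⟨P, hP, hPp, hcurl, hbd, hdiv⟩ := fun_solve g hg hgp hgr ψ hψ hψp
  have hα : ∀ x, alp g x ≠ 0 := by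
    intro x hx
    have : alp g x = ((1 + ∑ i : Fin n, DD i.succ ht x * DD i.succ ht x : ℝ) : ℂ) := by
      simp [alp, hgdef]
    rw [this] at hx
    have h0 : (0:ℝ) ≤ ∑ i : Fin n, DD i.succ ht x * DD i.succ ht x := Finset.sum_nonneg fun i _ => mul_self_nonneg _
    have := Complex.ofReal_eq_zero.1 hx
    linarith
  have hSys : Sys g P := by
    refine ⟨hP, hPp, hcurl, fun x => ?_⟩
    have := hdiv (FF g P) _ rfl rfl x
    have e : ∀ x, Fv g P x = P 0 x - ∑ i, g i x • FF g P i x := by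
      intro x
      simp only [Fv, FF, alp, add_smul, one_smul, smul_sub, Finset.sum_sub_distrib, Finset.sum_smul, smul_smul]
      abel
    rw [e x]; exact this
  have hPl : ∀ l, Sys g ((nxt g)^[l] P) := by
    intro l
    induction l with
    | zero => exact hSys
    | succ l ih => rw [Function.iterate_succ_apply']; exact ih.next hg hgp hα
  have hJl : ∀ l j x, (nxt g)^[l] P j x = JJ ((nxt g)^[l] P j x + (nxt g)^[l+1] P j x) := by
    intro l j x
    rw [Function.iterate_succ_apply']; exact (hPl l).step hg hα j x
  set G : ℕ → (Fin (n+1) → ℝ) → ZS := fun l => (nxt g)^[l] P 0 with hG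
  obtain ⟨b, v, hv, hvp⟩ := exists_Glu (G := G) (c := ψ) (fun l => (hPl l).sm 0) (fun l => hJl l 0) (fun l => (hPl l).per 0) hψ hψp
  have hvs := hv.contDiff
  have hval : ∀ u z, z ≤ 0 → v (u, z) = ψ u + eI z (G 0 u + G 1 u) := by
    intro u z hz; rw [hv.hf]; simp [GG, hz]
  -- vertical derivative
  have hZ : L2S (dv (ez _) v) G := by
    refine ⟨contDiff_dv _ hvs, fun l => (hPl l).sm 0, fun l => (hPl l).per 0, fun l => hJl l 0, fun u z hz => ?_⟩
    have := (hasDerivAt_z v hvs u z).unique (hv.hasDeriv u z)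
    rw [this]
    have hk : G 0 u + G 1 u = JJ ((G 0 u + G 1 u) + (G 1 u + G 2 u)) := by
      rw [map_add, ← hv.hJ, ← hv.hJ]
    rw [ev_ftc hk hz]
    simp only [GG, hz, if_true]
    rw [add_sub_cancel_left]
  have hdx : ∀ j u z, z ≤ 0 → dv (ex j) v (u, z) = DD j ψ u + eI z (DD j (G 0) u + DD j (G 1) u) := by
    intro j u z hz
    rw [dv_ex v hvs]
    have : (fun u => v (u, z)) = fun u => ψ u + eI z (G 0 u + G 1 u) := funext fun u => hval u z hz
    rw [this]
    have e1 : ContDiff ℝ ∞ (fun u => eI z (G 0 u + G 1 u)) := ContDiff.inner ℂ contDiff_const ((hv.hG 0).add (hv.hG 1))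
    rw [DD_add hψ e1, DD_eI ((hv.hG 0).add (hv.hG 1)), DD_add (hv.hG 0) (hv.hG 1)]
  have hX : ∀ i : Fin n, L2S (dv (ex i.succ) v) (fun l => (nxt g)^[l] P i.succ) := by
    intro i
    refine ⟨contDiff_dv _ hvs, fun l => (hPl l).sm _, fun l => (hPl l).per _, fun l => hJl l _, fun u z hz => ?_⟩
    have hk : (nxt g)^[0] P i.succ u + (nxt g)^[1] P i.succ u = JJ (((nxt g)^[0] P i.succ u + (nxt g)^[1] P i.succ u) + ((nxt g)^[1] P i.succ u + (nxt g)^[2] P i.succ u)) := by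
      rw [map_add, ← hJl, ← hJl]
    rw [ev_ftc hk hz, hdx _ u z hz, add_sub_cancel_left]
    congr 1
    exact (hbd i u).symm
  refine ⟨v, hvs, hvp, ?_, ⟨_, hZ⟩, fun i => ⟨_, hX i⟩, ?_, ?_⟩
  · intro u; rw [hval u 0 le_rfl, eI_zero, add_zero]
  · obtain ⟨C1, hC1⟩ := Per.bounded (f := DD 0 ψ) hψp.DD (contDiff_DD hψ).continuous
    obtain ⟨C2, hC2⟩ := Per.bounded (f := fun u => DD 0 (G 0) u + DD 0 (G 1) u)
      (fun x k => by
        have e1 := ((hPl 0).per 0).DD (i := 0) x k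
        have e2 := ((hPl 1).per 0).DD (i := 0) x k
        simp only [hG, e1, e2]) (((contDiff_DD (hv.hG 0)).add (contDiff_DD (hv.hG 1))).continuous)
    refine ⟨C1 + C2, fun u z hz => ?_⟩
    rw [hdx 0 u z hz]
    refine (norm_add_le _ _).trans ?_
    have h1 := hC1 u
    have h2 := (norm_eI_le z hz (DD 0 (G 0) u + DD 0 (G 1) u))
    have h3 := hC2 u
    have h4 := Real.sqrt_nonneg |z|
    have h5 : 0 ≤ C1 := (norm_nonneg _).trans h1
    have h6 : 0 ≤ C2 := (norm_nonneg _).trans h3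
    have h7 : Real.sqrt |z| * ‖DD 0 (G 0) u + DD 0 (G 1) u‖ ≤ Real.sqrt |z| * C2 := mul_le_mul_of_nonneg_left h3 h4
    nlinarith [mul_nonneg h5 h4]
  · intro F hF u z hz
    have hFi : ∀ i, L2S (F i) (fun l => FF g ((nxt g)^[l] P) i) := by
      intro i
      have := (hX i).add (hZ.mul (a := fun u => - g i u) (hg i).neg (fun x k => by simp only [hgp i x k]))
      convert this using 1
      · rw [hF]; funext p; simp only [hgdef]; ring
      · funext l u; simp only [FF, hG, neg_smul, sub_eq_add_neg]
    have hV : L2S (fun p => dv (ez _) v p + ∑ i, (- g i p.1) * F i p) (fun l u => G l u + ∑ i, (- g i u) • FF g ((nxt g)^[l] P) i u) :=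
      hZ.add (L2S.sum Finset.univ fun i => (hFi i).mul (hg i).neg (fun x k => by simp only [hgp i x k]))
    have e1 := hV.dz.hw u z hz
    have e2 : ∀ l u, G l u + ∑ i, (- g i u) • FF g ((nxt g)^[l] P) i u = Fv g ((nxt g)^[l] P) u := by
      intro l x
      simp only [Fv, FF, alp, add_smul, one_smul, smul_sub, Finset.sum_sub_distrib, Finset.sum_smul, smul_smul, hG, neg_smul, Finset.sum_neg_distrib, neg_mul]
      abel
    have e3 : ∀ l u, Fv g ((nxt g)^[l+1] P) u = - dvF g ((nxt g)^[l] P) u := by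
      intro l u
      rw [Function.iterate_succ_apply']; exact Fv_nxt hg hα _ _
    simp only [e2, e3] at e1
    have e4 : ∀ i : Fin n, dv (ex i.succ) (F i) (u, z) = ev z (DD i.succ (FF g ((nxt g)^[0] P) i) u + DD i.succ (FF g ((nxt g)^[1] P) i) u) :=
      fun i => ((hFi i).dx i.succ).hw u z hz
    have e5 : dv (ez _) (fun p => dv (ez _) v p + ∑ i, (- g i p.1) * F i p) (u, z) =
        dv (ez _) (dv (ez _) v) (u, z) + ∑ i, (- g i u) * dv (ez _) (F i) (u, z) := by
      have hd1 := hasDerivAt_z _ hZ.sm u z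
      have hd2 : ∀ i, HasDerivAt (fun z => (- g i u) * F i (u, z)) ((- g i u) * dv (ez _) (F i) (u, z)) z :=
        fun i => (hasDerivAt_z _ (hFi i).sm u z).const_mul _
      exact (hasDerivAt_z _ hV.sm u z).unique (hd1.add (HasDerivAt.fun_sum fun i _ => hd2 i))
    rw [e5] at e1
    rw [Finset.sum_sub_distrib]
    simp only [e4]
    have e6 : ∑ i : Fin n, ev z (DD i.succ (FF g ((nxt g)^[0] P) i) u + DD i.succ (FF g ((nxt g)^[1] P) i) u)
        = - ev z (-dvF g ((nxt g)^[0] P) u + -dvF g ((nxt g)^[1] P) u) := by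
      simp only [dvF, ← Finset.sum_neg_distrib, ← Finset.sum_add_distrib]
      simp only [ev, inner_sum]
      rw [← Finset.sum_neg_distrib]
      refine Finset.sum_congr rfl fun i _ => ?_
      rw [← inner_neg_right]; congr 1; abel
    rw [e6, ← e1]
    simp only [neg_mul, Finset.sum_neg_distrib]
    ring
end
end HS
end

noncomputable section
namespace HS
open Set Filter Topology
open scoped ComplexConjugate InnerProductSpace ContDiff

section
variable {d : ℕ}

/-- sheared real part -/
def sh (ht : (Fin d → ℝ) → ℝ) (w : (Fin d → ℝ) × ℝ → ℂ) (p : (Fin d → ℝ) × ℝ) : ℝ :=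
  (w (p.1, p.2 - ht p.1)).re

variable {ht : (Fin d → ℝ) → ℝ} {w : (Fin d → ℝ) × ℝ → ℂ}

lemma contDiff_sh (hs : ContDiff ℝ ∞ ht) (hw : ContDiff ℝ ∞ w) : ContDiff ℝ ∞ (sh ht w) :=
  Complex.reCLM.contDiff.comp (hw.comp (contDiff_fst.prodMk (contDiff_snd.sub (hs.comp contDiff_fst))))

lemma dv_sh (hs : ContDiff ℝ ∞ ht) (hw : ContDiff ℝ ∞ w) (v : (Fin d → ℝ) × ℝ) (p) :
    dv v (sh ht w) p = (fderiv ℝ w (p.1, p.2 - ht p.1) (v.1, v.2 - fderiv ℝ ht p.1 v.1)).re := by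
  have h1 : HasFDerivAt (fun q : (Fin d → ℝ) × ℝ => (q.1, q.2 - ht q.1))
      ((ContinuousLinearMap.fst ℝ _ _).prod (ContinuousLinearMap.snd ℝ _ _ - (fderiv ℝ ht p.1).comp (ContinuousLinearMap.fst ℝ _ _))) p :=
    hasFDerivAt_fst.prodMk (hasFDerivAt_snd.sub
      (HasFDerivAt.comp (g := ht) (f := fun q : (Fin d → ℝ) × ℝ => q.1) p
        ((hs.differentiable (by simp)) p.1).hasFDerivAt hasFDerivAt_fst))
  have h2 := HasFDerivAt.comp (g := w) (f := fun q : (Fin d → ℝ) × ℝ => (q.1, q.2 - ht q.1)) p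
    ((hw.differentiable (by simp)) (p.1, p.2 - ht p.1)).hasFDerivAt h1
  have h3 : HasFDerivAt (sh ht w) _ p := Complex.reCLM.hasFDerivAt.comp p h2
  rw [dv, h3.fderiv]; simp

lemma dv_sh_ez (hs : ContDiff ℝ ∞ ht) (hw : ContDiff ℝ ∞ w) : dv (ez d) (sh ht w) = sh ht (dv (ez d) w) := by
  funext p; rw [dv_sh hs hw]; simp [ez, sh, dv]

lemma dv_sh_ex (hs : ContDiff ℝ ∞ ht) (hw : ContDiff ℝ ∞ w) (j : Fin d) : dv (ex j) (sh ht w) =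
    sh ht (fun p => dv (ex j) w p - ((DD j ht p.1 : ℝ) : ℂ) * dv (ez d) w p) := by
  funext p; rw [dv_sh hs hw]
  have : ((ex j).1, (ex j).2 - (fderiv ℝ ht p.1) (ex j).1) = ex j - (DD j ht p.1) • ez d := by
    ext <;> simp [ex, ez, DD]
  rw [this, map_sub, map_smul]
  simp [sh, dv]

def LS (ht : (Fin d → ℝ) → ℝ) (F : (Fin d → ℝ) × ℝ → ℝ) : Prop := ∃ w K, L2S w K ∧ F = sh ht w

variable {F F' : (Fin d → ℝ) × ℝ → ℝ}

lemma L2S.ex_sub (hs : ContDiff ℝ ∞ ht) (hp : Per ht) {a b : (Fin d → ℝ) × ℝ → ℂ} {K K'} (ha : L2S a K) (hb : L2S b K') (j : Fin d) :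
    ∃ K, L2S (fun p => a p - ((DD j ht p.1 : ℝ) : ℂ) * b p) K := by
  have := ha.add (hb.mul (a := fun u => ((-DD j ht u : ℝ) : ℂ)) (Complex.ofRealCLM.contDiff.comp (contDiff_DD hs).neg)
    (fun x k => by have := hp.DD (i := j) x k; simp only [this]))
  have e : (fun p => a p - ((DD j ht p.1 : ℝ) : ℂ) * b p) = fun p => a p + ((-DD j ht p.1 : ℝ) : ℂ) * b p := by
    funext p; push_cast; ring
  rw [e]; exact ⟨_, this⟩

lemma LS.sm (hs : ContDiff ℝ ∞ ht) (h : LS ht F) : ContDiff ℝ ∞ F := by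
  obtain ⟨w, K, h, rfl⟩ := h; exact contDiff_sh hs h.sm

lemma LS.dz (hs : ContDiff ℝ ∞ ht) (h : LS ht F) : LS ht (dv (ez d) F) := by
  obtain ⟨w, K, h, rfl⟩ := h; exact ⟨_, _, h.dz, dv_sh_ez hs h.sm⟩

lemma LS.dx (hs : ContDiff ℝ ∞ ht) (hp : Per ht) (h : LS ht F) (j : Fin d) : LS ht (dv (ex j) F) := by
  obtain ⟨w, K, h, rfl⟩ := h
  obtain ⟨K', h'⟩ := L2S.ex_sub hs hp (h.dx j) h.dz j
  exact ⟨_, _, h', dv_sh_ex hs h.sm j⟩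

lemma LS.add (h : LS ht F) (h' : LS ht F') : LS ht (fun p => F p + F' p) := by
  obtain ⟨w, K, h, rfl⟩ := h
  obtain ⟨w', K', h', rfl⟩ := h'
  exact ⟨_, _, h.add h', by funext p; simp [sh]⟩

lemma LS.bdd (h : LS ht F) : ∃ C, ∀ u y, y ≤ ht u → |F (u, y)| ≤ C := by
  obtain ⟨w, K, h, rfl⟩ := h
  obtain ⟨C, hC⟩ := Per.bounded (f := fun u => K 0 u + K 1 u) (fun x k => by simp only [h.hp 0 x k, h.hp 1 x k])
    ((h.hK 0).add (h.hK 1)).continuous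
  refine ⟨C, fun u y hy => ?_⟩
  refine (Complex.abs_re_le_norm _).trans ?_
  simp only
  rw [h.hw u _ (by linarith)]
  exact (norm_ev_le _ _).trans (hC u)
end

section
variable {n : ℕ}

lemma measurableSet_cell : MeasurableSet (cell n) := MeasurableSet.univ_pi fun _ => measurableSet_Ico
lemma volume_cell : volume (cell n) = 1 := by
  rw [cell, volume_pi_pi]; simp

lemma measurableSet_fluidCell {h : (Fin n → ℝ) → ℝ} (hc : Continuous h) : MeasurableSet (fluidCell n h) :=
  (measurableSet_cell.preimage measurable_fst).inter
    (measurableSet_lt measurable_snd (hc.measurable.comp measurable_fst))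

lemma shear_mp {h : (Fin n → ℝ) → ℝ} (hc : Continuous h) :
    MeasurePreserving (fun p : (Fin n → ℝ) × ℝ => (p.1, p.2 - h p.1)) volume volume := by
  refine MeasurePreserving.skew_product (μa := volume) (μb := volume) (μc := volume) (μd := volume) (f := id) (g := fun x y => y - h x) (MeasurePreserving.id _) ?_ ?_
  · exact measurable_snd.sub (hc.measurable.comp measurable_fst)
  · exact Eventually.of_forall fun x => (measurePreserving_sub_right volume (h x)).map_eq

/-- integrability on the fluid cell through the shear -/
lemma integrableOn_fluidCell {h : (Fin n → ℝ) → ℝ} (hc : Continuous h) {g : (Fin n → ℝ) × ℝ → ℝ} :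
    IntegrableOn (fun p => g (p.1, p.2 - h p.1)) (fluidCell n h) ↔ IntegrableOn g (cell n ×ˢ Iio 0) := by
  rw [← integrable_indicator_iff (measurableSet_fluidCell hc), ← integrable_indicator_iff (measurableSet_cell.prod measurableSet_Iio)]
  let e : ((Fin n → ℝ) × ℝ) ≃ₜ ((Fin n → ℝ) × ℝ) :=
    { toFun := fun p => (p.1, p.2 - h p.1)
      invFun := fun p => (p.1, p.2 + h p.1)
      left_inv := fun p => by simp
      right_inv := fun p => by simp
      continuous_toFun := by fun_prop
      continuous_invFun := by fun_prop }
  rw [← (shear_mp hc).integrable_comp_emb e.measurableEmbedding (g := indicator (cell n ×ˢ Iio 0) g)]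
  refine iff_of_eq (congrArg (fun f => Integrable f volume) ?_)
  funext p
  by_cases hp : p ∈ fluidCell n h
  · rw [indicator_of_mem hp, Function.comp_apply, indicator_of_mem]
    exact ⟨hp.1, by simpa using hp.2⟩
  · rw [indicator_of_notMem hp, Function.comp_apply, indicator_of_notMem]
    intro hh; apply hp
    exact ⟨hh.1, by simpa using hh.2⟩

lemma integrableOn_cellprod {g : (Fin n → ℝ) × ℝ → ℝ} (hg : Continuous g) (h0 : ∀ p, 0 ≤ g p) (C : ℝ)
    (hi : ∀ x, IntegrableOn (fun z => g (x, z)) (Iio 0)) (hC : ∀ x, ∫ z in Iio 0, g (x, z) ≤ C) :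
    IntegrableOn g (cell n ×ˢ Iio 0) := by
  rw [IntegrableOn, Measure.volume_eq_prod, ← Measure.prod_restrict]
  rw [integrable_prod_iff hg.aestronglyMeasurable]
  refine ⟨Eventually.of_forall fun x => hi x, ?_⟩
  haveI : IsFiniteMeasure (volume.restrict (cell n)) := ⟨by rw [Measure.restrict_apply_univ, volume_cell]; simp⟩
  refine Integrable.of_bound (C := C) ?_ (Eventually.of_forall fun x => ?_)
  · exact (hg.norm.aestronglyMeasurable (μ := (volume.restrict (cell n)).prod (volume.restrict (Iio 0)))).integral_prod_right'
  · rw [Real.norm_of_nonneg (integral_nonneg fun _ => norm_nonneg _)]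
    simp only [Real.norm_of_nonneg (h0 _)]
    exact hC x

/-- time slice -/
def sl (s : ℝ) (F : (Fin (n+1) → ℝ) × ℝ → ℝ) (p : (Fin n → ℝ) × ℝ) : ℝ := F (Fin.cons s p.1, p.2)

lemma contDiff_cons (s : ℝ) : ContDiff ℝ ∞ (fun x : Fin n → ℝ => (Fin.cons s x : Fin (n+1) → ℝ)) := by
  rw [contDiff_pi]
  intro i
  refine Fin.cases ?_ (fun j => ?_) i
  · simpa using contDiff_const
  · simpa using contDiff_apply ℝ ℝ j

lemma LS.sq {ht : (Fin (n+1) → ℝ) → ℝ} (hs : ContDiff ℝ ∞ ht) {F} (h : LS ht F) (s : ℝ) :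
    IntegrableOn (fun p => (sl s F p)^2) (fluidCell n (fun x => ht (Fin.cons s x))) := by
  obtain ⟨w, K, h, rfl⟩ := h
  have hc : Continuous (fun x : Fin n → ℝ => ht (Fin.cons s x)) := hs.continuous.comp (contDiff_cons s).continuous
  obtain ⟨C, hC⟩ := Per.bounded (f := fun u => K 0 u + K 1 u) (fun x k => by simp only [h.hp 0 x k, h.hp 1 x k])
    ((h.hK 0).add (h.hK 1)).continuous
  refine (integrableOn_fluidCell (g := fun p => (w (Fin.cons s p.1, p.2)).re ^ 2) hc).2 ?_
  have hwc : Continuous (fun p : (Fin n → ℝ) × ℝ => (w (Fin.cons s p.1, p.2)).re ^ 2) := by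
    have := h.sm.continuous
    have h2 := (contDiff_cons (n := n) s).continuous
    exact (Complex.continuous_re.comp (this.comp ((h2.comp continuous_fst).prodMk continuous_snd))).pow 2
  have hle : ∀ (x : Fin n → ℝ) (z : ℝ), z ∈ Iio (0:ℝ) → (w (Fin.cons s x, z)).re ^ 2 ≤ ‖ev z (K 0 (Fin.cons s x) + K 1 (Fin.cons s x))‖^2 := by
    intro x z hz
    rw [← h.hw _ z (le_of_lt hz), ← sq_abs]
    exact pow_le_pow_left₀ (abs_nonneg _) (Complex.abs_re_le_norm _) 2
  have hint : ∀ k : ZS, IntegrableOn (fun z => ‖ev z k‖^2) (Iio 0) := fun k =>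
    (integrable_ev_sq k).mono_measure (Measure.restrict_mono Iio_subset_Iic_self le_rfl)
  have hi : ∀ x : Fin n → ℝ, IntegrableOn (fun z => (w (Fin.cons s x, z)).re ^ 2) (Iio 0) := by
    intro x
    refine Integrable.mono' (hint (K 0 (Fin.cons s x) + K 1 (Fin.cons s x))) ?_ ?_
    · exact (hwc.comp (Continuous.prodMk_right x)).aestronglyMeasurable
    · refine (ae_restrict_iff' measurableSet_Iio).2 (Eventually.of_forall fun z hz => ?_)
      rw [Real.norm_of_nonneg (sq_nonneg _)]; exact hle x z hz
  refine integrableOn_cellprod hwc (fun p => sq_nonneg _) (C^2) hi fun x => ?_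
  refine (setIntegral_mono_on (hi x) (hint _) measurableSet_Iio (hle x)).trans ?_
  refine (setIntegral_mono_set (integrable_ev_sq _) (Eventually.of_forall fun s => by positivity) Iio_subset_Iic_self.eventuallyLE).trans ?_
  refine (integral_ev_sq_le _).trans ?_
  exact pow_le_pow_left₀ (norm_nonneg _) (hC _) 2
end
end HS
end

noncomputable section
namespace HS
open Set Filter Topology
open scoped ComplexConjugate InnerProductSpace ContDiff

section
variable {n : ℕ}

/-- spatial Laplacian, not involving the zeroth (time) coordinate -/
def Lap (F : (Fin (n+1) → ℝ) × ℝ → ℝ) (p : (Fin (n+1) → ℝ) × ℝ) : ℝ :=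
  dv (ez _) (dv (ez _) F) p + ∑ i : Fin n, dv (ex i.succ) (dv (ex i.succ) F) p

theorem Phi_exists (ht : (Fin (n+1) → ℝ) → ℝ) (hs : ContDiff ℝ ∞ ht) (hper : Per ht) :
    ∃ Φ : (Fin (n+1) → ℝ) × ℝ → ℝ, ContDiff ℝ ∞ Φ ∧ (∀ y, Per (fun u => Φ (u, y))) ∧
      (∀ u, Φ (u, ht u) = ht u) ∧ LS ht (dv (ez _) Φ) ∧ (∀ i : Fin n, LS ht (dv (ex i.succ) Φ)) ∧
      (∃ C, ∀ u y, y ≤ ht u → |dv (ex 0) Φ (u, y)| ≤ C * (1 + Real.sqrt (ht u - y))) ∧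
      (∀ u y, y ≤ ht u → Lap Φ (u, y) = 0) := by
  obtain ⟨v, hv, hvp, hb, ⟨K0, hK0⟩, hKi, ⟨C, hC⟩, hF⟩ := v_exists ht hs hper
  have hFi : ∀ j : Fin (n+1), ContDiff ℝ ∞ (fun p => dv (ex j) v p - ((DD j ht p.1 : ℝ) : ℂ) * dv (ez _) v p) := fun j =>
    (contDiff_dv _ hv).sub ((Complex.ofRealCLM.contDiff.comp ((contDiff_DD hs).comp contDiff_fst)).mul (contDiff_dv _ hv))
  refine ⟨sh ht v, contDiff_sh hs hv, fun y x k => ?_, fun u => ?_, ?_, fun i => ?_, ?_, fun u y hy => ?_⟩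
  · simp only [sh, hper x k]
    exact congrArg Complex.re (hvp (y - ht x) x k)
  · simp [sh, hb]
  · exact ⟨_, _, hK0, dv_sh_ez hs hv⟩
  · obtain ⟨K, hK⟩ := hKi i
    obtain ⟨K', hK'⟩ := L2S.ex_sub hs hper hK hK0 i.succ
    exact ⟨_, _, hK', dv_sh_ex hs hv _⟩
  · obtain ⟨C1, hC1⟩ := Per.bounded (f := fun u => K0 0 u + K0 1 u) (fun x k => by simp only [hK0.hp 0 x k, hK0.hp 1 x k])
      ((hK0.hK 0).add (hK0.hK 1)).continuous
    obtain ⟨C2, hC2⟩ := Per.bounded (f := DD 0 ht) hper.DD (contDiff_DD hs).continuous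
    refine ⟨C + C2 * C1, fun u y hy => ?_⟩
    rw [dv_sh_ex hs hv]
    refine (Complex.abs_re_le_norm _).trans ?_
    refine (norm_sub_le _ _).trans ?_
    have hz : y - ht u ≤ 0 := by linarith
    have e1 := hC u _ hz
    have e2 : ‖dv (ez _) v (u, y - ht u)‖ ≤ C1 := by
      rw [hK0.hw u _ hz]; exact (norm_ev_le _ _).trans (hC1 u)
    have e3 : ‖((DD 0 ht u : ℝ) : ℂ)‖ ≤ C2 := by rw [Complex.norm_real]; exact hC2 u
    have e4 : |y - ht u| = ht u - y := by rw [abs_of_nonpos hz]; ring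
    rw [e4] at e1
    simp only
    rw [norm_mul]
    have e5 := mul_le_mul e3 e2 (norm_nonneg _) ((norm_nonneg _).trans e3)
    have e6 : 0 ≤ C2 * C1 := le_trans (by positivity) e5
    nlinarith [Real.sqrt_nonneg (ht u - y), mul_nonneg e6 (Real.sqrt_nonneg (ht u - y))]
  · have hz : y - ht u ≤ 0 := by linarith
    have := congrArg Complex.re (hF _ rfl u (y - ht u) hz)
    rw [Complex.add_re, Complex.re_sum] at this
    rw [Lap, dv_sh_ez hs hv, dv_sh_ez hs (contDiff_dv _ hv)]
    rw [Complex.zero_re] at this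
    rw [← this]
    congr 1
    refine Finset.sum_congr rfl fun i _ => ?_
    rw [dv_sh_ex hs hv, dv_sh_ex hs (hFi _)]
    rfl

lemma Lap_dv {F : (Fin (n+1) → ℝ) × ℝ → ℝ} (hF : ContDiff ℝ ∞ F) (v) : Lap (dv v F) = dv v (Lap F) := by
  funext p
  have hd : ∀ a b p, DifferentiableAt ℝ (dv a (dv b F)) p := fun a b p =>
    (contDiff_dv a (contDiff_dv b hF)).differentiable (by simp) p
  have e : ∀ a, dv a (dv a (dv v F)) = dv v (dv a (dv a F)) := fun a => by
    rw [dv_comm a v hF, dv_comm a v (contDiff_dv a hF)]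
  simp only [Lap, e]
  show _ = fderiv ℝ (fun p => dv (ez _) (dv (ez _) F) p + ∑ i : Fin n, dv (ex i.succ) (dv (ex i.succ) F) p) p v
  rw [fderiv_fun_add (hd _ _ _) (DifferentiableAt.fun_sum fun i _ => hd _ _ _), fderiv_fun_sum (fun i _ => hd _ _ _)]
  simp [dv]

lemma Lap_add {F G : (Fin (n+1) → ℝ) × ℝ → ℝ} (hF : ContDiff ℝ ∞ F) (hG : ContDiff ℝ ∞ G) (p) :
    Lap (fun p => F p + G p) p = Lap F p + Lap G p := by
  have e : ∀ a {F G : (Fin (n+1) → ℝ) × ℝ → ℝ}, ContDiff ℝ ∞ F → ContDiff ℝ ∞ G → dv a (fun p => F p + G p) = fun p => dv a F p + dv a G p := by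
    intro a F G hF hG; funext p
    simp only [dv]
    rw [fderiv_fun_add (hF.differentiable (by simp) p) (hG.differentiable (by simp) p)]; simp
  have e2 : ∀ a, dv a (dv a (fun p => F p + G p)) p = dv a (dv a F) p + dv a (dv a G) p := fun a => by
    rw [e a hF hG, e a (contDiff_dv _ hF) (contDiff_dv _ hG)]
  simp only [Lap, e2, Finset.sum_add_distrib]; ring

lemma harm_dv {ht : (Fin (n+1) → ℝ) → ℝ} (hs : ContDiff ℝ ∞ ht) {F : (Fin (n+1) → ℝ) × ℝ → ℝ} (hF : ContDiff ℝ ∞ F)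
    (hL : ∀ u y, y < ht u → Lap F (u, y) = 0) (v) (u y) (hy : y < ht u) : Lap (dv v F) (u, y) = 0 := by
  rw [Lap_dv hF, dv]
  have ho : IsOpen {p : (Fin (n+1) → ℝ) × ℝ | p.2 < ht p.1} := isOpen_lt continuous_snd (hs.continuous.comp continuous_fst)
  have : Lap F =ᶠ[𝓝 (u, y)] fun _ => 0 := by
    filter_upwards [ho.mem_nhds (show (u, y) ∈ {p : (Fin (n+1) → ℝ) × ℝ | p.2 < ht p.1} from hy)] with p hp
    exact hL p.1 p.2 hp
  rw [this.fderiv_eq]; simp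

lemma per_dv {F : (Fin (n+1) → ℝ) × ℝ → ℝ} (hF : ContDiff ℝ ∞ F) (hp : ∀ y, Per (fun u => F (u, y))) (v y) :
    Per (fun u => dv v F (u, y)) := by
  intro x k
  have h1 : (fun q : (Fin (n+1) → ℝ) × ℝ => F (q + ((fun i => (k i : ℝ)), 0))) = F := by
    funext q
    have := hp q.2 q.1 k
    simpa [Prod.add_def] using this
  have h2 : fderiv ℝ (fun q : (Fin (n+1) → ℝ) × ℝ => F (q + ((fun i => (k i : ℝ)), 0))) (x, y) = fderiv ℝ F ((x, y) + ((fun i => (k i : ℝ)), 0)) :=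
    fderiv_comp_add_right _
  rw [h1] at h2
  simp only [dv, h2]
  simp

lemma dv_line {E : Type*} [NormedAddCommGroup E] [NormedSpace ℝ E] {f : E → ℝ} (hf : ContDiff ℝ ∞ f) (v p : E) :
    dv v f p = deriv (fun t : ℝ => f (p + t • v)) 0 :=
  (((hf.differentiable (by simp)) p).lineDeriv_eq_fderiv (v := v)).symm

lemma contDiff_sl (s : ℝ) {F : (Fin (n+1) → ℝ) × ℝ → ℝ} (hF : ContDiff ℝ ∞ F) : ContDiff ℝ ∞ (sl s F) :=
  hF.comp (((contDiff_cons s).comp contDiff_fst).prodMk contDiff_snd)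

lemma pdE_sl_X (s : ℝ) {F : (Fin (n+1) → ℝ) × ℝ → ℝ} (hF : ContDiff ℝ ∞ F) (i : Fin n) :
    pdE n (sl s F) (eX n i) = sl s (dv (ex i.succ) F) := by
  funext p
  refine (dv_line (contDiff_sl s hF) (eX n i) p).trans ?_
  rw [sl, dv_line hF]
  congr 1; funext t
  simp only [sl]
  congr 1
  ext j
  · refine Fin.cases ?_ (fun j => ?_) j
    · simp [ex]
    · by_cases hj : j = i
      · subst hj; simp [ex, eX]
      · simp [ex, eX, hj]
  · simp [ex, eX]

lemma pdE_sl_Y (s : ℝ) {F : (Fin (n+1) → ℝ) × ℝ → ℝ} (hF : ContDiff ℝ ∞ F) :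
    pdE n (sl s F) (eY n) = sl s (dv (ez _) F) := by
  funext p
  refine (dv_line (contDiff_sl s hF) (eY n) p).trans ?_
  rw [sl, dv_line hF]
  congr 1; funext t
  simp only [sl]
  congr 1
  ext j
  · refine Fin.cases ?_ (fun j => ?_) j
    · simp [ez]
    · simp [ez, eY]
  · simp [ez, eY]

lemma lapE_sl (s : ℝ) {F : (Fin (n+1) → ℝ) × ℝ → ℝ} (hF : ContDiff ℝ ∞ F) (p) : lapE n (sl s F) p = sl s (Lap F) p := by
  rw [lapE, pdE_sl_Y s hF, pdE_sl_Y s (contDiff_dv _ hF)]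
  simp only [pdE_sl_X s hF, fun i : Fin n => pdE_sl_X s (contDiff_dv (ex i.succ) hF)]
  simp only [sl, Lap]; ring

lemma slice_ext {ht : (Fin (n+1) → ℝ) → ℝ} (hs : ContDiff ℝ ∞ ht) {Q : (Fin (n+1) → ℝ) × ℝ → ℝ}
    (hQ : ContDiff ℝ ∞ Q) (hQp : ∀ y, Per (fun u => Q (u, y))) (hL : ∀ u y, y < ht u → Lap Q (u, y) = 0)
    (hz : LS ht (dv (ez _) Q)) (hx : ∀ i : Fin n, LS ht (dv (ex i.succ) Q)) (s : ℝ) :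
    IsHarmonicExt n (fun x => ht (Fin.cons s x)) (fun x => Q (Fin.cons s x, ht (Fin.cons s x))) (sl s Q) := by
  refine ⟨contDiff_sl s hQ, fun x y k => ?_, fun p hp => ?_, fun x => rfl, ?_⟩
  · have := hQp y (Fin.cons s x) (Fin.cons 0 k)
    simp only [sl]
    refine Eq.trans ?_ this
    show Q _ = Q _
    congr 2
    funext j
    refine Fin.cases ?_ (fun j => ?_) j <;> simp
  · rw [lapE_sl s hQ]; exact hL _ _ hp
  · have : gradSqE n (sl s Q) = fun p => (∑ i : Fin n, (sl s (dv (ex i.succ) Q) p)^2) + (sl s (dv (ez _) Q) p)^2 := by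
      funext p
      simp only [gradSqE, pdE_sl_X s hQ, pdE_sl_Y s hQ]
    rw [this]
    exact (integrable_finsetSum _ fun i _ => (hx i).sq hs s).add (hz.sq hs s)
end
end HS
end

noncomputable section
namespace HS
open Set Filter Topology
open scoped ComplexConjugate InnerProductSpace ContDiff

section
variable {d : ℕ}

lemma dv_mul {E : Type*} [NormedAddCommGroup E] [NormedSpace ℝ E] (v : E) {a b : E → ℝ} (ha : ContDiff ℝ ∞ a) (hb : ContDiff ℝ ∞ b) (p) :
    dv v (fun p => a p * b p) p = dv v a p * b p + a p * dv v b p := by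
  simp only [dv]
  rw [fderiv_fun_mul (ha.differentiable (by simp) p) (hb.differentiable (by simp) p)]
  simp; ring

/-- straightened function -/
def sk (h : (Fin d → ℝ) → ℝ) (f : (Fin d → ℝ) × ℝ → ℝ) (p : (Fin d → ℝ) × ℝ) : ℝ := f (p.1, p.2 + h p.1)

variable {h : (Fin d → ℝ) → ℝ} {f : (Fin d → ℝ) × ℝ → ℝ}

lemma contDiff_sk (hs : ContDiff ℝ ∞ h) (hf : ContDiff ℝ ∞ f) : ContDiff ℝ ∞ (sk h f) :=
  hf.comp (contDiff_fst.prodMk (contDiff_snd.add (hs.comp contDiff_fst)))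

lemma dv_sk (hs : ContDiff ℝ ∞ h) (hf : ContDiff ℝ ∞ f) (v : (Fin d → ℝ) × ℝ) (p) :
    dv v (sk h f) p = fderiv ℝ f (p.1, p.2 + h p.1) (v.1, v.2 + fderiv ℝ h p.1 v.1) := by
  have h1 : HasFDerivAt (fun q : (Fin d → ℝ) × ℝ => (q.1, q.2 + h q.1))
      ((ContinuousLinearMap.fst ℝ _ _).prod (ContinuousLinearMap.snd ℝ _ _ + (fderiv ℝ h p.1).comp (ContinuousLinearMap.fst ℝ _ _))) p :=
    hasFDerivAt_fst.prodMk (hasFDerivAt_snd.add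
      (HasFDerivAt.comp (g := h) (f := fun q : (Fin d → ℝ) × ℝ => q.1) p
        ((hs.differentiable (by simp)) p.1).hasFDerivAt hasFDerivAt_fst))
  have h2 : HasFDerivAt (sk h f) _ p := HasFDerivAt.comp (g := f) (f := fun q : (Fin d → ℝ) × ℝ => (q.1, q.2 + h q.1)) p
    ((hf.differentiable (by simp)) (p.1, p.2 + h p.1)).hasFDerivAt h1
  rw [dv, h2.fderiv]; simp

lemma dv_sk_ez (hs : ContDiff ℝ ∞ h) (hf : ContDiff ℝ ∞ f) : dv (ez d) (sk h f) = sk h (dv (ez d) f) := by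
  funext p; rw [dv_sk hs hf]; simp [ez, sk, dv]

lemma dv_sk_ex (hs : ContDiff ℝ ∞ h) (hf : ContDiff ℝ ∞ f) (j : Fin d) (p) : dv (ex j) (sk h f) p =
    sk h (dv (ex j) f) p + DD j h p.1 * sk h (dv (ez d) f) p := by
  rw [dv_sk hs hf]
  have : ((ex j).1, (ex j).2 + (fderiv ℝ h p.1) (ex j).1) = ex j + (DD j h p.1) • ez d := by
    ext <;> simp [ex, ez, DD]
  rw [this, map_add, map_smul]
  simp [sk, dv]

lemma integral_DD_real {k : (Fin d → ℝ) → ℝ} (hk : Per k) (hs : ContDiff ℝ ∞ k) (i : Fin d) :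
    ∫ x in bx 0, DD i k x = 0 := by
  have h1 := integral_DD_eq_zero (f := fun x => (k x : ℂ)) (fun x j => by simp only [hk x j]) (Complex.ofRealCLM.contDiff.comp hs) i
  have h2 : ∀ x, DD i (fun x => (k x : ℂ)) x = ((DD i k x : ℝ) : ℂ) := by
    intro x
    have := (Complex.ofRealCLM.hasFDerivAt.comp x ((hs.differentiable (by simp)) x).hasFDerivAt).fderiv
    have e : (fun x => (k x : ℂ)) = Complex.ofRealCLM ∘ k := rfl
    rw [DD, e, this]; rfl
  simp only [h2] at h1
  rw [integral_complex_ofReal] at h1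
  exact_mod_cast h1

lemma integrableOn_bx {k : (Fin d → ℝ) → ℝ} (hk : Continuous k) : IntegrableOn k (bx 0) :=
  (hk.continuousOn.integrableOn_compact isCompact_Icc).mono_set (bx_subset 0)

lemma hasDerivAt_bx {k : (Fin d → ℝ) × ℝ → ℝ} (hk : ContDiff ℝ ∞ k) (z : ℝ) :
    HasDerivAt (fun z => ∫ x in bx 0, k (x, z)) (∫ x in bx 0, dv (ez d) k (x, z)) z := by
  have hc := (contDiff_dv (ez d) hk).continuous
  obtain ⟨C, hC⟩ := ((isCompact_Icc (a := (0 : Fin d → ℝ)) (b := 0 + 1)).prod (isCompact_closedBall z 1)).exists_bound_of_continuousOn hc.continuousOn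
  have hb : ∀ {q : ℝ}, Continuous fun x : Fin d → ℝ => k (x, q) := hk.continuous.comp (Continuous.prodMk_left _)
  refine (hasDerivAt_integral_of_dominated_loc_of_deriv_le (μ := volume.restrict (bx 0)) (F := fun z x => k (x, z)) (F' := fun z x => dv (ez d) k (x, z))
    (bound := fun _ => C) (s := Metric.ball z 1) (Metric.ball_mem_nhds z one_pos) ?_ ?_ ?_ ?_ ?_ ?_).2
  · exact Eventually.of_forall fun q => hb.aestronglyMeasurable
  · exact integrableOn_bx hb
  · exact (hc.comp (Continuous.prodMk_left _)).aestronglyMeasurable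
  · refine (ae_restrict_iff' (measurableSet_bx 0)).2 (Eventually.of_forall fun x hx q hq => ?_)
    exact hC (x, q) ⟨bx_subset 0 hx, Metric.ball_subset_closedBall hq⟩
  · exact integrableOn_const (volume_bx_lt 0).ne
  · exact Eventually.of_forall fun x q _ => hasDerivAt_z k hk x q

lemma cell_ae_bx : cell d =ᵐ[volume] bx (0 : Fin d → ℝ) := by
  have h1 : cell d =ᵐ[volume] Icc (0 : Fin d → ℝ) 1 := Measure.univ_pi_Ico_ae_eq_Icc (μ := fun _ : Fin d => volume) (f := 0) (g := 1)
  have h2 : bx (0 : Fin d → ℝ) =ᵐ[volume] Icc (0 : Fin d → ℝ) 1 := by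
    have e : bx (0 : Fin d → ℝ) = univ.pi fun i => Ioc ((0 : Fin d → ℝ) i) ((1 : Fin d → ℝ) i) := by
      ext x; simp [bx]
    rw [e]; exact Measure.univ_pi_Ioc_ae_eq_Icc (μ := fun _ : Fin d => volume) (f := 0) (g := 1)
  exact h1.trans h2.symm

lemma eq_zero_of_integral_bx {k : (Fin d → ℝ) → ℝ} (hp : Per k) (hc : Continuous k) (h0 : ∀ x, 0 ≤ k x)
    (hi : ∫ x in bx 0, k x = 0) (x) : k x = 0 := by
  have h1 := (setIntegral_eq_zero_iff_of_nonneg_ae (Eventually.of_forall h0) (integrableOn_bx hc)).1 hi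
  have hU : IsOpen (univ.pi fun _ : Fin d => Ioo (0:ℝ) 1) := isOpen_set_pi finite_univ fun _ _ => isOpen_Ioo
  have hsub : (univ.pi fun _ : Fin d => Ioo (0:ℝ) 1) ⊆ bx 0 := fun x hx i => ⟨(hx i trivial).1, by simpa using (hx i trivial).2.le⟩
  have h2 := Measure.eqOn_open_of_ae_eq (ae_mono (Measure.restrict_mono hsub le_rfl) h1) hU hc.continuousOn continuousOn_const
  have h3 := h2.closure hc continuous_const
  rw [closure_pi_set] at h3
  have e := hp x (fun i => -⌊x i⌋)
  rw [← e]
  refine h3 fun i _ => ?_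
  rw [closure_Ioo (by norm_num)]
  simp only [Pi.add_apply, Int.cast_neg]
  constructor
  · linarith [Int.floor_le (x i)]
  · linarith [Int.lt_floor_add_one (x i)]

lemma sq_integral_le {a : ℝ → ℝ} (ha : Continuous a) {z : ℝ} (hz : z ≤ 0) :
    (∫ s in Ioc z 0, a s)^2 ≤ (-z) * ∫ s in Ioc z 0, a s ^ 2 := by
  have hi : IntegrableOn (fun s => a s ^ 2) (Ioc z 0) := ((ha.pow 2).integrableOn_Icc).mono_set Ioc_subset_Icc_self
  have hI : IntegrableOn a (Ioc z 0) := (ha.integrableOn_Icc).mono_set Ioc_subset_Icc_self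
  set Iv := ∫ s in Ioc z 0, a s with hIdef
  rcases eq_or_lt_of_le hz with h0 | h0
  · rw [hIdef, h0]; simp
  set t := Iv / (-z) with ht
  have hn : 0 ≤ ∫ s in Ioc z 0, (a s - t)^2 := setIntegral_nonneg measurableSet_Ioc fun s _ => sq_nonneg _
  have he : ∫ s in Ioc z 0, (a s - t)^2 = (∫ s in Ioc z 0, a s^2) - 2 * t * Iv + t^2 * (-z) := by
    have : (fun s => (a s - t)^2) = fun s => (a s^2 - 2 * t * a s) + t^2 := by funext s; ring
    have hA : IntegrableOn (fun s => a s^2 - 2 * t * a s) (Ioc z 0) := hi.sub (hI.const_mul _)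
    have hC : IntegrableOn (fun _ : ℝ => t^2) (Ioc z 0) := integrableOn_const (by simp)
    rw [this, integral_add hA hC, integral_sub hi (hI.const_mul _), integral_const_mul]
    simp [h0.le]; ring
  rw [he] at hn
  have h2 : Iv = t * (-z) := by rw [ht, div_mul_cancel₀ _ (by linarith)]
  rw [h2] at hn ⊢
  nlinarith
end
end HS
end

noncomputable section
namespace HS
open Set Filter Topology
open scoped ComplexConjugate InnerProductSpace ContDiff

section
variable {n : ℕ}

lemma per_sk {h : (Fin n → ℝ) → ℝ} (hp : Per h) {f : (Fin n → ℝ) × ℝ → ℝ} (hf : ZPeriodicE n f) (z) : Per (fun x => sk h f (x, z)) := by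
  intro x k
  simp only [sk, hp x k]
  exact hf _ _ _

lemma zper_dv {f : (Fin n → ℝ) × ℝ → ℝ} (hp : ZPeriodicE n f) (v) : ZPeriodicE n (dv v f) := by
  intro x y k
  have h1 : (fun q : (Fin n → ℝ) × ℝ => f (q + ((fun i => (k i : ℝ)), 0))) = f := by
    funext q
    have := hp q.1 q.2 k
    simpa [Prod.add_def] using this
  have h2 : fderiv ℝ (fun q : (Fin n → ℝ) × ℝ => f (q + ((fun i => (k i : ℝ)), 0))) (x, y) = fderiv ℝ f ((x, y) + ((fun i => (k i : ℝ)), 0)) :=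
    fderiv_comp_add_right _
  rw [h1] at h2
  simp only [dv, h2]
  simp

lemma DD_bdd {h : (Fin n → ℝ) → ℝ} (hs : ContDiff ℝ ∞ h) (hp : Per h) : ∃ H, 0 ≤ H ∧ ∀ x, ∑ i, (DD i h x)^2 ≤ H := by
  obtain ⟨C, hC⟩ := Per.bounded (f := fun x => ∑ i, (DD i h x)^2)
    (fun x k => by simp only [fun i => hp.DD (i := i) x k])
    (continuous_finsetSum _ fun i _ => (contDiff_DD hs).continuous.pow 2)
  exact ⟨C, (norm_nonneg _).trans (hC 0), fun x => (le_abs_self _).trans (hC x)⟩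

lemma alg_id (a G : ℝ) (h b c e : Fin n → ℝ) :
    a * (a - ∑ i, h i * b i) + G * ((-∑ i, c i) - ∑ i, h i * e i) =
      ((∑ i, b i ^ 2) + a ^ 2) - ∑ i, ((b i + h i * a) * b i + G * (c i + h i * e i)) := by
  have e1 : ∑ i, ((b i + h i * a) * b i + G * (c i + h i * e i)) =
     (∑ i, b i ^ 2) + a * (∑ i, h i * b i) + G * (∑ i, c i) + G * ∑ i, h i * e i := by
    rw [Finset.mul_sum, Finset.mul_sum, Finset.mul_sum, ← Finset.sum_add_distrib, ← Finset.sum_add_distrib, ← Finset.sum_add_distrib]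
    exact Finset.sum_congr rfl fun i _ => by ring
  rw [e1]; ring

/-- energy uniqueness -/
theorem unique_zero {h : (Fin n → ℝ) → ℝ} (hs : ContDiff ℝ ∞ h) (hp : Per h) {f : (Fin n → ℝ) × ℝ → ℝ}
    (hf : ContDiff ℝ ∞ f) (hfp : ZPeriodicE n f) (hL : ∀ p : (Fin n → ℝ) × ℝ, p.2 < h p.1 → lapE n f p = 0)
    (h0 : ∀ x, f (x, h x) = 0) (hi : IntegrableOn (gradSqE n f) (fluidCell n h)) (x y) (hy : y ≤ h x) : f (x, y) = 0 := by
  set g := sk h f with hgdef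
  set A0 := sk h (dv (ez n) f) with hA0
  set A : Fin n → (Fin n → ℝ) × ℝ → ℝ := fun i => sk h (dv (ex i) f) with hA
  set W : (Fin n → ℝ) × ℝ → ℝ := fun p => A0 p - ∑ i, DD i h p.1 * A i p with hW
  set M : (Fin n → ℝ) × ℝ → ℝ := fun p => (∑ i, A i p ^ 2) + A0 p ^ 2 with hM
  have sg : ContDiff ℝ ∞ g := contDiff_sk hs hf
  have sA0 : ContDiff ℝ ∞ A0 := contDiff_sk hs (contDiff_dv _ hf)
  have sA : ∀ i, ContDiff ℝ ∞ (A i) := fun i => contDiff_sk hs (contDiff_dv _ hf)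
  have sW : ContDiff ℝ ∞ W := sA0.sub (ContDiff.sum fun i _ => ((contDiff_DD hs).comp contDiff_fst).mul (sA i))
  have sM : Continuous M := (continuous_finsetSum _ fun i _ => (sA i).continuous.pow 2).add (sA0.continuous.pow 2)
  have hM0 : ∀ p, 0 ≤ M p := fun p => add_nonneg (Finset.sum_nonneg fun i _ => sq_nonneg _) (sq_nonneg _)
  have hMp : ∀ z, Per (fun x => M (x, z)) := fun z x k => by
    have e0 := per_sk hp (zper_dv hfp (ez n)) z x k
    have ei := fun i => per_sk hp (zper_dv hfp (ex (d := n) i)) z x k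
    simp only at e0 ei
    simp only [hM, hA, hA0, e0, ei]
  have hgz : dv (ez n) g = A0 := dv_sk_ez hs hf
  have hcx : ∀ {k : (Fin n → ℝ) × ℝ → ℝ} (z : ℝ), Continuous k → Continuous fun x => k (x, z) := fun z hk => hk.comp (Continuous.prodMk_left _)
  have hcz : ∀ {k : (Fin n → ℝ) × ℝ → ℝ} (x : Fin n → ℝ), Continuous k → Continuous fun z => k (x, z) := fun z hk => hk.comp (Continuous.prodMk_right _)
  -- pointwise identity
  have hid : ∀ x z, z < 0 → dv (ez n) (fun p => g p * W p) (x, z) = M (x, z) - ∑ i, dv (ex i) (fun p => g p * A i p) (x, z) := by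
    intro x z hz
    have d0 := hasDerivAt_z A0 sA0 x z
    have di := fun i => hasDerivAt_z (A i) (sA i) x z
    have dW : dv (ez n) W (x, z) = dv (ez n) A0 (x, z) - ∑ i, DD i h x * dv (ez n) (A i) (x, z) := by
      refine (hasDerivAt_z W sW x z).unique ?_
      exact d0.sub (HasDerivAt.fun_sum fun i _ => (di i).const_mul (DD i h x))
    rw [dv_mul _ sg sW, hgz, dW]
    have e1 : ∀ i, dv (ex i) (fun p => g p * A i p) (x, z) = (A i (x, z) + DD i h x * A0 (x, z)) * A i (x, z) +
        g (x, z) * (sk h (dv (ex i) (dv (ex i) f)) (x, z) + DD i h x * sk h (dv (ez n) (dv (ex i) f)) (x, z)) := by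
      intro i
      rw [dv_mul _ sg (sA i)]
      congr 1
      · rw [hgdef, dv_sk_ex hs hf i]
      · exact congrArg _ (dv_sk_ex hs (contDiff_dv (ex i) hf) i (x, z))
    have e2 : dv (ez n) A0 = sk h (dv (ez n) (dv (ez n) f)) := dv_sk_ez hs (contDiff_dv (ez n) hf)
    have e3 : ∀ i, dv (ez n) (A i) = sk h (dv (ez n) (dv (ex i) f)) := fun i => dv_sk_ez hs (contDiff_dv (ex i) hf)
    simp only [e1, e2, e3]
    have hl := hL (x, z + h x) (by simpa using hz)
    have hl' : (∑ i, sk h (dv (ex i) (dv (ex i) f)) (x, z)) + sk h (dv (ez n) (dv (ez n) f)) (x, z) = 0 := hl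
    have : sk h (dv (ez n) (dv (ez n) f)) (x, z) = - ∑ i, sk h (dv (ex i) (dv (ex i) f)) (x, z) := by linarith
    rw [this]
    exact alg_id _ _ _ _ _ _
  -- flux
  set J : ℝ → ℝ := fun z => ∫ x in bx 0, g (x, z) * W (x, z) with hJ
  set m : ℝ → ℝ := fun z => ∫ x in bx 0, M (x, z) with hm
  have hJd : ∀ z < 0, HasDerivAt J (m z) z := by
    intro z hz
    refine (hasDerivAt_bx (sg.mul sW) z).congr_deriv ?_
    rw [setIntegral_congr_fun (measurableSet_bx 0) (fun x _ => hid x z hz)]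
    have hci : ∀ i, IntegrableOn (fun x => dv (ex i) (fun p => g p * A i p) (x, z)) (bx 0) := fun i =>
      integrableOn_bx (hcx z (contDiff_dv _ (sg.mul (sA i))).continuous)
    rw [integral_sub (integrableOn_bx (hcx z sM)) (integrable_finsetSum _ fun i _ => hci i), integral_finsetSum _ fun i _ => hci i]
    rw [Finset.sum_eq_zero, sub_zero]
    intro i _
    simp only [fun x => dv_ex (fun p => g p * A i p) (sg.mul (sA i)) i x z]
    refine integral_DD_real (k := fun u => g (u, z) * A i (u, z)) (fun x k => ?_) ((sg.mul (sA i)).comp (contDiff_id.prodMk contDiff_const)) i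
    have e1 := per_sk hp hfp z x k
    have e2 := per_sk hp (zper_dv hfp (ex i)) z x k
    simp only at e1 e2
    simp only [hgdef, hA, e1, e2]
  have hJc : Continuous J := continuous_iff_continuousAt.2 fun z => (hasDerivAt_bx (sg.mul sW) z).continuousAt
  have hg0 : ∀ x, g (x, 0) = 0 := fun x => by simp [hgdef, sk, h0]
  have hJ0 : J 0 = 0 := by simp [hJ, hg0]
  -- integrability
  have hMi : Integrable M ((volume.restrict (bx 0)).prod (volume.restrict (Iio 0))) := by
    have h1 : IntegrableOn M (cell n ×ˢ Iio 0) := by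
      refine (integrableOn_fluidCell hs.continuous).1 (hi.congr_fun (fun p hp => ?_) (measurableSet_fluidCell hs.continuous))
      simp [hM, hA, hA0, sk, gradSqE]; rfl
    rw [IntegrableOn, Measure.volume_eq_prod, ← Measure.prod_restrict, Measure.restrict_congr_set cell_ae_bx] at h1
    exact h1
  have hmi : IntegrableOn m (Iio 0) := hMi.integral_prod_right
  have hm0 : ∀ z, 0 ≤ m z := fun z => setIntegral_nonneg (measurableSet_bx 0) fun x _ => hM0 _
  set ρ : (Fin n → ℝ) → ℝ := fun x => ∫ z in Iio 0, M (x, z) with hρ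
  have hρi : IntegrableOn ρ (bx 0) := hMi.integral_prod_left
  have hρ0 : ∀ x, 0 ≤ ρ x := fun x => setIntegral_nonneg measurableSet_Iio fun z _ => hM0 _
  have hae : ∀ᵐ x ∂(volume.restrict (bx 0)), IntegrableOn (fun z => M (x, z)) (Iio 0) := hMi.prod_right_ae
  set E := ∫ x in bx 0, ρ x with hE
  have hE0 : 0 ≤ E := setIntegral_nonneg (measurableSet_bx 0) fun x _ => hρ0 x
  have hgE : ∀ z < 0, ∫ x in bx 0, g (x, z)^2 ≤ (-z) * E := by
    intro z hz
    rw [hE, ← integral_const_mul]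
    refine integral_mono_ae (integrableOn_bx ((hcx z sg.continuous).pow 2)) (hρi.const_mul _) ?_
    filter_upwards [hae] with x hx
    have e1 : ∫ s in Ioc z 0, A0 (x, s) = - g (x, z) := by
      rw [← intervalIntegral.integral_of_le hz.le, ← hgz,
        intervalIntegral.integral_eq_sub_of_hasDerivAt (fun s _ => hasDerivAt_z g sg x s)
          ((hcz x (contDiff_dv (ez n) sg).continuous).intervalIntegrable _ _), hg0, zero_sub]
    have e2 := sq_integral_le (hcz x sA0.continuous) hz.le
    rw [e1, neg_sq] at e2
    refine e2.trans (mul_le_mul_of_nonneg_left ?_ (by linarith))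
    rw [integral_Ioc_eq_integral_Ioo]
    refine (setIntegral_mono_on ?_ ?_ measurableSet_Ioo (fun s _ => ?_)).trans (setIntegral_mono_set hx (Eventually.of_forall fun s => hM0 _) Ioo_subset_Iio_self.eventuallyLE)
    · exact (((hcz x sA0.continuous).pow 2).integrableOn_Icc).mono_set Ioo_subset_Icc_self
    · exact hx.mono_set Ioo_subset_Iio_self
    · exact le_add_of_nonneg_left (Finset.sum_nonneg fun i _ => sq_nonneg _)
  obtain ⟨H, hH0, hH⟩ := DD_bdd hs hp
  have hWM : ∀ p, W p ^ 2 ≤ 2 * (1 + H) * M p := by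
    intro p
    have c := Finset.sum_mul_sq_le_sq_mul_sq Finset.univ (fun i => DD i h p.1) (fun i => A i p)
    have c1 : (0:ℝ) ≤ ∑ i, A i p ^ 2 := Finset.sum_nonneg fun i _ => sq_nonneg _
    have c2 := mul_le_mul_of_nonneg_right (hH p.1) c1
    simp only [hW, hM]
    nlinarith [sq_nonneg (A0 p + ∑ i, DD i h p.1 * A i p), mul_nonneg hH0 (sq_nonneg (A0 p))]
  have hWm : ∀ z, ∫ x in bx 0, W (x, z)^2 ≤ 2 * (1 + H) * m z := by
    intro z
    rw [hm, ← integral_const_mul]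
    exact setIntegral_mono (integrableOn_bx ((hcx z sW.continuous).pow 2)) ((integrableOn_bx (hcx z sM)).const_mul _) fun x => hWM _
  have hmono : ∀ a b, a ≤ b → b ≤ 0 → J a ≤ J b := by
    intro a b hab hb
    have := monotoneOn_of_deriv_nonneg (convex_Iic (0:ℝ)) hJc.continuousOn
      (by rw [interior_Iic]; exact fun z hz => (hJd z hz).differentiableAt.differentiableWithinAt)
      (by rw [interior_Iic]; exact fun z hz => by rw [(hJd z hz).deriv]; exact hm0 z)
    exact this (show a ∈ Iic 0 from hab.trans hb) hb hab
  have hJzero : ∀ z ≤ 0, J z = 0 := by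
    intro z0 hz0
    by_contra hne
    have hneg : J z0 < 0 := lt_of_le_of_ne (by rw [← hJ0]; exact hmono z0 0 hz0 le_rfl) hne
    have hz0' : z0 < 0 := lt_of_le_of_ne hz0 (fun hh => hne (by rw [hh, hJ0]))
    set δ := - J z0 with hδ
    have hδ0 : 0 < δ := by linarith
    have hlow : ∀ z ∈ Iic z0, δ^2 / (2 * (1 + H) * (E + 1)) * (-z)⁻¹ ≤ m z := by
      intro z hz
      have hz' : z ≤ z0 := hz
      have hzn : z < 0 := lt_of_le_of_lt hz' hz0'
      have hJz : δ ≤ - J z := by have := hmono z z0 hz' hz0; linarith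
      set lam := δ / ((-z) * (E + 1)) with hlam
      have hden : 0 < (-z) * (E + 1) := by apply mul_pos <;> linarith
      have hlam0 : 0 < lam := div_pos hδ0 hden
      have hAM : - J z ≤ lam / 2 * (∫ x in bx 0, g (x, z)^2) + (1 / (2 * lam)) * ∫ x in bx 0, W (x, z)^2 := by
        have ig : IntegrableOn (fun x => g (x, z)^2) (bx 0) := integrableOn_bx ((hcx z sg.continuous).pow 2)
        have iW : IntegrableOn (fun x => W (x, z)^2) (bx 0) := integrableOn_bx ((hcx z sW.continuous).pow 2)
        rw [hJ, ← integral_const_mul, ← integral_const_mul, ← integral_neg, ← integral_add (ig.const_mul _) (iW.const_mul _)]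
        refine setIntegral_mono ?_ ((ig.const_mul _).add (iW.const_mul _)) fun x => ?_
        · exact (integrableOn_bx (hcx z (sg.mul sW).continuous)).neg
        · have : lam / 2 * g (x, z)^2 + 1 / (2 * lam) * W (x, z)^2 + g (x, z) * W (x, z) = (lam * g (x, z) + W (x, z))^2 / (2 * lam) := by
            field_simp; ring
          have h2 : 0 ≤ (lam * g (x, z) + W (x, z))^2 / (2 * lam) := by positivity
          simp only [Pi.add_apply]
          linarith
      have b1 := hgE z hzn
      have b2 := hWm z
      have k1 : lam / 2 * (∫ x in bx 0, g (x, z)^2) ≤ δ / 2 := by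
        calc lam / 2 * (∫ x in bx 0, g (x, z)^2) ≤ lam / 2 * ((-z) * (E + 1)) := by
              apply mul_le_mul_of_nonneg_left _ (by positivity)
              nlinarith
          _ = δ / 2 := by rw [hlam, div_div, div_mul_eq_mul_div, mul_comm _ (2:ℝ), mul_div_mul_right _ _ hden.ne']
      have k2 : (1 / (2 * lam)) * ∫ x in bx 0, W (x, z)^2 ≤ (1 / (2 * lam)) * (2 * (1 + H) * m z) :=
        mul_le_mul_of_nonneg_left b2 (by positivity)
      have k3 : δ / 2 ≤ (1 / (2 * lam)) * (2 * (1 + H) * m z) := by linarith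
      have k4 : δ * lam ≤ 2 * (1 + H) * m z := by
        have := mul_le_mul_of_nonneg_left k3 (show 0 ≤ 2 * lam by positivity)
        have e : 2 * lam * (1 / (2 * lam) * (2 * (1 + H) * m z)) = 2 * (1 + H) * m z := by field_simp
        rw [e] at this; linarith
      have e5 : δ^2 / (2 * (1 + H) * (E + 1)) * (-z)⁻¹ = δ * lam / (2 * (1 + H)) := by
        rw [hlam]
        have : -z ≠ 0 := by linarith
        have : E + 1 ≠ 0 := by linarith
        have : 1 + H ≠ 0 := by linarith
        field_simp
      rw [e5, div_le_iff₀ (by linarith)]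
      linarith
    have hint : IntegrableOn (fun z : ℝ => δ^2 / (2 * (1 + H) * (E + 1)) * (-z)⁻¹) (Iic z0) := by
      refine Integrable.mono' (hmi.mono_set (Iic_subset_Iio.2 hz0')) ?_ ?_
      · exact ((measurable_neg.inv).const_mul _).aestronglyMeasurable
      · refine (ae_restrict_iff' measurableSet_Iic).2 (Eventually.of_forall fun z hz => ?_)
        have : 0 < -z := by have : z ≤ z0 := hz; linarith
        rw [Real.norm_of_nonneg (by positivity)]
        exact hlow z hz
    have hc0 : δ^2 / (2 * (1 + H) * (E + 1)) ≠ 0 := by positivity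
    have hint2 : IntegrableOn (fun z : ℝ => (-z)⁻¹) (Iic z0) := by
      have := hint.const_mul (δ^2 / (2 * (1 + H) * (E + 1)))⁻¹
      refine this.congr (Eventually.of_forall fun z => ?_)
      simp only
      rw [inv_mul_cancel_left₀ hc0]
    have hint3 : IntegrableOn (fun z : ℝ => z⁻¹) (Ioi (-z0)) := by
      have e := (Measure.measurePreserving_neg (volume : Measure ℝ)).integrableOn_comp_preimage (MeasurableEquiv.neg ℝ).measurableEmbedding
        (f := fun z : ℝ => z⁻¹) (s := Ioi (-z0))
      refine e.1 (hint2.mono_set fun z hz => ?_)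
      have : -z0 < -z := hz
      exact le_of_lt (by linarith : z < z0)
    exact not_integrableOn_Ioi_inv hint3
  have hmz : ∀ z < 0, m z = 0 := by
    intro z hz
    have : J =ᶠ[𝓝 z] fun _ => 0 := by
      filter_upwards [Iio_mem_nhds hz] with q hq
      exact hJzero q (le_of_lt hq)
    have e := (hJd z hz).congr_of_eventuallyEq this.symm
    exact (e.unique (hasDerivAt_const z (0:ℝ)))
  have hA00 : ∀ x z, z < 0 → A0 (x, z) = 0 := by
    intro x z hz
    have := eq_zero_of_integral_bx (hMp z) (hcx z sM) (fun x => hM0 _) (hmz z hz) x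
    have c1 : (0:ℝ) ≤ ∑ i, A i (x, z) ^ 2 := Finset.sum_nonneg fun i _ => sq_nonneg _
    simp only [hM] at this
    nlinarith [sq_nonneg (A0 (x, z))]
  have hfin : ∀ z ≤ 0, g (x, z) = 0 := by
    intro z hz
    rcases eq_or_lt_of_le hz with h1 | h1
    · rw [h1, hg0]
    have := intervalIntegral.integral_eq_sub_of_hasDerivAt (a := z) (b := 0) (fun s _ => hasDerivAt_z g sg x s)
          ((hcz x (contDiff_dv (ez n) sg).continuous).intervalIntegrable _ _)
    rw [hgz, hg0, intervalIntegral.integral_of_le hz, integral_Ioc_eq_integral_Ioo,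
      setIntegral_congr_fun measurableSet_Ioo (fun s hs => hA00 x s hs.2)] at this
    simp at this
    linarith
  have := hfin (y - h x) (by linarith)
  simpa [hgdef, sk] using this
end
end HS
end

noncomputable section
namespace HS
open Set Filter Topology
open scoped ComplexConjugate InnerProductSpace ContDiff

section
variable {E : Type*} [NormedAddCommGroup E] [NormedSpace ℝ E]

lemma dv_add (v : E) {F G : E → ℝ} (hF : ContDiff ℝ ∞ F) (hG : ContDiff ℝ ∞ G) :
    dv v (fun p => F p + G p) = fun p => dv v F p + dv v G p := by
  funext p
  simp only [dv]
  rw [fderiv_fun_add (hF.differentiable (by simp) p) (hG.differentiable (by simp) p)]; simp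

lemma dv_sub (v : E) {F G : E → ℝ} (hF : ContDiff ℝ ∞ F) (hG : ContDiff ℝ ∞ G) :
    dv v (fun p => F p - G p) = fun p => dv v F p - dv v G p := by
  funext p
  simp only [dv]
  rw [fderiv_fun_sub (hF.differentiable (by simp) p) (hG.differentiable (by simp) p)]; simp

lemma dv_sum (v : E) {ι : Type*} (s : Finset ι) {F : ι → E → ℝ} (hF : ∀ i, ContDiff ℝ ∞ (F i)) :
    dv v (fun p => ∑ i ∈ s, F i p) = fun p => ∑ i ∈ s, dv v (F i) p := by
  funext p
  simp only [dv]
  rw [fderiv_fun_sum fun i _ => (hF i).differentiable (by simp) p]; simp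

lemma hasDerivAt_line {F : E → ℝ} (hF : ContDiff ℝ ∞ F) (q v : E) (t : ℝ) :
    HasDerivAt (fun t : ℝ => F (q + t • v)) (dv v F (q + t • v)) t := by
  have h1 : HasDerivAt (fun t : ℝ => q + t • v) v t := by
    simpa using ((hasDerivAt_id t).smul_const v).const_add q
  exact ((hF.differentiable (by simp) (q + t • v)).hasFDerivAt).comp_hasDerivAt t h1

lemma second_deriv_nonneg {F : E → ℝ} (hF : ContDiff ℝ ∞ F) {q : E} (hq : IsLocalMin F q) (v : E) :
    0 ≤ dv v (dv v F) q := by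
  set φ : ℝ → ℝ := fun t => F (q + t • v) with hφ
  have d1 : deriv φ = fun t => dv v F (q + t • v) := funext fun t => (hasDerivAt_line hF q v t).deriv
  have d2 : deriv (deriv φ) 0 = dv v (dv v F) q := by
    rw [d1, (hasDerivAt_line (contDiff_dv v hF) q v 0).deriv]; simp
  have hc : Continuous (fun t : ℝ => q + t • v) := by fun_prop
  have hmin : IsLocalMin φ 0 := by
    have h0 : Tendsto (fun t : ℝ => q + t • v) (𝓝 0) (𝓝 q) := by
      have := hc.tendsto 0; simpa using this
    have := h0.eventually hq
    simpa [IsLocalMin, IsMinFilter, hφ] using this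
  by_contra hneg
  push Not at hneg
  rw [← d2] at hneg
  have hmax : IsLocalMax φ 0 := isLocalMax_of_deriv_deriv_neg hneg hmin.deriv_eq_zero
    (hasDerivAt_line hF q v 0).continuousAt
  have hcst : φ =ᶠ[𝓝 0] fun _ => φ 0 := by
    filter_upwards [hmin, hmax] with t h1 h2 using le_antisymm h2 h1
  have e1 : deriv φ =ᶠ[𝓝 0] fun _ => 0 := by
    filter_upwards [hcst.deriv] with t ht
    rw [ht]; simp
  rw [e1.deriv_eq] at hneg
  simp at hneg
end

section
variable {n : ℕ}

lemma ext_unique {h ψ : (Fin n → ℝ) → ℝ} (hs : ContDiff ℝ ∞ h) (hp : Per h) {φ1 φ2} (h1 : IsHarmonicExt n h ψ φ1)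
    (h2 : IsHarmonicExt n h ψ φ2) (x y) (hy : y ≤ h x) : φ1 (x, y) = φ2 (x, y) := by
  have s1 : ContDiff ℝ ∞ φ1 := h1.smooth
  have s2 : ContDiff ℝ ∞ φ2 := h2.smooth
  have hd : ∀ v, pdE n (fun p => φ1 p - φ2 p) v = fun p => pdE n φ1 v p - pdE n φ2 v p := fun v => dv_sub v s1 s2
  have hd2 : ∀ v, pdE n (pdE n (fun p => φ1 p - φ2 p) v) v = fun p => pdE n (pdE n φ1 v) v p - pdE n (pdE n φ2 v) v p := by
    intro v; rw [hd]; exact dv_sub v (contDiff_dv v s1) (contDiff_dv v s2)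
  have key := unique_zero hs hp (f := fun p => φ1 p - φ2 p) (s1.sub s2) (fun x y k => by
    simp only [h1.periodic x y k, h2.periodic x y k]) (fun p hp => ?_) (fun x => by simp only [h1.boundary, h2.boundary, sub_self]) ?_ x y hy
  · exact sub_eq_zero.1 key
  · have e1 := h1.harmonic p hp
    have e2 := h2.harmonic p hp
    simp only [lapE, hd2, Finset.sum_sub_distrib] at e1 e2 ⊢
    linarith
  · have hc : ∀ {φ}, ContDiff ℝ ∞ φ → Continuous (gradSqE n φ) := fun {φ} hh =>
      (continuous_finsetSum _ fun i _ => (contDiff_dv (eX n i) hh).continuous.pow 2).add ((contDiff_dv (eY n) hh).continuous.pow 2)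
    refine Integrable.mono' ((h1.gradL2.const_mul 2).add (h2.gradL2.const_mul 2)) (hc (s1.sub s2)).aestronglyMeasurable (Eventually.of_forall fun p => ?_)
    have h0 : ∀ φ, 0 ≤ gradSqE n φ p := fun φ => add_nonneg (Finset.sum_nonneg fun i _ => sq_nonneg _) (sq_nonneg _)
    rw [Real.norm_of_nonneg (h0 _)]
    simp only [gradSqE, hd, Pi.add_apply, mul_add, Finset.mul_sum]
    have a1 : ∀ a b : ℝ, (a - b)^2 ≤ 2 * a^2 + 2 * b^2 := fun a b => by nlinarith [sq_nonneg (a + b)]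
    have a2 := a1 (pdE n φ1 (eY n) p) (pdE n φ2 (eY n) p)
    have a3 : ∑ i, (pdE n φ1 (eX n i) p - pdE n φ2 (eX n i) p)^2 ≤ ∑ i, 2 * pdE n φ1 (eX n i) p ^ 2 + ∑ i, 2 * pdE n φ2 (eX n i) p ^ 2 := by
      rw [← Finset.sum_add_distrib]; exact Finset.sum_le_sum fun i _ => a1 _ _
    linarith

lemma dv_eq_boundary {h : (Fin n → ℝ) → ℝ} (hs : ContDiff ℝ ∞ h) {f g : (Fin n → ℝ) × ℝ → ℝ}
    (hf : ContDiff ℝ ∞ f) (hg : ContDiff ℝ ∞ g) (he : ∀ x y, y < h x → f (x, y) = g (x, y)) (v x) : dv v f (x, h x) = dv v g (x, h x) := by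
  have ho : IsOpen {p : (Fin n → ℝ) × ℝ | p.2 < h p.1} := isOpen_lt continuous_snd (hs.continuous.comp continuous_fst)
  have h1 : ∀ y < h x, dv v f (x, y) = dv v g (x, y) := by
    intro y hy
    have : f =ᶠ[𝓝 (x, y)] g := by
      filter_upwards [ho.mem_nhds (show (x, y) ∈ {p : (Fin n → ℝ) × ℝ | p.2 < h p.1} from hy)] with p hp
      exact he p.1 p.2 hp
    rw [dv, dv, this.fderiv_eq]
  have c : ∀ {k : (Fin n → ℝ) × ℝ → ℝ}, ContDiff ℝ ∞ k → Continuous (fun y => dv v k (x, y)) := fun hk =>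
    (contDiff_dv v hk).continuous.comp (Continuous.prodMk_right x)
  have h2 : EqOn (fun y => dv v f (x, y)) (fun y => dv v g (x, y)) (Iio (h x)) := fun y hy => h1 y hy
  have h3 := h2.closure (c hf) (c hg)
  rw [closure_Iio] at h3
  exact h3 (le_refl (h x))

lemma ext_unique_dv {h ψ : (Fin n → ℝ) → ℝ} (hs : ContDiff ℝ ∞ h) (hp : Per h) {φ1 φ2} (h1 : IsHarmonicExt n h ψ φ1)
    (h2 : IsHarmonicExt n h ψ φ2) (v x) : pdE n φ1 v (x, h x) = pdE n φ2 v (x, h x) :=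
  dv_eq_boundary hs h1.smooth h2.smooth (fun x y hy => ext_unique hs hp h1 h2 x y hy.le) v x

lemma DtN_eq {h ψ : (Fin n → ℝ) → ℝ} (hs : ContDiff ℝ ∞ h) (hp : Per h) {φ} (H : IsHarmonicExt n h ψ φ) (x) :
    DtN n h ψ x = pdE n φ (eY n) (x, h x) - ∑ i, pdX n h i x * pdE n φ (eX n i) (x, h x) := by
  have hex : ∃ φ, IsHarmonicExt n h ψ φ := ⟨φ, H⟩
  rw [DtN, dif_pos hex]
  simp only [fun v => ext_unique_dv hs hp hex.choose_spec H v x]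

lemma Bop_eq {h ψ : (Fin n → ℝ) → ℝ} (hs : ContDiff ℝ ∞ h) (hp : Per h) {φ} (H : IsHarmonicExt n h ψ φ) (x) :
    Bop n h ψ x = pdE n φ (eY n) (x, h x) := by
  have hex : ∃ φ, IsHarmonicExt n h ψ φ := ⟨φ, H⟩
  rw [Bop, dif_pos hex]
  exact ext_unique_dv hs hp hex.choose_spec H _ x

lemma Vop_eq {h ψ : (Fin n → ℝ) → ℝ} (hs : ContDiff ℝ ∞ h) (hp : Per h) {φ} (H : IsHarmonicExt n h ψ φ) (x i) :
    Vop n h ψ x i = pdE n φ (eX n i) (x, h x) := by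
  have hex : ∃ φ, IsHarmonicExt n h ψ φ := ⟨φ, H⟩
  rw [Vop, dif_pos hex]
  exact ext_unique_dv hs hp hex.choose_spec H _ x

theorem max_principle {h : (Fin n → ℝ) → ℝ} (hs : ContDiff ℝ ∞ h) (hp : Per h) {u : (Fin n → ℝ) × ℝ → ℝ}
    (hu : ContDiff ℝ ∞ u) (hup : ZPeriodicE n u) (hL : ∀ p : (Fin n → ℝ) × ℝ, p.2 < h p.1 → lapE n u p ≤ 0)
    (h0 : ∀ x, u (x, h x) = 0) (C : ℝ) (hC : ∀ x y, y ≤ h x → -(C * (1 + Real.sqrt (h x - y))) ≤ u (x, y)) :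
    ∀ x y, y ≤ h x → 0 ≤ u (x, y) := by
  obtain ⟨c, hc⟩ := Per.bounded hp hs.continuous
  have hc' : ∀ x, h x ≤ c := fun x => (le_abs_self _).trans (hc x)
  have hc2 : ∀ x, -c ≤ h x := fun x => (abs_le.1 (hc x)).1
  set B : (Fin n → ℝ) × ℝ → ℝ := fun p => c + 1 - p.2 - Real.exp (p.2 - c) with hB
  have sB : ContDiff ℝ ∞ B := by
    simp only [hB]
    exact (contDiff_const.sub contDiff_snd).sub (Real.contDiff_exp.comp (contDiff_snd.sub contDiff_const))
  have hBpos : ∀ p, p.2 ≤ c → c - p.2 ≤ B p := by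
    intro p hp
    have : Real.exp (p.2 - c) ≤ 1 := Real.exp_le_one_iff.2 (by linarith)
    simp only [hB]; linarith
  have dBx : ∀ i, dv (ex i) B = fun _ => 0 := by
    intro i; funext p
    rw [dv_line sB]; simp [hB, ex]
  have dBz : dv (ez n) B = fun p => -1 - Real.exp (p.2 - c) := by
    funext p
    refine (hasDerivAt_z B sB p.1 p.2).unique ?_
    have e1 : HasDerivAt (fun z : ℝ => Real.exp (z - c)) (Real.exp (p.2 - c)) p.2 := by
      simpa using ((hasDerivAt_id p.2).sub_const c).exp
    exact ((hasDerivAt_id p.2).const_sub (c + 1)).sub e1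
  have dBzz : dv (ez n) (dv (ez n) B) = fun p => - Real.exp (p.2 - c) := by
    funext p
    refine (hasDerivAt_z _ (contDiff_dv (ez n) sB) p.1 p.2).unique ?_
    rw [dBz]
    have e1 : HasDerivAt (fun z : ℝ => Real.exp (z - c)) (Real.exp (p.2 - c)) p.2 := by
      simpa using ((hasDerivAt_id p.2).sub_const c).exp
    simpa using e1.const_sub (-1)
  have main : ∀ ε > 0, ∀ x y, y ≤ h x → 0 ≤ u (x, y) + ε * B (x, y) := by
    intro ε hε x0 y0 hy0
    by_contra hneg
    push Not at hneg
    set F : (Fin n → ℝ) × ℝ → ℝ := fun p => u p + ε * B p with hF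
    have sF : ContDiff ℝ ∞ F := hu.add (contDiff_const.mul sB)
    have hFp : ZPeriodicE n F := fun x y k => by simp only [hF, hB, hup x y k]
    -- positivity far below
    obtain ⟨R, hR⟩ : ∃ R : ℝ, ∀ x y, y ≤ h x → y ≤ R → 0 ≤ F (x, y) := by
      have hlim : ∃ S0 : ℝ, 0 ≤ S0 ∧ ∀ S ≥ S0, |C| * (1 + S) ≤ ε * S^2 := by
        refine ⟨2 * |C| / ε + 1, by positivity, fun S hS => ?_⟩
        have k1 : 0 ≤ 2 * |C| / ε := by positivity
        have k2 : 1 ≤ S := by linarith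
        have k3 : 2 * |C| ≤ ε * S := by
          have : 2 * |C| / ε ≤ S := by linarith
          rw [div_le_iff₀ hε] at this; linarith
        nlinarith [abs_nonneg C]
      obtain ⟨S0, hS0, hS⟩ := hlim
      refine ⟨-c - S0^2, fun x y hy hyR => ?_⟩
      have k1 : S0 ≤ Real.sqrt (h x - y) := Real.le_sqrt_of_sq_le (by linarith [hc2 x])
      have k2 := hS _ k1
      rw [Real.sq_sqrt (by linarith)] at k2
      have k3 := hC x y hy
      have k4 := hBpos (x, y) (by simpa using hy.trans (hc' x))
      have k5 : C * (1 + Real.sqrt (h x - y)) ≤ |C| * (1 + Real.sqrt (h x - y)) :=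
        mul_le_mul_of_nonneg_right (le_abs_self _) (by positivity)
      have k6 : ε * (h x - y) ≤ ε * B (x, y) := mul_le_mul_of_nonneg_left (by simp only at k4; linarith [hc' x]) hε.le
      simp only [hF]; linarith
    set K : Set ((Fin n → ℝ) × ℝ) := {p | p.1 ∈ Icc 0 1 ∧ p.2 ∈ Icc R c ∧ p.2 ≤ h p.1} with hK
    have hKc : IsCompact K := by
      refine IsCompact.of_isClosed_subset ((isCompact_Icc (a := (0 : Fin n → ℝ)) (b := 1)).prod (isCompact_Icc (a := R) (b := c))) ?_ (fun p hp => ⟨hp.1, hp.2.1⟩)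
      exact (isClosed_Icc.preimage continuous_fst).inter ((isClosed_Icc.preimage continuous_snd).inter
        (isClosed_le continuous_snd (hs.continuous.comp continuous_fst)))
    have hred : ∀ x y, ∃ x' ∈ Icc (0 : Fin n → ℝ) 1, h x' = h x ∧ F (x', y) = F (x, y) := by
      intro x y
      refine ⟨x + fun i => ((-⌊x i⌋ : ℤ) : ℝ), ⟨fun i => ?_, fun i => ?_⟩, hp x (fun i => -⌊x i⌋), hFp x y (fun i => -⌊x i⌋)⟩
      · simp [Int.floor_le]
      · simp; have := Int.lt_floor_add_one (x i); linarith
    have hmemK : ∀ x y, y ≤ h x → F (x, y) < 0 → ∃ x', (x', y) ∈ K ∧ F (x', y) = F (x, y) := by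
      intro x y hy hlt
      obtain ⟨x', h1, h2, h3⟩ := hred x y
      refine ⟨x', ⟨h1, ⟨?_, hy.trans (hc' x)⟩, by simpa [h2] using hy⟩, h3⟩
      by_contra hh
      push Not at hh
      exact absurd (hR x y hy hh.le) (not_le.2 hlt)
    obtain ⟨x1, hx1, hF1⟩ := hmemK x0 y0 hy0 hneg
    obtain ⟨q, hqK, hq⟩ := hKc.exists_isMinOn ⟨_, hx1⟩ sF.continuous.continuousOn
    have hqneg : F q < 0 := lt_of_le_of_lt (hq hx1) (by rw [hF1]; exact hneg)
    have hq2 : q.2 < h q.1 := by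
      refine lt_of_le_of_ne hqK.2.2 fun heq => ?_
      have e1 : F q = ε * B q := by
        simp only [hF]
        have : u q = 0 := by rw [← h0 q.1, ← heq]
        rw [this, zero_add]
      have e2 := hBpos q hqK.2.1.2
      have : 0 ≤ ε * B q := mul_nonneg hε.le (by linarith [hqK.2.1.2])
      linarith
    have ho : IsOpen {p : (Fin n → ℝ) × ℝ | p.2 < h p.1} := isOpen_lt continuous_snd (hs.continuous.comp continuous_fst)
    have hloc : IsLocalMin F q := by
      filter_upwards [ho.mem_nhds hq2] with p hpp
      by_contra hlt
      push Not at hlt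
      obtain ⟨x', h1, h2⟩ := hmemK p.1 p.2 (le_of_lt hpp) (hlt.trans hqneg)
      have := hq h1
      simp only [mem_setOf_eq] at this
      rw [h2] at this
      exact absurd this (not_le.2 hlt)
    have hdF : ∀ v, dv v F = fun p => dv v u p + ε * dv v B p := by
      intro v
      simp only [hF]
      rw [dv_add v hu (contDiff_const.mul sB)]
      funext p
      rw [dv_mul v contDiff_const sB]
      have : dv v (fun _ : (Fin n → ℝ) × ℝ => ε) p = 0 := by simp [dv]
      rw [this]; ring
    have hddF : ∀ v, dv v (dv v F) q = dv v (dv v u) q + ε * dv v (dv v B) q := by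
      intro v
      rw [hdF, dv_add v (contDiff_dv v hu) (contDiff_const.mul (contDiff_dv v sB))]
      simp only
      rw [dv_mul v contDiff_const (contDiff_dv v sB)]
      have : dv v (fun _ : (Fin n → ℝ) × ℝ => ε) q = 0 := by simp [dv]
      rw [this]; ring
    have n1 : ∀ i, 0 ≤ dv (ex i) (dv (ex i) u) q := by
      intro i
      have := second_deriv_nonneg sF hloc (ex i)
      rw [hddF, dBx] at this
      simpa [dv] using this
    have n2 := second_deriv_nonneg sF hloc (ez n)
    rw [hddF, dBzz] at n2
    have n3 : 0 ≤ ∑ i, dv (ex i) (dv (ex i) u) q := Finset.sum_nonneg fun i _ => n1 i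
    have n4 : (∑ i, dv (ex i) (dv (ex i) u) q) + dv (ez n) (dv (ez n) u) q ≤ 0 := hL q hq2
    have n5 : 0 < ε * Real.exp (q.2 - c) := mul_pos hε (Real.exp_pos _)
    simp only [mul_neg] at n2
    linarith
  intro x y hy
  have hlim : Tendsto (fun ε : ℝ => u (x, y) + ε * B (x, y)) (𝓝[>] 0) (𝓝 (u (x, y))) := by
    have : Continuous (fun ε : ℝ => u (x, y) + ε * B (x, y)) := by fun_prop
    have := (this.tendsto 0).mono_left (nhdsWithin_le_nhds (s := Ioi 0))
    simpa using this
  exact ge_of_tendsto hlim (by filter_upwards [self_mem_nhdsWithin] with ε hε using main ε hε x y hy)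

theorem hopf {h : (Fin n → ℝ) → ℝ} (hs : ContDiff ℝ ∞ h) (hp : Per h) {u : (Fin n → ℝ) × ℝ → ℝ}
    (hu : ContDiff ℝ ∞ u) (hup : ZPeriodicE n u) (hL : ∀ p : (Fin n → ℝ) × ℝ, p.2 < h p.1 → lapE n u p ≤ 0)
    (h0 : ∀ x, u (x, h x) = 0) (C : ℝ) (hC : ∀ x y, y ≤ h x → -(C * (1 + Real.sqrt (h x - y))) ≤ u (x, y)) (x) :
    dv (ez n) u (x, h x) ≤ 0 := by
  have h1 := max_principle hs hp hu hup hL h0 C hC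
  have h2 := (hasDerivAt_iff_tendsto_slope.1 (hasDerivAt_z u hu x (h x))).mono_left (nhdsWithin_mono _ (fun y (hy : y ∈ Iio (h x)) => ne_of_lt hy))
  refine le_of_tendsto h2 ?_
  filter_upwards [self_mem_nhdsWithin] with y hy
  have hy' : y < h x := hy
  rw [slope_def_field, h0, sub_zero]
  exact div_nonpos_of_nonneg_of_nonpos (h1 x y hy'.le) (by linarith)
end
end HS
end

noncomputable section
namespace HS
open Set Filter Topology
open scoped ComplexConjugate InnerProductSpace ContDiff
section
variable {n : ℕ}

lemma DD_bdry {d : ℕ} {ht : (Fin d → ℝ) → ℝ} (hs : ContDiff ℝ ∞ ht) {F : (Fin d → ℝ) × ℝ → ℝ} (hF : ContDiff ℝ ∞ F)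
    (j : Fin d) (u) : DD j (fun u => F (u, ht u)) u = dv (ex j) F (u, ht u) + DD j ht u * dv (ez d) F (u, ht u) := by
  have h1 := ((hF.differentiable (by simp) (u, ht u)).hasFDerivAt).comp u
    ((hasFDerivAt_id u).prodMk (hs.differentiable (by simp) u).hasFDerivAt)
  have h2 : fderiv ℝ (fun u => F (u, ht u)) u = _ := h1.fderiv
  rw [DD, h2]
  simp only [ContinuousLinearMap.comp_apply, ContinuousLinearMap.prod_apply, ContinuousLinearMap.id_apply, dv, DD]
  have : ((Pi.single j 1 : Fin d → ℝ), (fderiv ℝ ht u) (Pi.single j 1)) = ex j + (fderiv ℝ ht u) (Pi.single j 1) • ez d := by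
    ext <;> simp [ex, ez]
  rw [this, map_add, map_smul, smul_eq_mul]

lemma DD_slice {g : (Fin (n+1) → ℝ) → ℝ} (hg : ContDiff ℝ ∞ g) (s : ℝ) (i : Fin n) (x) :
    DD i (fun x => g (Fin.cons s x)) x = DD i.succ g (Fin.cons s x) := by
  have h1 : ContDiff ℝ ∞ (fun x : Fin n → ℝ => g (Fin.cons s x)) := hg.comp (contDiff_cons s)
  refine (dv_line h1 (Pi.single i 1) x).trans ((dv_line hg (Pi.single i.succ 1) (Fin.cons s x)).trans ?_).symm
  congr 1; funext t
  congr 1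
  funext j
  refine Fin.cases ?_ (fun j => ?_) j
  · simp
  · by_cases hj : j = i
    · subst hj; simp
    · simp [Pi.single_apply, hj]

lemma Lap_sq_nonneg {F : (Fin (n+1) → ℝ) × ℝ → ℝ} (hF : ContDiff ℝ ∞ F) (p) (h0 : Lap F p = 0) :
    0 ≤ Lap (fun p => F p * F p) p := by
  have e : ∀ v, dv v (dv v (fun p => F p * F p)) p = 2 * (F p * dv v (dv v F) p) + 2 * (dv v F p) ^ 2 := by
    intro v
    have h1 : dv v (fun p => F p * F p) = fun p => dv v F p * F p + F p * dv v F p := by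
      funext p; exact dv_mul v hF hF p
    have s1 := contDiff_dv v hF
    rw [h1, dv_add v (s1.mul hF) (hF.mul s1)]
    simp only [dv_mul v s1 hF p, dv_mul v hF s1 p]
    ring
  have : Lap (fun p => F p * F p) p = 2 * (F p * Lap F p) + 2 * ((dv (ez _) F p) ^ 2 + ∑ i : Fin n, (dv (ex i.succ) F p) ^ 2) := by
    simp only [Lap, e, Finset.sum_add_distrib, ← Finset.mul_sum]; ring
  rw [this, h0]
  have : 0 ≤ ∑ i : Fin n, (dv (ex i.succ) F p) ^ 2 := Finset.sum_nonneg fun i _ => sq_nonneg _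
  nlinarith [sq_nonneg (dv (ez _) F p)]

lemma Lap_sub {F G : (Fin (n+1) → ℝ) × ℝ → ℝ} (hF : ContDiff ℝ ∞ F) (hG : ContDiff ℝ ∞ G) (p) :
    Lap (fun p => F p - G p) p = Lap F p - Lap G p := by
  have := Lap_add (hF.sub hG) hG p
  simp only [sub_add_cancel] at this
  have e : Lap (fun p => F p) p = Lap F p := rfl
  linarith

lemma Lap_sum {F : Fin n → (Fin (n+1) → ℝ) × ℝ → ℝ} (hF : ∀ i, ContDiff ℝ ∞ (F i)) (p) :
    Lap (fun p => ∑ i, F i p) p = ∑ i, Lap (F i) p := by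
  have e2 : ∀ a, dv a (dv a (fun p => ∑ i, F i p)) p = ∑ i, dv a (dv a (F i)) p := fun a => by
    rw [dv_sum a _ hF, dv_sum a _ (fun i => contDiff_dv a (hF i))]
  simp only [Lap, e2, Finset.sum_add_distrib]
  rw [Finset.sum_comm]

theorem main_slice (ht : (Fin (n+1) → ℝ) → ℝ) (hs : ContDiff ℝ ∞ ht) (hper : Per ht)
    (hE : ∀ x : Fin n → ℝ, DD 0 ht (Fin.cons 0 x) + DtN n (fun x => ht (Fin.cons 0 x)) (fun x => ht (Fin.cons 0 x)) x = 0) :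
    ∃ g : (Fin (n+1) → ℝ) → ℝ, ContDiff ℝ ∞ g ∧
      (∀ (s : ℝ) (x : Fin n → ℝ), Bop n (fun x => ht (Fin.cons s x)) (fun x => ht (Fin.cons s x)) x = g (Fin.cons s x)) ∧
      ∀ (h : ℝ → (Fin n → ℝ) → ℝ) (t : ℝ), h t = (fun x => ht (Fin.cons 0 x)) → ∀ x,
      (DD 0 g (Fin.cons 0 x)
        - (∑ i, HSV n h t x i * pdX n (fun z => HSB n h t z) i x)
        + HSa n h t x * DtN n (h t) (fun z => HSB n h t z) x
        = HSgamma n h t x) ∧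
      HSgamma n h t x ≤ 0 := by
  obtain ⟨Φ, sΦ, pΦ, bΦ, LSz, LSx, ⟨C0, hC0⟩, hL⟩ := Phi_exists ht hs hper
  have hL' : ∀ u y, y < ht u → Lap Φ (u, y) = 0 := fun u y hy => hL u y hy.le
  have shs : ∀ s : ℝ, ContDiff ℝ ∞ (fun x : Fin n → ℝ => ht (Fin.cons s x)) := fun s => hs.comp (contDiff_cons s)
  have shp : ∀ s : ℝ, Per (fun x : Fin n → ℝ => ht (Fin.cons s x)) := by
    intro s x k
    have := hper (Fin.cons s x) (Fin.cons 0 k)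
    refine Eq.trans ?_ this
    show ht _ = ht _
    congr 1
    funext j
    refine Fin.cases ?_ (fun j => ?_) j <;> simp
  have sz := contDiff_dv (ez (n+1)) sΦ
  have s0 := contDiff_dv (ex (0 : Fin (n+1))) sΦ
  have si : ∀ i : Fin n, ContDiff ℝ ∞ (dv (ex i.succ) Φ) := fun i => contDiff_dv _ sΦ
  have H1 : ∀ s, IsHarmonicExt n (fun x => ht (Fin.cons s x)) (fun x => ht (Fin.cons s x)) (sl s Φ) := by
    intro s
    have := slice_ext hs sΦ pΦ hL' LSz LSx s
    simpa only [bΦ] using this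
  have HB := slice_ext hs sz (per_dv sΦ pΦ _) (harm_dv hs sΦ hL' _) (LSz.dz hs) (fun i => LSz.dx hs hper i.succ) 0
  have HV := fun i : Fin n => slice_ext hs (si i) (per_dv sΦ pΦ _) (harm_dv hs sΦ hL' _) ((LSx i).dz hs) (fun j => (LSx i).dx hs hper j.succ) 0
  set q : (Fin (n+1) → ℝ) × ℝ → ℝ := fun p => dv (ex 0) Φ p + dv (ez _) Φ p with hq
  have sq : ContDiff ℝ ∞ q := s0.add sz
  have dq : ∀ v, dv v q = fun p => dv v (dv (ex 0) Φ) p + dv v (dv (ez _) Φ) p := fun v => dv_add v s0 sz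
  have HQ := slice_ext hs sq
    (fun y x k => by
      have h1 := per_dv sΦ pΦ (ex 0) y x k
      have h2 := per_dv sΦ pΦ (ez _) y x k
      simp only [hq]
      simp only at h1 h2
      rw [h1, h2])
    (fun u y hy => by
      rw [hq, Lap_add s0 sz, harm_dv hs sΦ hL' _ u y hy, harm_dv hs sΦ hL' _ u y hy, add_zero])
    (by
      rw [dq, dv_comm (ez _) (ex 0) sΦ]
      exact (LSz.dx hs hper 0).add (LSz.dz hs))
    (fun i => by
      rw [dq, dv_comm (ex i.succ) (ex 0) sΦ]
      exact ((LSx i).dx hs hper 0).add (LSz.dx hs hper _)) 0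
  -- boundary identities
  have bd : ∀ j u, dv (ex j) Φ (u, ht u) + DD j ht u * dv (ez _) Φ (u, ht u) = DD j ht u := by
    intro j u
    rw [← DD_bdry hs sΦ]; simp only [bΦ]
  set h0 : (Fin n → ℝ) → ℝ := fun x => ht (Fin.cons 0 x) with hh0
  replace HB : IsHarmonicExt n h0 (fun x => dv (ez _) Φ (Fin.cons 0 x, h0 x)) (sl 0 (dv (ez _) Φ)) := HB
  replace HV : ∀ i : Fin n, IsHarmonicExt n h0 (fun x => dv (ex i.succ) Φ (Fin.cons 0 x, h0 x)) (sl 0 (dv (ex i.succ) Φ)) := HV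
  replace HQ : IsHarmonicExt n h0 (fun x => q (Fin.cons 0 x, h0 x)) (sl 0 q) := HQ
  have pd0 : ∀ i x, pdX n h0 i x = DD i.succ ht (Fin.cons 0 x) := fun i x => DD_slice hs 0 i x
  have dtn : ∀ {ψ : (Fin n → ℝ) → ℝ} {Q : (Fin (n+1) → ℝ) × ℝ → ℝ}, ContDiff ℝ ∞ Q → IsHarmonicExt n h0 ψ (sl 0 Q) → ∀ x,
      DtN n h0 ψ x = dv (ez _) Q (Fin.cons 0 x, h0 x) - ∑ i : Fin n, DD i.succ ht (Fin.cons 0 x) * dv (ex i.succ) Q (Fin.cons 0 x, h0 x) := by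
    intro ψ Q sQ H x
    rw [DtN_eq (h := h0) (shs 0) (shp 0) H x, pdE_sl_Y 0 sQ]
    simp only [pd0, pdE_sl_X 0 sQ, sl]
  have bop : ∀ (s : ℝ) (x : Fin n → ℝ), Bop n (fun x => ht (Fin.cons s x)) (fun x => ht (Fin.cons s x)) x = dv (ez _) Φ (Fin.cons s x, ht (Fin.cons s x)) := by
    intro s x
    rw [Bop_eq (shs s) (shp s) (H1 s) x, pdE_sl_Y s sΦ]; rfl
  have vop : ∀ (x : Fin n → ℝ) i, Vop n h0 h0 x i = dv (ex i.succ) Φ (Fin.cons 0 x, h0 x) := by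
    intro x i
    rw [Vop_eq (shs 0) (shp 0) (H1 0) x, pdE_sl_X 0 sΦ]; rfl
  have bi : ∀ (i : Fin n) x, dv (ex i.succ) Φ (Fin.cons 0 x, h0 x) =
      (1 - dv (ez _) Φ (Fin.cons 0 x, h0 x)) * DD i.succ ht (Fin.cons 0 x) := by
    intro i x
    have := bd i.succ (Fin.cons 0 x)
    simp only [hh0]; linarith
  have ha0 : ∀ x : Fin n → ℝ, DD 0 ht (Fin.cons 0 x) = - dv (ez _) Φ (Fin.cons 0 x, h0 x)
      + ∑ i : Fin n, DD i.succ ht (Fin.cons 0 x) * dv (ex i.succ) Φ (Fin.cons 0 x, h0 x) := by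
    intro x
    have := hE x
    rw [dtn sΦ (H1 0) x] at this
    linarith
  have bq : ∀ x : Fin n → ℝ, q (Fin.cons 0 x, h0 x) = (dv (ez _) Φ (Fin.cons 0 x, h0 x)) ^ 2 + ∑ i : Fin n, (dv (ex i.succ) Φ (Fin.cons 0 x, h0 x)) ^ 2 := by
    intro x
    have h1 := bd 0 (Fin.cons 0 x)
    have h2 := ha0 x
    have h3 : ∑ i : Fin n, (dv (ex i.succ) Φ (Fin.cons 0 x, h0 x)) ^ 2 =
        (1 - dv (ez _) Φ (Fin.cons 0 x, h0 x)) * ∑ i : Fin n, DD i.succ ht (Fin.cons 0 x) * dv (ex i.succ) Φ (Fin.cons 0 x, h0 x) := by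
      rw [Finset.mul_sum]
      refine Finset.sum_congr rfl fun i _ => ?_
      rw [pow_two]; nth_rewrite 1 [bi i x]; ring
    have h4 : ht (Fin.cons 0 x) = h0 x := rfl
    rw [h4] at h1
    rw [h3]
    simp only [hq]
    linear_combination h1 + (1 - dv (ez _) Φ (Fin.cons 0 x, h0 x)) * h2
  -- the function W
  set S : (Fin (n+1) → ℝ) × ℝ → ℝ := fun p => ∑ i : Fin n, dv (ex i.succ) Φ p * dv (ex i.succ) Φ p with hS
  have sS : ContDiff ℝ ∞ S := ContDiff.sum fun i _ => (si i).mul (si i)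
  set R : (Fin (n+1) → ℝ) × ℝ → ℝ := fun p => dv (ez _) Φ p * dv (ez _) Φ p with hR
  have sR : ContDiff ℝ ∞ R := sz.mul sz
  set W1 : (Fin (n+1) → ℝ) × ℝ → ℝ := fun p => q p - S p with hW1
  have sW1 : ContDiff ℝ ∞ W1 := sq.sub sS
  set W : (Fin (n+1) → ℝ) × ℝ → ℝ := fun p => W1 p - R p with hW
  have sW : ContDiff ℝ ∞ W := sW1.sub sR
  have dW : ∀ v p, dv v W p = dv v q p - 2 * (∑ i : Fin n, dv (ex i.succ) Φ p * dv v (dv (ex i.succ) Φ) p)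
      - 2 * (dv (ez _) Φ p * dv v (dv (ez _) Φ) p) := by
    intro v p
    rw [hW, dv_sub v sW1 sR, hW1, dv_sub v sq sS, hS, dv_sum v _ (fun i => (si i).mul (si i)), hR]
    simp only [dv_mul v sz sz p, fun i : Fin n => dv_mul v (si i) (si i) p]
    rw [Finset.mul_sum, Finset.sum_congr rfl fun (i : Fin n) _ => show _ = 2 * (dv (ex i.succ) Φ p * dv v (dv (ex i.succ) Φ) p) by ring]
    ring
  have bW : ∀ x : Fin n → ℝ, W (Fin.cons 0 x, h0 x) = 0 := by
    intro x
    simp only [hW, hW1, hS, hR, bq x, pow_two]; ring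
  have LW : ∀ u y, y < ht u → Lap W (u, y) ≤ 0 := by
    intro u y hy
    have e1 : Lap q (u, y) = 0 := by
      rw [hq, Lap_add s0 sz, harm_dv hs sΦ hL' _ u y hy, harm_dv hs sΦ hL' _ u y hy, add_zero]
    have e2 : 0 ≤ Lap S (u, y) := by
      rw [hS, Lap_sum (fun i => (si i).mul (si i))]
      exact Finset.sum_nonneg fun i _ => Lap_sq_nonneg (si i) _ (harm_dv hs sΦ hL' _ u y hy)
    have e3 : 0 ≤ Lap R (u, y) := Lap_sq_nonneg sz _ (harm_dv hs sΦ hL' _ u y hy)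
    rw [hW, Lap_sub sW1 sR, hW1, Lap_sub sq sS]
    linarith
  obtain ⟨Cz, hCz⟩ := LSz.bdd
  choose Ci hCi using fun i => (LSx i).bdd
  have hop : ∀ x, dv (ez _) W (Fin.cons 0 x, h0 x) ≤ 0 := by
    intro x
    have := hopf (shs 0) (shp 0) (u := sl 0 W) (contDiff_sl 0 sW) ?_ ?_ ?_ (|C0| + |Cz| + ∑ i, Ci i ^ 2 + Cz ^ 2) ?_ x
    · have e := congrFun (pdE_sl_Y 0 sW) (x, h0 x)
      exact e.symm.trans_le this
    · intro x y k
      have h1 := HQ.periodic x y k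
      have h2 := HB.periodic x y k
      have h3 := fun i => (HV i).periodic x y k
      simp only [sl] at h1 h2 h3
      simp only [sl, hW, hW1, hS, hR, h1, h2, h3]
    · intro p hp
      rw [lapE_sl 0 sW]
      exact LW _ _ hp
    · intro x; exact bW x
    · intro x y hy
      have a1 := hC0 (Fin.cons 0 x) y hy
      have a2 := hCz (Fin.cons 0 x) y hy
      have a3 : S (Fin.cons 0 x, y) ≤ ∑ i, Ci i ^ 2 := by
        refine Finset.sum_le_sum fun i _ => ?_
        have := hCi i (Fin.cons 0 x) y hy
        rw [← pow_two]; exact sq_le_sq.2 (this.trans (le_abs_self _))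
      have a4 : R (Fin.cons 0 x, y) ≤ Cz ^ 2 := by
        simp only [hR]
        rw [← pow_two]; exact sq_le_sq.2 (a2.trans (le_abs_self _))
      have hr := Real.sqrt_nonneg (ht (Fin.cons 0 x) - y)
      set r := Real.sqrt (ht (Fin.cons 0 x) - y)
      have a5 : C0 * (1 + r) ≤ |C0| * (1 + r) := mul_le_mul_of_nonneg_right (le_abs_self _) (by linarith)
      have b1 := neg_le_of_abs_le a1
      have b2 := neg_le_of_abs_le a2
      have b3 := le_abs_self Cz
      have b4 : 0 ≤ ∑ i, Ci i ^ 2 := Finset.sum_nonneg fun i _ => sq_nonneg _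
      have b5 : 0 ≤ (|Cz| + ∑ i, Ci i ^ 2 + Cz ^ 2) * r := by positivity
      show _ ≤ W (Fin.cons 0 x, y)
      simp only [hW, hW1, hq]
      nlinarith
  refine ⟨fun u => dv (ez _) Φ (u, ht u), sz.comp (contDiff_id.prodMk hs), bop, ?_⟩
  intro h t hht x
  have eB : (fun z => HSB n h t z) = fun z => dv (ez _) Φ (Fin.cons 0 z, h0 z) := by
    funext z; simp only [HSB, hht]; exact bop 0 z
  have eB' : HSB n h t x = dv (ez _) Φ (Fin.cons 0 x, h0 x) := congrFun eB x
  have eV : ∀ z i, HSV n h t z i = dv (ex i.succ) Φ (Fin.cons 0 z, h0 z) := by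
    intro z i; simp only [HSV, hht]; exact vop z i
  have eQ : (fun z => (HSB n h t z)^2 + ∑ i, (HSV n h t z i)^2) = fun z => q (Fin.cons 0 z, h0 z) := by
    funext z; rw [bq]; simp only [eV]; rw [congrFun eB z]
  have sg : ContDiff ℝ ∞ (fun u => dv (ez _) Φ (u, ht u)) := sz.comp (contDiff_id.prodMk hs)
  have dB : ∀ i, pdX n (fun z => HSB n h t z) i x = dv (ex i.succ) (dv (ez _) Φ) (Fin.cons 0 x, h0 x) +
      DD i.succ ht (Fin.cons 0 x) * dv (ez _) (dv (ez _) Φ) (Fin.cons 0 x, h0 x) := by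
    intro i
    rw [eB]
    exact (DD_slice sg 0 i x).trans (DD_bdry hs sz i.succ (Fin.cons 0 x))
  have d0 : DD 0 (fun u => dv (ez _) Φ (u, ht u)) (Fin.cons 0 x) = dv (ex 0) (dv (ez _) Φ) (Fin.cons 0 x, h0 x) +
      DD 0 ht (Fin.cons 0 x) * dv (ez _) (dv (ez _) Φ) (Fin.cons 0 x, h0 x) := DD_bdry hs sz 0 (Fin.cons 0 x)
  have dWi : ∀ i : Fin n, dv (ex i.succ) W (Fin.cons 0 x, h0 x) = - DD i.succ ht (Fin.cons 0 x) * dv (ez _) W (Fin.cons 0 x, h0 x) := by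
    intro i
    have sWb : ContDiff ℝ ∞ (fun u => W (u, ht u)) := sW.comp (contDiff_id.prodMk hs)
    have e1 := (DD_slice sWb 0 i x).trans (DD_bdry hs sW i.succ (Fin.cons 0 x))
    have e2 : (fun x : Fin n → ℝ => W (Fin.cons 0 x, ht (Fin.cons 0 x))) = fun _ => 0 := funext bW
    rw [e2] at e1
    have e3 : DD i (fun _ : Fin n → ℝ => (0:ℝ)) x = 0 := by simp [DD]
    rw [e3] at e1
    have h4 : ht (Fin.cons 0 x) = h0 x := rfl
    rw [h4] at e1
    linarith
  have hgam : HSgamma n h t x = dv (ez _) W (Fin.cons 0 x, h0 x) := by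
    unfold HSgamma
    rw [eQ, eB, eB']
    simp only [eV, hht, pd0]
    have hA : 0 < 1 + ∑ i : Fin n, (DD i.succ ht (Fin.cons 0 x))^2 := by
      have : 0 ≤ ∑ i : Fin n, (DD i.succ ht (Fin.cons 0 x))^2 := Finset.sum_nonneg fun i _ => sq_nonneg _
      linarith
    rw [inv_mul_eq_iff_eq_mul₀ hA.ne']
    rw [dtn sq HQ x, dtn sz HB x]
    simp only [fun i => dtn (si i) (HV i) x]
    have k1 : (1 + ∑ i : Fin n, (DD i.succ ht (Fin.cons 0 x))^2) * dv (ez _) W (Fin.cons 0 x, h0 x) =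
        dv (ez _) W (Fin.cons 0 x, h0 x) - ∑ i : Fin n, DD i.succ ht (Fin.cons 0 x) * dv (ex i.succ) W (Fin.cons 0 x, h0 x) := by
      simp only [dWi]
      rw [add_mul, Finset.sum_mul, sub_eq_add_neg, ← Finset.sum_neg_distrib, one_mul]
      congr 1
      exact Finset.sum_congr rfl fun i _ => by ring
    rw [k1, dW]
    simp only [dW, mul_sub, Finset.mul_sum, Finset.sum_sub_distrib]
    rw [Finset.sum_comm (s := Finset.univ) (t := Finset.univ) (f := fun (i j : Fin n) => 2 * (dv (ex i.succ) Φ (Fin.cons 0 x, h0 x) *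
      (DD j.succ ht (Fin.cons 0 x) * dv (ex j.succ) (dv (ex i.succ) Φ) (Fin.cons 0 x, h0 x))))]
    simp only [mul_left_comm, mul_assoc]
    ring
  refine ⟨?_, hgam ▸ hop x⟩
  rw [hgam, d0]
  simp only [dB, HSa, eV]
  rw [eB', eB, hht, dtn sz HB x, dW, dq, ha0 x]
  simp only [dv_comm (ez _) (ex 0) sΦ, fun i : Fin n => dv_comm (ez _) (ex i.succ) sΦ]
  have k2 : (1 - dv (ez _) Φ (Fin.cons 0 x, h0 x)) * ∑ i : Fin n, DD i.succ ht (Fin.cons 0 x) * dv (ex i.succ) (dv (ez _) Φ) (Fin.cons 0 x, h0 x)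
     = ∑ i : Fin n, dv (ex i.succ) Φ (Fin.cons 0 x, h0 x) * dv (ex i.succ) (dv (ez _) Φ) (Fin.cons 0 x, h0 x) := by
    rw [Finset.mul_sum]
    exact Finset.sum_congr rfl fun i _ => by rw [bi i x]; ring
  have k3 : ∑ i : Fin n, dv (ex i.succ) Φ (Fin.cons 0 x, h0 x) * (dv (ex i.succ) (dv (ez _) Φ) (Fin.cons 0 x, h0 x) +
      DD i.succ ht (Fin.cons 0 x) * dv (ez _) (dv (ez _) Φ) (Fin.cons 0 x, h0 x)) =
      (∑ i : Fin n, dv (ex i.succ) Φ (Fin.cons 0 x, h0 x) * dv (ex i.succ) (dv (ez _) Φ) (Fin.cons 0 x, h0 x)) +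
      (∑ i : Fin n, DD i.succ ht (Fin.cons 0 x) * dv (ex i.succ) Φ (Fin.cons 0 x, h0 x)) * dv (ez _) (dv (ez _) Φ) (Fin.cons 0 x, h0 x) := by
    rw [Finset.sum_mul, ← Finset.sum_add_distrib]
    exact Finset.sum_congr rfl fun i _ => by ring
  rw [k3]
  linear_combination -k2
end
end HS
end

namespace HS
open Set Filter Topology
open scoped ComplexConjugate InnerProductSpace ContDiff

lemma hasDerivAt_cons {n : ℕ} {g : (Fin (n+1) → ℝ) → ℝ} (hg : ContDiff ℝ ∞ g) (x : Fin n → ℝ) (s : ℝ) :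
    HasDerivAt (fun s : ℝ => g (Fin.cons s x)) (DD 0 g (Fin.cons s x)) s := by
  have h1 := hasDerivAt_line hg (Fin.cons 0 x) (Pi.single 0 1) s
  have e : ∀ s : ℝ, (Fin.cons 0 x + s • Pi.single 0 1 : Fin (n+1) → ℝ) = Fin.cons s x := by
    intro s
    funext j
    refine Fin.cases ?_ (fun j => ?_) j <;> simp
  simp only [e] at h1
  exact h1

end HS

/-- B satisfies ∂ₜB − V·∇B + a G(h)B = γ with
γ = (1+|∇h|²)⁻¹ (G(h)(B²+|V|²) − 2B G(h)B − 2V·G(h)V), and γ ≤ 0. -/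
theorem heleShaw_B_evolution (n : ℕ) (hn : 1 ≤ n) (T : ℝ) (hT : 0 ≤ T)
    (h : ℝ → (Fin n → ℝ) → ℝ) (hsol : IsHeleShawSol n T h) :
    ∀ t ∈ Set.Icc 0 T, ∀ x,
      (deriv (fun s => HSB n h s x) t
        - (∑ i, HSV n h t x i * pdX n (fun z => HSB n h t z) i x)
        + HSa n h t x * DtN n (h t) (fun z => HSB n h t z) x
        = HSgamma n h t x) ∧
      HSgamma n h t x ≤ 0 := by
  intro t0 ht0 x
  set τ : ℝ → ℝ := fun s => t0 + Real.sin (2 * Real.pi * s) / (2 * Real.pi) with hτ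
  have pi2 : (2 * Real.pi) ≠ 0 := by positivity
  have dτ : HasDerivAt τ 1 0 := by
    have h1 : HasDerivAt (fun s : ℝ => 2 * Real.pi * s) (2 * Real.pi) 0 := by
      simpa using (hasDerivAt_id (0:ℝ)).const_mul (2 * Real.pi)
    have h2 := ((h1.sin).div_const (2 * Real.pi)).const_add t0
    refine h2.congr_deriv ?_
    simp [pi2]
  have τ0 : τ 0 = t0 := by simp [hτ]
  set ht : (Fin (n+1) → ℝ) → ℝ := fun u => h (τ (u 0)) (Fin.tail u) with hht
  have hcons : ∀ (s : ℝ) (x : Fin n → ℝ), ht (Fin.cons s x) = h (τ s) x := by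
    intro s x; simp [hht]
  have hconsf : ∀ s : ℝ, (fun x : Fin n → ℝ => ht (Fin.cons s x)) = h (τ s) := fun s => funext (hcons s)
  have sτ : ContDiff ℝ (⊤ : ℕ∞) τ := by
    simp only [hτ]; fun_prop
  have s1 : ContDiff ℝ (⊤ : ℕ∞) (fun u : Fin (n+1) → ℝ => u 0) := by fun_prop
  have s2 : ContDiff ℝ (⊤ : ℕ∞) (fun u : Fin (n+1) → ℝ => Fin.tail u) := by
    simp only [Fin.tail_def]; fun_prop
  have hs : ContDiff ℝ (⊤ : ℕ∞) ht := hsol.smooth.comp ((sτ.comp s1).prodMk s2)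
  have hper : HS.Per ht := by
    intro u k
    have e1 : τ ((u + fun i => (k i : ℝ)) 0) = τ (u 0) := by
      simp only [hτ, Pi.add_apply]
      rw [show 2 * Real.pi * (u 0 + (k 0 : ℝ)) = 2 * Real.pi * u 0 + (k 0 : ℤ) * (2 * Real.pi) by ring, Real.sin_add_int_mul_two_pi]
    have e2 : (Fin.tail (u + fun i => (k i : ℝ)) : Fin n → ℝ) = Fin.tail u + fun i => (k i.succ : ℝ) := rfl
    simp only [hht]
    rw [e1, e2]
    exact hsol.periodic _ _ _
  have hE : ∀ x : Fin n → ℝ, HS.DD 0 ht (Fin.cons 0 x) + DtN n (fun x => ht (Fin.cons 0 x)) (fun x => ht (Fin.cons 0 x)) x = 0 := by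
    intro x
    rw [hconsf 0, τ0]
    have e0 := hsol.equation t0 ht0 x
    have d1 := HS.hasDerivAt_cons hs x 0
    simp only [hcons] at d1
    have sh : ContDiff ℝ (⊤ : ℕ∞) (fun s : ℝ => h s x) := hsol.smooth.comp (contDiff_id.prodMk contDiff_const)
    have d2 : HasDerivAt (fun s => h s x) (deriv (fun s => h s x) t0) (τ 0) := by
      rw [τ0]; exact (sh.differentiable (by simp) t0).hasDerivAt
    have d3 := d2.comp 0 dτ
    have := d1.unique d3
    rw [this, mul_one]; exact e0
  obtain ⟨g, sg, hg, hmain⟩ := HS.main_slice ht hs hper hE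
  have hd : deriv (fun s => HSB n h s x) t0 = HS.DD 0 g (Fin.cons 0 x) := by
    set σ : ℝ → ℝ := fun t => Real.arcsin (2 * Real.pi * (t - t0)) / (2 * Real.pi) with hσ
    have σ0 : σ t0 = 0 := by simp [hσ]
    have dσ : HasDerivAt σ 1 t0 := by
      have h1 : HasDerivAt (fun t : ℝ => 2 * Real.pi * (t - t0)) (2 * Real.pi) t0 := by
        simpa using ((hasDerivAt_id t0).sub_const t0).const_mul (2 * Real.pi)
      have h2 : HasDerivAt Real.arcsin 1 (2 * Real.pi * (t0 - t0)) := by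
        have := Real.hasDerivAt_arcsin (x := 2 * Real.pi * (t0 - t0)) (by simp) (by simp)
        refine this.congr_deriv ?_
        simp
      have h3 := (HasDerivAt.comp t0 h2 h1).div_const (2 * Real.pi)
      refine h3.congr_deriv ?_
      simp [pi2]
    have d1 : HasDerivAt (fun s : ℝ => g (Fin.cons s x)) (HS.DD 0 g (Fin.cons 0 x)) (σ t0) := by
      rw [σ0]; exact HS.hasDerivAt_cons sg x 0
    have d2 := d1.comp t0 dσ
    rw [mul_one] at d2
    have ev : (fun s => HSB n h s x) =ᶠ[nhds t0] (fun s : ℝ => g (Fin.cons s x)) ∘ σ := by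
      have hc : ContinuousAt (fun t : ℝ => 2 * Real.pi * (t - t0)) t0 := by fun_prop
      have hm : Set.Icc (-1:ℝ) 1 ∈ nhds (2 * Real.pi * (t0 - t0)) := by
        simp only [sub_self, mul_zero]
        exact Icc_mem_nhds (by norm_num) (by norm_num)
      filter_upwards [hc.preimage_mem_nhds hm] with t hts
      have hts' : 2 * Real.pi * (t - t0) ∈ Set.Icc (-1:ℝ) 1 := hts
      have e : τ (σ t) = t := by
        simp only [hτ, hσ]
        rw [mul_div_cancel₀ _ pi2, Real.sin_arcsin hts'.1 hts'.2, mul_div_cancel_left₀ _ pi2]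
        ring
      have := hg (σ t) x
      rw [hconsf, e] at this
      exact this
    exact (d2.congr_of_eventuallyEq ev).deriv
  rw [hd]
  exact hmain h t0 (by rw [hconsf 0, τ0]) x

end
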